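/- arXiv:1808.02224 — 7 statements merged into one kernel-verified Lean document; each statement's English description precedes it below -/
import Mathlib

section
/- Let F be a field and V an infinite-dimensional F-vector space. Then every linear automorphism u of V is the product of four involutions: there exist linear automorphisms a₁, a₂, a₃, a₄ of V with aᵢ ∘ aᵢ = id_V for i = 1,2,3,4 and u = a₁ ∘ a₂ ∘ a₃ ∘ a₄. -/
open Cardinal

section Involutions

variable {F E V V' : Type*} [Field F] [AddCommGroup E] [Module F E]
  [AddCommGroup V] [Module F V] [AddCommGroup V'] [Module F V']

theorem conj_mul_conj (e : V ≃ₗ[F] V') (f g : Module.End F V) :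
    e.conj (f * g) = e.conj f * e.conj g :=
  e.conj_comp g f

/-- An automorphism with a wandering subspace `ι E` whose translates span is a bilateral shift,
hence a product of two involutions. -/
theorem exists_two_involutions_of_wandering (g : V ≃ₗ[F] V) (ι : E →ₗ[F] V) (β : V →ₗ[F] E)
    (hβι : ∀ x, β (ι x) = x) (hβ : ∀ (n : ℤ), n < 0 → ∀ x, β ((g ^ n) (ι x)) = 0)
    (hspan : ∀ S : Submodule F V, (∀ x, ι x ∈ S) → (∀ y ∈ S, g y ∈ S) →
      (∀ y ∈ S, g.symm y ∈ S) → S = ⊤) :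
    ∃ a b : Module.End F V, a * a = 1 ∧ b * b = 1 ∧ (g : Module.End F V) = a * b := by
  let Ψ : (ℤ →₀ E) →ₗ[F] V :=
    Finsupp.lsum F fun n : ℤ => ((g ^ n : V ≃ₗ[F] V) : V →ₗ[F] V) ∘ₗ ι
  have hΨ : ∀ n x, Ψ (Finsupp.single n x) = (g ^ n) (ι x) := fun n x => by simp [Ψ]
  have hshift : ∀ (m : ℤ) (f : ℤ →₀ E),
      (g ^ m) (Ψ f) = Ψ (Finsupp.lmapDomain E F (fun n => m + n) f) := by
    intro m f
    induction f using Finsupp.induction_linear with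
    | zero => simp
    | add f f' h h' => simp only [map_add, h, h']
    | single n x =>
      simp only [Finsupp.lmapDomain_apply, Finsupp.mapDomain_single, hΨ, zpow_add]
      rfl
  have hβΨ : ∀ f : ℤ →₀ E, (∀ n ∈ f.support, n ≤ 0) → β (Ψ f) = f 0 := by
    intro f hf
    have h1 : β (Ψ f) = f.sum fun n x => β ((g ^ n) (ι x)) := by
      simp [Ψ, Finsupp.sum, map_sum]
    rw [h1, Finsupp.sum, Finset.sum_eq_single 0]
    · simp [hβι]
    · intro n hn hn0
      exact hβ n (lt_of_le_of_ne (hf n hn) hn0) _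
    · intro h0
      simp [Finsupp.notMem_support_iff.1 h0]
  have hinj : Function.Injective Ψ := by
    rw [injective_iff_map_eq_zero]
    intro f hf
    by_contra hne
    have hs : f.support.Nonempty := Finsupp.support_nonempty_iff.2 hne
    set M := f.support.max' hs
    have hinjM : Function.Injective fun n : ℤ => -M + n := add_right_injective _
    have h1 := hβΨ (Finsupp.lmapDomain E F (fun n => -M + n) f) (by
      classical
      intro n hn
      obtain ⟨k, hk, rfl⟩ := Finset.mem_image.1 (Finsupp.mapDomain_support hn)
      have := f.support.le_max' k hk
      omega)
    rw [← hshift, hf] at h1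
    have h2 : Finsupp.mapDomain (fun n : ℤ => -M + n) f (-M + M) = f M :=
      Finsupp.mapDomain_apply hinjM f M
    rw [neg_add_cancel] at h2
    simp only [map_zero, Finsupp.lmapDomain_apply, h2] at h1
    exact Finsupp.mem_support_iff.1 (f.support.max'_mem hs) h1.symm
  have hsurj : Function.Surjective Ψ := by
    rw [← LinearMap.range_eq_top]
    refine hspan _ (fun x => ⟨Finsupp.single 0 x, by simp [hΨ]⟩) ?_ ?_
    · rintro _ ⟨f, rfl⟩
      exact ⟨_, (hshift 1 f).symm.trans (by simp)⟩
    · rintro _ ⟨f, rfl⟩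
      exact ⟨_, (hshift (-1) f).symm.trans (by simp)⟩
  let e := LinearEquiv.ofBijective Ψ ⟨hinj, hsurj⟩
  let r : ℤ → Module.End F V := fun m => e.conj (Finsupp.lmapDomain E F fun n => m - n)
  have hr : ∀ m, r m * r m = 1 := by
    intro m
    simp only [r]
    rw [← conj_mul_conj]
    have : (Finsupp.lmapDomain E F fun n => m - n) * (Finsupp.lmapDomain E F fun n => m - n) =
        (1 : Module.End F (ℤ →₀ E)) := by
      ext n x : 2
      simp
    rw [this]
    exact LinearEquiv.conj_id e
  refine ⟨r 1, r 0, hr 1, hr 0, ?_⟩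
  simp only [r]
  rw [← conj_mul_conj]
  ext y
  obtain ⟨f, rfl⟩ := e.surjective y
  rw [LinearEquiv.conj_apply_apply, LinearEquiv.symm_apply_apply]
  have h1 : (Finsupp.lmapDomain E F fun n : ℤ => 1 - n) * (Finsupp.lmapDomain E F fun n => 0 - n)
      = Finsupp.lmapDomain E F fun n : ℤ => 1 + n := by
    ext n x : 2
    simp
  rw [h1]
  exact hshift 1 f

theorem exists_three_involutions_conj (e : V ≃ₗ[F] V') (u : Module.End F V)
    (h : ∃ a b c : Module.End F V', a * a = 1 ∧ b * b = 1 ∧ c * c = 1 ∧ e.conj u = a * b * c) :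
    ∃ a b c : Module.End F V, a * a = 1 ∧ b * b = 1 ∧ c * c = 1 ∧ u = a * b * c := by
  obtain ⟨a, b, c, ha, hb, hc, h⟩ := h
  have h1 : e.symm.conj 1 = 1 := LinearEquiv.conj_id _
  refine ⟨e.symm.conj a, e.symm.conj b, e.symm.conj c, ?_, ?_, ?_, ?_⟩
  · rw [← conj_mul_conj, ha, h1]
  · rw [← conj_mul_conj, hb, h1]
  · rw [← conj_mul_conj, hc, h1]
  · rw [← conj_mul_conj, ← conj_mul_conj, ← h]
    ext x
    simp

/-- Prepending an entry to a finitely supported sequence. -/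
noncomputable def finsuppCons : (E × (ℕ →₀ E)) →ₗ[F] (ℕ →₀ E) :=
  (Finsupp.lsingle 0).coprod (Finsupp.lmapDomain E F Nat.succ)

/-- Deleting the first entry of a finitely supported sequence. -/
noncomputable def finsuppTail : (ℕ →₀ E) →ₗ[F] (ℕ →₀ E) :=
  Finsupp.lcomapDomain Nat.succ Nat.succ_injective

theorem finsuppCons_apply_zero (x : E) (p : ℕ →₀ E) :
    (finsuppCons (F := F) (x, p)) 0 = x := by
  simp [finsuppCons, Finsupp.mapDomain_of_notMem_range]

theorem finsuppTail_cons (x : E) (p : ℕ →₀ E) :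
    finsuppTail (F := F) (finsuppCons (F := F) (x, p)) = p := by
  ext n
  simp [finsuppCons, finsuppTail, Finsupp.lcomapDomain, Finsupp.comapDomain_apply,
    Finsupp.mapDomain_apply Nat.succ_injective]

theorem finsuppCons_tail (p : ℕ →₀ E) :
    finsuppCons (F := F) (p 0, finsuppTail (F := F) p) = p := by
  ext n
  cases n with
  | zero => exact finsuppCons_apply_zero _ _
  | succ n =>
    simp [finsuppCons, finsuppTail, Finsupp.lcomapDomain, Finsupp.comapDomain_apply,
      Finsupp.mapDomain_apply Nat.succ_injective]

theorem finsuppCons_zero_single (n : ℕ) (x : E) :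
    finsuppCons (F := F) (0, Finsupp.single n x) = Finsupp.single (n + 1) x := by
  simp [finsuppCons]

theorem finsuppCons_single_zero (x : E) :
    finsuppCons (F := F) (x, 0) = Finsupp.single 0 x := by
  simp [finsuppCons]

/-- In the coordinates `∑_{n > 0} E ⊕ ∑_{n < 0} E ⊕ E`, the reflection `n ↦ 1 - n` of the indices
turns the given automorphism into a bilateral shift up to terms of lower index. -/
theorem exists_three_involutions_of_swap_of_triangular
    (w : ((ℕ →₀ E) × (ℕ →₀ E) × E) ≃ₗ[F] ((ℕ →₀ E) × (ℕ →₀ E) × E)) {c : F} (hc : c ≠ 0)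
    (Y : E →ₗ[F] (ℕ →₀ E)) (v : E →ₗ[F] E)
    (hw : ∀ p q b, w (p, q, b) = (c • q + Y b, c • p, v b)) :
    ∃ a₁ a₂ a₃ : Module.End F ((ℕ →₀ E) × (ℕ →₀ E) × E),
      a₁ * a₁ = 1 ∧ a₂ * a₂ = 1 ∧ a₃ * a₃ = 1 ∧ (w : Module.End F _) = a₁ * a₂ * a₃ := by
  let a : Module.End F ((ℕ →₀ E) × (ℕ →₀ E) × E) :=
    { toFun := fun x => (finsuppCons (F := F) (x.2.2, x.2.1), finsuppTail (F := F) x.1, x.1 0)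
      map_add' := fun x y => Prod.ext
        (map_add finsuppCons (x.2.2, x.2.1) (y.2.2, y.2.1)) (Prod.ext (map_add _ _ _) rfl)
      map_smul' := fun r x => Prod.ext
        (map_smul finsuppCons r (x.2.2, x.2.1)) (Prod.ext (map_smul _ _ _) rfl) }
  have ha_apply : ∀ p q b, a (p, q, b) =
      (finsuppCons (F := F) (b, q), finsuppTail (F := F) p, p 0) := fun _ _ _ => rfl
  have ha : a * a = 1 := by
    refine LinearMap.ext ?_
    rintro ⟨p, q, b⟩
    simp only [Module.End.mul_apply, ha_apply, Module.End.one_apply, finsuppCons_tail,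
      finsuppTail_cons, finsuppCons_apply_zero]
  have ha' : Function.Involutive a := fun x => LinearMap.congr_fun ha x
  let g := w.trans (LinearEquiv.ofInvolutive a ha')
  have hg : ∀ p q b, g (p, q, b) = (finsuppCons (F := F) (v b, c • p),
      finsuppTail (F := F) (c • q + Y b), (c • q + Y b) 0) := fun p q b => by
    change a (w (p, q, b)) = _
    rw [hw, ha_apply]
  have hgs : ∀ q b, g.symm (0, q, b) = (0, c⁻¹ • finsuppCons (F := F) (b, q), 0) := fun q b => by
    rw [LinearEquiv.symm_apply_eq, hg]
    simp only [smul_inv_smul₀ hc, map_zero, add_zero, smul_zero, finsuppTail_cons,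
      finsuppCons_apply_zero, ← Prod.zero_eq_mk]
  have hv : Function.Surjective v := fun x => by
    obtain ⟨⟨p, q, b⟩, h⟩ := w.surjective (0, 0, x)
    rw [hw] at h
    exact ⟨b, congrArg (fun y => y.2.2) h⟩
  obtain ⟨b₁, b₂, hb₁, hb₂, hgb⟩ := exists_two_involutions_of_wandering g
    (LinearMap.inr F (ℕ →₀ E) ((ℕ →₀ E) × E) ∘ₗ LinearMap.inr F (ℕ →₀ E) E)
    (LinearMap.snd F (ℕ →₀ E) E ∘ₗ LinearMap.snd F (ℕ →₀ E) ((ℕ →₀ E) × E))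
    (fun x => rfl) (by
      intro n hn x
      obtain ⟨k, rfl⟩ : ∃ k : ℕ, n = -((k : ℤ) + 1) := ⟨(-n - 1).toNat, by omega⟩
      have key : ∃ q, (g ^ (-((k : ℤ) + 1))) (0, 0, x) = (0, q, 0) := by
        induction k with
        | zero => exact ⟨_, hgs 0 x⟩
        | succ k ih =>
          obtain ⟨q, hq⟩ := ih (by omega)
          refine ⟨c⁻¹ • finsuppCons (F := F) (0, q), ?_⟩
          have : -(((k + 1 : ℕ) : ℤ) + 1) = -1 + -((k : ℤ) + 1) := by push_cast; ring
          rw [this, zpow_add, LinearEquiv.mul_apply, hq, zpow_neg_one]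
          exact hgs q 0
      obtain ⟨q, hq⟩ := key
      exact congrArg (fun y => y.2.2) hq) (by
      intro S h0 hS hS'
      replace h0 : ∀ x, ((0, 0, x) : (ℕ →₀ E) × (ℕ →₀ E) × E) ∈ S := h0
      have hq1 : ∀ n x, ((0, Finsupp.single n x, 0) : (ℕ →₀ E) × (ℕ →₀ E) × E) ∈ S := by
        intro n
        induction n with
        | zero =>
          intro x
          have := hS' _ (h0 (c • x))
          rwa [hgs, finsuppCons_single_zero, Finsupp.smul_single, inv_smul_smul₀ hc] at this
        | succ n ih =>
          intro x
          have := hS' _ (ih (c • x))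
          rwa [hgs, finsuppCons_zero_single, Finsupp.smul_single, inv_smul_smul₀ hc] at this
      have hq : ∀ q, ((0, q, 0) : (ℕ →₀ E) × (ℕ →₀ E) × E) ∈ S := by
        intro q
        induction q using Finsupp.induction_linear with
        | zero => exact S.zero_mem
        | add q q' h h' => simpa using S.add_mem h h'
        | single n x => exact hq1 n x
      have hp1 : ∀ n x, ((Finsupp.single n x, 0, 0) : (ℕ →₀ E) × (ℕ →₀ E) × E) ∈ S := by
        intro n
        induction n with
        | zero =>
          intro x
          obtain ⟨b, rfl⟩ := hv x
          have h1 := hS _ (h0 b)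
          rw [hg, smul_zero, zero_add, finsuppCons_single_zero] at h1
          have h2 := S.sub_mem (S.sub_mem h1 (hq (finsuppTail (F := F) (Y b)))) (h0 (Y b 0))
          rwa [Prod.mk_sub_mk, Prod.mk_sub_mk, Prod.mk_sub_mk, Prod.mk_sub_mk, sub_zero, sub_zero,
            sub_self, sub_zero, sub_zero, sub_self] at h2
        | succ n ih =>
          intro x
          have := hS _ (ih (c⁻¹ • x))
          rw [hg, Finsupp.smul_single, smul_inv_smul₀ hc, map_zero, finsuppCons_zero_single] at this
          simpa using this
      have hp : ∀ p, ((p, 0, 0) : (ℕ →₀ E) × (ℕ →₀ E) × E) ∈ S := by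
        intro p
        induction p using Finsupp.induction_linear with
        | zero => exact S.zero_mem
        | add q q' h h' => simpa using S.add_mem h h'
        | single n x => exact hp1 n x
      rw [eq_top_iff]
      rintro ⟨p, q, b⟩ -
      simpa using S.add_mem (S.add_mem (hp p) (hq q)) (h0 b))
  refine ⟨a, b₁, b₂, ha, hb₁, hb₂, ?_⟩
  rw [mul_assoc, ← hgb]
  refine LinearMap.ext fun x => ?_
  exact (ha' (w x)).symm

/-- An automorphism that acts on a large invariant subspace with large complement as a multiple of
the swap of two halves is a product of three involutions. -/
theorem exists_three_involutions_of_swap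
    (w : ((ℕ →₀ E) × (ℕ →₀ E) × E) ≃ₗ[F] ((ℕ →₀ E) × (ℕ →₀ E) × E)) {c : F} (hc : c ≠ 0)
    (hw : ∀ p q, w (p, q, 0) = (c • q, c • p, 0)) :
    ∃ a₁ a₂ a₃ : Module.End F ((ℕ →₀ E) × (ℕ →₀ E) × E),
      a₁ * a₁ = 1 ∧ a₂ * a₂ = 1 ∧ a₃ * a₃ = 1 ∧ (w : Module.End F _) = a₁ * a₂ * a₃ := by
  let N := ℕ →₀ E
  let i : E →ₗ[F] N × N × E := LinearMap.inr F N (N × E) ∘ₗ LinearMap.inr F N E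
  let y : E →ₗ[F] N := LinearMap.fst F N (N × E) ∘ₗ w ∘ₗ i
  let z : E →ₗ[F] N := LinearMap.fst F N E ∘ₗ LinearMap.snd F N (N × E) ∘ₗ w ∘ₗ i
  let v : E →ₗ[F] E := LinearMap.snd F N E ∘ₗ LinearMap.snd F N (N × E) ∘ₗ w ∘ₗ i
  have hw' : ∀ p q b, w (p, q, b) = (c • q + y b, c • p + z b, v b) := by
    intro p q b
    have h1 : ((p, q, b) : N × N × E) = (p, q, 0) + i b := by simp [i]
    have h2 : w (i b) = (y b, z b, v b) := rfl
    rw [h1, map_add, hw, h2]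
    simp
  let X : E →ₗ[F] N := c⁻¹ • z
  let t : (N × N × E) ≃ₗ[F] (N × N × E) :=
    { toFun := fun x => (x.1 + X x.2.2, x.2.1, x.2.2)
      invFun := fun x => (x.1 - X x.2.2, x.2.1, x.2.2)
      map_add' := fun x x' => by
        ext1
        · simp only [Prod.fst_add, Prod.snd_add, map_add]; abel
        · rfl
      map_smul' := fun r x => by
        ext1
        · simp
        · rfl
      left_inv := fun x => by simp
      right_inv := fun x => by simp }
  refine exists_three_involutions_conj t _ ?_
  obtain ⟨a₁, a₂, a₃, h₁, h₂, h₃, h⟩ := exists_three_involutions_of_swap_of_triangular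
    ((t.symm.trans w).trans t) hc (y + X ∘ₗ v) v (by
      intro p q b
      change t (w (p - X b, q, b)) = _
      rw [hw']
      have hX : c • X b = z b := smul_inv_smul₀ hc (z b)
      change (c • q + y b + X (v b), c • (p - X b) + z b, v b) = _
      rw [smul_sub, hX, sub_add_cancel, add_assoc]
      rfl)
  exact ⟨a₁, a₂, a₃, h₁, h₂, h₃, h⟩

end Involutions

section Decomposition

variable {F V : Type*} [Field F] [AddCommGroup V] [Module F V]

/-- An injective linear map is the inclusion of a direct factor. -/
theorem exists_prod_equiv_of_injective {A : Type*} [AddCommGroup A] [Module F A]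
    (j : A →ₗ[F] V) (hj : Function.Injective j) :
    ∃ (C : Submodule F V) (e : (A × C) ≃ₗ[F] V), ∀ x, e (x, 0) = j x := by
  obtain ⟨C, hC⟩ := Submodule.exists_isCompl (LinearMap.range j)
  refine ⟨C, ((LinearEquiv.ofInjective j hj).prodCongr (LinearEquiv.refl F C)).trans
    (Submodule.prodEquivOfIsCompl _ _ hC), fun x => ?_⟩
  simp

theorem exists_maximal_disjoint_map (u : V ≃ₗ[F] V) :
    ∃ P : Submodule F V, Disjoint P (P.map (u : V →ₗ[F] V)) ∧
      ∀ x ∉ P ⊔ P.map (u : V →ₗ[F] V), ∃ d : F, u x - d • x ∈ P ⊔ P.map (u : V →ₗ[F] V) := by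
  obtain ⟨P, hP⟩ := zorn_le₀ {P : Submodule F V | Disjoint P (P.map (u : V →ₗ[F] V))} (by
    intro c hc hchain
    rcases c.eq_empty_or_nonempty with rfl | hne
    · exact ⟨⊥, disjoint_bot_left, by simp⟩
    refine ⟨sSup c, ?_, fun z hz => le_sSup hz⟩
    rw [Set.mem_ofPred_eq, Submodule.disjoint_def]
    rintro _ hx ⟨y, hy, rfl⟩
    rw [SetLike.mem_coe] at hy
    rw [Submodule.mem_sSup_of_directed hne hchain.directedOn] at hx hy
    obtain ⟨P, hP, hx⟩ := hx
    obtain ⟨Q, hQ, hy⟩ := hy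
    rcases hchain.total hP hQ with h | h
    · exact (Submodule.disjoint_def.1 (hc hQ)) _ (h hx) ⟨y, hy, rfl⟩
    · exact (Submodule.disjoint_def.1 (hc hP)) _ hx ⟨y, h hy, rfl⟩)
  have hdis : Disjoint P (P.map (u : V →ₗ[F] V)) := hP.prop
  refine ⟨P, hdis, fun x hx => ?_⟩
  set M := P ⊔ P.map (u : V →ₗ[F] V)
  have hPM : ∀ p ∈ P, p ∈ M := fun p hp => le_sup_left (a := P) hp
  have huPM : ∀ p ∈ P, u p ∈ M := fun p hp =>
    le_sup_right (a := P) (Submodule.mem_map_of_mem hp)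
  have hnot : ¬ Disjoint (P ⊔ F ∙ x) ((P ⊔ F ∙ x).map (u : V →ₗ[F] V)) := fun h =>
    hx (hPM x (hP.le_of_ge h le_sup_left
      (le_sup_right (a := P) (Submodule.mem_span_singleton_self x))))
  rw [Submodule.disjoint_def] at hnot
  push Not at hnot
  obtain ⟨_, h1, ⟨y, hy, rfl⟩, hne⟩ := hnot
  rw [SetLike.mem_coe] at hy
  rw [Submodule.mem_sup] at h1 hy
  obtain ⟨p, hp, _, hr, h1⟩ := h1
  obtain ⟨p', hp', _, hr', rfl⟩ := hy
  obtain ⟨r, rfl⟩ := Submodule.mem_span_singleton.1 hr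
  obtain ⟨r', rfl⟩ := Submodule.mem_span_singleton.1 hr'
  have h2 : p + r • x = u p' + r' • u x := by simpa using h1
  have hr'0 : r' ≠ 0 := by
    rintro rfl
    by_cases hr0 : r = 0
    · subst hr0
      apply hne
      simp only [zero_smul, add_zero] at h2 ⊢
      exact Submodule.disjoint_def.1 hdis _ (by simpa [← h2] using hp)
        (Submodule.mem_map_of_mem hp')
    · have h3 : r • x ∈ M := by
        have : r • x = u p' - p := by rw [eq_sub_iff_add_eq']; simpa using h2
        rw [this]
        exact M.sub_mem (huPM _ hp') (hPM _ hp)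
      exact hx ((M.smul_mem_iff hr0).1 h3)
  refine ⟨r'⁻¹ * r, ?_⟩
  rw [← M.smul_mem_iff hr'0]
  have : r' • (u x - (r'⁻¹ * r) • x) = p - u p' := by
    rw [smul_sub, smul_smul, mul_inv_cancel_left₀ hr'0, sub_eq_sub_iff_add_eq_add, h2, add_comm]
  rw [this]
  exact M.sub_mem (hPM _ hp) (huPM _ hp')

theorem exists_apply_sub_smul_mem (u : V →ₗ[F] V) (M : Submodule F V)
    (hM : ∀ y, M ⊔ F ∙ y ≠ ⊤) (hu : ∀ x ∉ M, ∃ d : F, u x - d • x ∈ M) :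
    ∃ d : F, ∀ x, u x - d • x ∈ M := by
  obtain ⟨y, -, hy⟩ := SetLike.exists_of_lt (lt_top_iff_ne_top.2 fun h : M = ⊤ => hM 0 (by simp [h]))
  obtain ⟨d, hd⟩ := hu y hy
  have hyM : y ∈ M ⊔ F ∙ y :=
    le_sup_right (a := M) (Submodule.mem_span_singleton_self y)
  have hout : ∀ x ∉ M ⊔ F ∙ y, u x - d • x ∈ M := by
    intro x hx
    have hxM : x ∉ M := fun h => hx (le_sup_left (a := M) h)
    have hxyM : x + y ∉ M := fun h => hx (by
      simpa using (M ⊔ F ∙ y).sub_mem (le_sup_left (a := M) h) hyM)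
    obtain ⟨d₁, hd₁⟩ := hu x hxM
    obtain ⟨d₂, hd₂⟩ := hu (x + y) hxyM
    have h1 : (d₂ - d₁) • x + (d₂ - d) • y ∈ M := by
      have := M.sub_mem (M.add_mem hd₁ hd) hd₂
      rw [map_add] at this
      convert this using 1
      module
    have h2 : d₂ = d₁ := by
      by_contra hne
      apply hx
      rw [← Submodule.smul_mem_iff _ (sub_ne_zero.2 hne)]
      simpa using (M ⊔ F ∙ y).sub_mem (le_sup_left (a := M) h1)
        ((M ⊔ F ∙ y).smul_mem (d₂ - d) hyM)
    have h3 : d₂ = d := by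
      by_contra hne
      apply hy
      rw [← Submodule.smul_mem_iff _ (sub_ne_zero.2 hne)]
      simpa [h2] using h1
    rwa [← h3, h2]
  refine ⟨d, fun x => ?_⟩
  by_cases hx : x ∈ M ⊔ F ∙ y
  · obtain ⟨z, -, hz⟩ := SetLike.exists_of_lt (lt_top_iff_ne_top.2 (hM y))
    have hxz : x + z ∉ M ⊔ F ∙ y := fun h => hz (by simpa using (M ⊔ F ∙ y).sub_mem h hx)
    have := M.sub_mem (hout _ hxz) (hout _ hz)
    rw [map_add] at this
    convert this using 1
    module
  · exact hout x hx

/-- Every automorphism of an infinite-dimensional space either moves some subspace of full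
dimension off itself, or has an eigenspace of full dimension. -/
theorem exists_disjoint_map_or_exists_eigenspace (hV : ℵ₀ ≤ Module.rank F V) (u : V ≃ₗ[F] V) :
    (∃ P : Submodule F V, Disjoint P (P.map (u : V →ₗ[F] V)) ∧
      Module.rank F P = Module.rank F V) ∨
    ∃ (c : F) (P : Submodule F V), c ≠ 0 ∧ (∀ x ∈ P, u x = c • x) ∧
      Module.rank F P = Module.rank F V := by
  obtain ⟨P, hdis, hP⟩ := exists_maximal_disjoint_map u
  rcases (Submodule.rank_le P).eq_or_lt with hr | hr
  · exact Or.inl ⟨P, hdis, hr⟩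
  right
  set M := P ⊔ P.map (u : V →ₗ[F] V)
  have hMr : Module.rank F M < Module.rank F V :=
    (Submodule.rank_add_le_rank_add_rank _ _).trans_lt
      (add_lt_of_lt hV hr ((rank_map_le _ _).trans_lt hr))
  obtain ⟨c, hc⟩ := exists_apply_sub_smul_mem (u : V →ₗ[F] V) M (by
    intro y h
    have h1 : Module.rank F ↥(M ⊔ F ∙ y) < Module.rank F V :=
      (Submodule.rank_add_le_rank_add_rank _ _).trans_lt
        (add_lt_of_lt hV hMr ((rank_span_le _).trans_lt
          ((by simp : #({y} : Set V) < ℵ₀).trans_le hV)))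
    rw [h, rank_top] at h1
    exact h1.false) hP
  set f : V →ₗ[F] V := (u : V →ₗ[F] V) - c • LinearMap.id
  have hker : Module.rank F (LinearMap.ker f) = Module.rank F V := by
    refine (Submodule.rank_le _).eq_or_lt.resolve_right fun hlt => ?_
    have h1 : Module.rank F (LinearMap.range f) < Module.rank F V := by
      refine (Submodule.rank_mono ?_).trans_lt hMr
      rintro _ ⟨x, rfl⟩
      exact hc x
    exact (add_lt_of_lt hV h1 hlt).ne (LinearMap.rank_range_add_rank_ker f)
  have hf : ∀ x ∈ LinearMap.ker f, u x = c • x := fun x hx => sub_eq_zero.1 hx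
  refine ⟨c, LinearMap.ker f, ?_, hf, hker⟩
  rintro rfl
  have : LinearMap.ker f = ⊥ := by
    rw [Submodule.eq_bot_iff]
    intro x hx
    simpa using hf x hx
  rw [this, rank_bot] at hker
  exact (aleph0_pos.trans_le hV).ne hker

theorem rank_nat_finsupp (hV : ℵ₀ ≤ Module.rank F V) :
    Module.rank F (ℕ →₀ V) = Module.rank F V := by
  simp [rank_finsupp, aleph0_mul_eq hV]

theorem rank_prod_nat_finsupp (hV : ℵ₀ ≤ Module.rank F V) :
    Module.rank F ((ℕ →₀ V) × (ℕ →₀ V)) = Module.rank F V := by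
  rw [rank_prod', rank_nat_finsupp hV, add_eq_self hV]

theorem exists_coordinates {D : Type*} [AddCommGroup D] [Module F D] (hV : ℵ₀ ≤ Module.rank F V)
    (δ : D ≃ₗ[F] V) (j : (((ℕ →₀ V) × (ℕ →₀ V)) × D) →ₗ[F] V) (hj : Function.Injective j) :
    ∃ (C : Submodule F V) (e₀ : ((((ℕ →₀ V) × (ℕ →₀ V)) × D) × C) ≃ₗ[F] V)
      (e : ((ℕ →₀ V) × (ℕ →₀ V) × V) ≃ₗ[F] V),
      (∀ x, e₀ (x, 0) = j x) ∧ ∀ p q, e (p, q, 0) = j ((p, q), 0) := by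
  obtain ⟨C, e₀, he₀⟩ := exists_prod_equiv_of_injective j hj
  have hr : Module.rank F V = Module.rank F (V × C) := by
    rw [rank_prod', add_eq_left hV (Submodule.rank_le C)]
  let ψ : V ≃ₗ[F] (D × C) :=
    (LinearEquiv.ofRankEq _ _ hr).trans (δ.symm.prodCongr (LinearEquiv.refl F C))
  refine ⟨C, e₀, (LinearEquiv.prodAssoc F _ _ _).symm.trans
    ((((LinearEquiv.refl F ((ℕ →₀ V) × (ℕ →₀ V))).prodCongr ψ).trans
      (LinearEquiv.prodAssoc F _ _ _).symm).trans e₀), he₀, fun p q => ?_⟩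
  rw [← he₀]
  change e₀ (((p, q), (ψ 0).1), (ψ 0).2) = _
  rw [map_zero]
  rfl

theorem exists_four_involutions_of_swap (u : V ≃ₗ[F] V)
    (e : ((ℕ →₀ V) × (ℕ →₀ V) × V) ≃ₗ[F] V) (a : Module.End F V) (ha : a * a = 1) {c : F}
    (hc : c ≠ 0) (hau : ∀ p q, a (u (e (p, q, 0))) = e (c • q, c • p, 0)) :
    ∃ a₁ a₂ a₃ a₄ : Module.End F V,
      a₁ * a₁ = 1 ∧ a₂ * a₂ = 1 ∧ a₃ * a₃ = 1 ∧ a₄ * a₄ = 1 ∧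
      (u : Module.End F V) = a₁ * a₂ * a₃ * a₄ := by
  have ha' : Function.Involutive a := fun x => LinearMap.congr_fun ha x
  let g := u.trans (LinearEquiv.ofInvolutive a ha')
  obtain ⟨b₁, b₂, b₃, h₁, h₂, h₃, h⟩ := exists_three_involutions_conj e.symm (g : Module.End F V)
    (exists_three_involutions_of_swap ((e.trans g).trans e.symm) hc fun p q =>
      e.symm_apply_eq.2 (hau p q))
  refine ⟨a, b₁, b₂, b₃, ha, h₁, h₂, h₃, ?_⟩
  rw [mul_assoc, mul_assoc, ← mul_assoc b₁, ← h]
  exact LinearMap.ext fun x => (ha' (u x)).symm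

end Decomposition

theorem product_of_four_involutions
    {F V : Type*} [Field F] [AddCommGroup V] [Module F V]
    (hV : ℵ₀ ≤ Module.rank F V) (u : V ≃ₗ[F] V) :
    ∃ a₁ a₂ a₃ a₄ : Module.End F V,
      a₁ * a₁ = 1 ∧ a₂ * a₂ = 1 ∧ a₃ * a₃ = 1 ∧ a₄ * a₄ = 1 ∧
      (u : Module.End F V) = a₁ * a₂ * a₃ * a₄ := by
  let N := ℕ →₀ V
  let σ : (N × N) ≃ₗ[F] (N × N) := LinearEquiv.prodComm F N N
  rcases exists_disjoint_map_or_exists_eigenspace hV u with ⟨P, hdis, hP⟩ | ⟨c, P, hc, hPc, hP⟩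
  · let f : (N × N) ≃ₗ[F] P := LinearEquiv.ofRankEq _ _ ((rank_prod_nat_finsupp hV).trans hP.symm)
    let k : (N × N) →ₗ[F] V := P.subtype ∘ₗ f
    have hk : ∀ x, k x ∈ P := fun x => (f x).2
    have hk0 : ∀ x, k x = 0 → x = 0 := fun x hx => f.map_eq_zero_iff.1 (Subtype.ext hx)
    obtain ⟨C, e₀, e, he₀, he⟩ := exists_coordinates hV
      (LinearEquiv.ofRankEq _ _ (rank_prod_nat_finsupp hV)) (k.coprod ((u : V →ₗ[F] V) ∘ₗ k)) (by
        rw [injective_iff_map_eq_zero]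
        rintro ⟨x, y⟩ h
        have h1 : k x + u (k y) = 0 := h
        have h2 : u (k (-y)) = k x := by
          rw [map_neg, map_neg, eq_comm, ← add_eq_zero_iff_eq_neg, h1]
        have h3 : k x = 0 := Submodule.disjoint_def.1 hdis _ (hk x) ⟨_, hk (-y), h2⟩
        rw [h3, zero_add, u.map_eq_zero_iff] at h1
        rw [hk0 x h3, hk0 y h1, Prod.mk_zero_zero])
    let s : Module.End F (((N × N) × (N × N)) × C) :=
      LinearMap.prodMap (((σ : (N × N) →ₗ[F] (N × N)) ∘ₗ LinearMap.snd F _ _).prod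
        ((σ : (N × N) →ₗ[F] (N × N)) ∘ₗ LinearMap.fst F _ _)) LinearMap.id
    have hs : s * s = 1 := LinearMap.ext fun _ => rfl
    refine exists_four_involutions_of_swap u e (e₀.conj s) ?_ one_ne_zero fun p q => ?_
    · rw [← conj_mul_conj, hs]
      exact LinearEquiv.conj_id e₀
    · have h1 : u (e (p, q, 0)) = e₀ ((0, (p, q)), 0) := by
        rw [he, he₀]
        simp
      rw [h1, LinearEquiv.conj_apply_apply, LinearEquiv.symm_apply_apply, one_smul, one_smul, he,
        ← he₀]
      exact congrArg e₀ rfl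
  · have hr : Module.rank F ((N × N) × V) = Module.rank F P := by
      rw [rank_prod', rank_prod_nat_finsupp hV, add_eq_self hV, hP]
    let f : ((N × N) × V) ≃ₗ[F] P := LinearEquiv.ofRankEq _ _ hr
    obtain ⟨C, e₀, e, he₀, he⟩ := exists_coordinates hV (LinearEquiv.refl F V)
      (P.subtype ∘ₗ f) (P.injective_subtype.comp f.injective)
    let s : Module.End F (((N × N) × V) × C) :=
      LinearMap.prodMap (LinearMap.prodMap (σ : (N × N) →ₗ[F] (N × N)) LinearMap.id) LinearMap.id
    have hs : s * s = 1 := LinearMap.ext fun _ => rfl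
    refine exists_four_involutions_of_swap u e (e₀.conj s) ?_ hc fun p q => ?_
    · rw [← conj_mul_conj, hs]
      exact LinearEquiv.conj_id e₀
    · have h1 : u (e (p, q, 0)) = e₀ (c • (((p, q), 0), 0)) := by
        rw [map_smul, he₀, he]
        exact hPc _ (f _).2
      rw [h1, LinearEquiv.conj_apply_apply, LinearEquiv.symm_apply_apply, he, ← he₀]
      have h2 : s (c • (((p, q), 0), 0)) = (((c • q, c • p), 0), 0) := by
        rw [map_smul]
        change c • (((q, p), 0), 0) = _
        simp
      rw [h2]
end

section
/- Let F be a field with at most 3 elements and V an infinite-dimensional F-vector space. Then every linear automorphism of V is the product of three involutions. -/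
open Cardinal

open Module Polynomial DirectSum

theorem mul_self_eq_one_of_mk_le_three {F : Type*} [Field F] (hF : Cardinal.mk F ≤ 3)
    {x : F} (hx : x ≠ 0) : x * x = 1 := by
  classical
  by_contra h
  have h1 : x ≠ 1 := by rintro rfl; simp at h
  have hinv : x⁻¹ ≠ x := fun e ↦ h (by nth_rw 1 [← e]; exact inv_mul_cancel₀ hx)
  have hle : ((({0, 1, x, x⁻¹} : Finset F).card : ℕ) : Cardinal) ≤ 3 :=
    (Cardinal.mk_coe_finset (s := ({0, 1, x, x⁻¹} : Finset F))) ▸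
      (Cardinal.mk_subtype_le _).trans hF
  have hcard : ({0, 1, x, x⁻¹} : Finset F).card = 4 := by
    rw [Finset.card_insert_of_notMem, Finset.card_insert_of_notMem,
      Finset.card_insert_of_notMem, Finset.card_singleton]
    · simpa using hinv.symm
    · simpa [eq_comm] using h1
    · simpa [eq_comm] using hx
  rw [hcard] at hle
  have : (4 : ℕ) ≤ 3 := by exact_mod_cast hle
  omega

/-- `f` is a product of three endomorphisms of square `1`. -/
def IsProdThreeInvolutions {F V : Type*} [Field F] [AddCommGroup V] [Module F V]
    (f : End F V) : Prop :=
  ∃ a b c : End F V, a * a = 1 ∧ b * b = 1 ∧ c * c = 1 ∧ f = a * b * c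

namespace IsProdThreeInvolutions

variable {F V W : Type*} [Field F] [AddCommGroup V] [Module F V] [AddCommGroup W] [Module F W]

theorem of_conj {f : End F V} {g : End F W} (e : V ≃ₗ[F] W) (h : ∀ x, e (f x) = g (e x))
    (hg : IsProdThreeInvolutions g) : IsProdThreeInvolutions f := by
  obtain ⟨a, b, c, ha, hb, hc, rfl⟩ := hg
  have hf : f = e.symm.conj (a * b * c) := by
    ext x
    simp [LinearEquiv.conj_apply, ← h]
  have hmul (p q : End F W) : e.symm.conj (p * q) = e.symm.conj p * e.symm.conj q :=
    e.symm.conj_comp q p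
  have hone : e.symm.conj (1 : End F W) = 1 := e.symm.conj_id
  exact ⟨e.symm.conj a, e.symm.conj b, e.symm.conj c, by rw [← hmul, ha, hone],
    by rw [← hmul, hb, hone], by rw [← hmul, hc, hone], by rw [hf, hmul, hmul]⟩

theorem prodMap {f : End F V} {g : End F W} (hf : IsProdThreeInvolutions f)
    (hg : IsProdThreeInvolutions g) :
    IsProdThreeInvolutions (f.prodMap g : End F (V × W)) := by
  obtain ⟨a, b, c, ha, hb, hc, rfl⟩ := hf
  obtain ⟨a', b', c', ha', hb', hc', rfl⟩ := hg
  refine ⟨a.prodMap a', b.prodMap b', c.prodMap c', ?_, ?_, ?_, ?_⟩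
  · rw [LinearMap.prodMap_mul, ha, ha', LinearMap.prodMap_one]
  · rw [LinearMap.prodMap_mul, hb, hb', LinearMap.prodMap_one]
  · rw [LinearMap.prodMap_mul, hc, hc', LinearMap.prodMap_one]
  · rw [LinearMap.prodMap_mul, LinearMap.prodMap_mul]

theorem lmap {ι : Type*} {M : ι → Type*} [∀ i, AddCommGroup (M i)] [∀ i, Module F (M i)]
    {f : ∀ i, End F (M i)} (hf : ∀ i, IsProdThreeInvolutions (f i)) :
    IsProdThreeInvolutions (DirectSum.lmap f : End F (⨁ i, M i)) := by
  choose a b c ha hb hc habc using hf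
  have hmul (p q : ∀ i, End F (M i)) : (DirectSum.lmap p : End F (⨁ i, M i)) * DirectSum.lmap q =
      DirectSum.lmap fun i ↦ p i * q i := (DirectSum.lmap_comp q p).symm
  have hone : (DirectSum.lmap (fun i ↦ (1 : End F (M i))) : End F (⨁ i, M i)) = 1 :=
    DirectSum.lmap_id
  exact ⟨DirectSum.lmap a, DirectSum.lmap b, DirectSum.lmap c, by simp only [hmul, ha, hone],
    by simp only [hmul, hb, hone], by simp only [hmul, hc, hone], by simp only [hmul, ← habc]⟩

theorem smul_one {r : F} (hr : r * r = 1) : IsProdThreeInvolutions (r • 1 : End F V) :=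
  ⟨r • 1, 1, 1, by rw [smul_mul_smul_comm, hr, one_mul, _root_.one_smul], one_mul 1, one_mul 1,
    by simp⟩

/-- A cyclic automorphism whose companion matrix has constant term `±1` is a reflection times
a signed cyclic permutation of a basis, and the latter is a product of two involutions. -/
theorem of_cyclic (hF : ∀ x : F, x ≠ 0 → x * x = 1) {n : ℕ} (e : Basis (Fin (n + 1)) F V)
    {u : End F V} (hu : Function.Surjective u)
    (he : ∀ i : Fin n, u (e i.castSucc) = e i.succ) : IsProdThreeInvolutions u := by
  set c := e.coord 0 (u (e (Fin.last n))) with hc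
  have hcoord : e.coord 0 ∘ₗ u = c • e.coord (Fin.last n) := by
    refine e.ext fun i ↦ ?_
    induction i using Fin.lastCases with
    | last => simp [hc]
    | cast i => simp [he, Fin.succ_ne_zero, (Fin.castSucc_lt_last i).ne]
  have hc0 : c ≠ 0 := by
    intro h
    obtain ⟨x, hx⟩ := hu (e 0)
    have := LinearMap.congr_fun hcoord x
    simp [h, hx] at this
  have hcc := hF c hc0
  let R : End F V := e.constr F fun i ↦ if i = 0 then -c • u (e (Fin.last n)) else e i
  let b : End F V := e.constr F fun i ↦ if i = 0 then -c • e 0 else e (-i)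
  let d : End F V := e.constr F fun i ↦ e i.rev
  have hR0 : R (e 0) = -c • u (e (Fin.last n)) := by simp only [R, Basis.constr_basis, if_true]
  have hR (i) (hi : i ≠ 0) : R (e i) = e i := by simp only [R, Basis.constr_basis, if_neg hi]
  have hb0 : b (e 0) = -c • e 0 := by simp only [b, Basis.constr_basis, if_true]
  have hb (i) (hi : i ≠ 0) : b (e i) = e (-i) := by simp only [b, Basis.constr_basis, if_neg hi]
  have hd (i) : d (e i) = e i.rev := by simp only [d, Basis.constr_basis]
  have hRx (x : V) : R x = x + e.coord 0 x • (R (e 0) - e 0) := by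
    have : R = 1 + (e.coord 0).smulRight (R (e 0) - e 0) := by
      refine e.ext fun i ↦ ?_
      by_cases hi : i = 0
      · subst hi; simp
      · simp [hR i hi, hi]
    conv_lhs => rw [this]
    simp
  refine ⟨R, b, d, ?_, ?_, ?_, ?_⟩
  · refine LinearMap.ext fun x ↦ ?_
    have h1 : e.coord 0 (R (e 0)) = -1 := by
      rw [hR0, map_smul, ← hc, smul_eq_mul, neg_mul, hcc]
    rw [End.mul_apply, hRx (R x), hRx x, map_add, map_smul, map_sub, h1]
    simp only [Basis.coord_apply, Basis.repr_self, Finsupp.single_eq_same, smul_eq_mul,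
      End.one_apply]
    module
  · refine e.ext fun i ↦ ?_
    by_cases hi : i = 0
    · subst hi
      rw [End.mul_apply, hb0, map_smul, hb0, smul_smul, neg_mul_neg, hcc]
      simp
    · rw [End.mul_apply, hb i hi, hb _ (neg_ne_zero.mpr hi), neg_neg]
      simp
  · refine e.ext fun i ↦ ?_
    simp [hd]
  · refine e.ext fun i ↦ ?_
    induction i using Fin.lastCases with
    | last =>
      rw [End.mul_apply, End.mul_apply, hd, Fin.rev_last, hb0, map_smul, hR0, smul_smul,
        neg_mul_neg, hcc, _root_.one_smul]
    | cast i =>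
      have h0 : i.castSucc.rev ≠ 0 := by
        rw [Fin.rev_castSucc]; exact Fin.succ_ne_zero _
      have h1 : -i.castSucc.rev = i.succ := by
        rw [neg_eq_iff_add_eq_zero, Fin.rev_castSucc]
        ext
        have hi : n - (i + 1 : ℕ) + 1 + (i + 1) = n + 1 := by omega
        simp [Fin.val_add, hi]
      rw [End.mul_apply, End.mul_apply, hd, hb _ h0, h1, hR _ (Fin.succ_ne_zero _), he]

theorem mul_root (hF : ∀ x : F, x ≠ 0 → x * x = 1) {q : F[X]} (hq : q ≠ 0)
    (hs : Function.Surjective (LinearMap.mulLeft F (AdjoinRoot.root q))) :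
    IsProdThreeInvolutions (LinearMap.mulLeft F (AdjoinRoot.root q)) := by
  let B := AdjoinRoot.powerBasis hq
  obtain h0 | ⟨n, hn⟩ : B.dim = 0 ∨ ∃ n, B.dim = n + 1 := by
    cases B.dim <;> simp
  · have := B.basis.reindex (finCongr h0)
    have : Subsingleton (AdjoinRoot q) := this.repr.toEquiv.subsingleton
    have : Subsingleton (End F (AdjoinRoot q)) := ⟨fun f g ↦ LinearMap.ext fun x ↦
      Subsingleton.elim _ _⟩
    exact ⟨1, 1, 1, Subsingleton.elim _ _, Subsingleton.elim _ _, Subsingleton.elim _ _,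
      Subsingleton.elim _ _⟩
  · refine of_cyclic hF (B.basis.reindex (finCongr hn)) hs fun i ↦ ?_
    simp [B, pow_succ']

theorem of_finiteDimensional (hF : ∀ x : F, x ≠ 0 → x * x = 1) [FiniteDimensional F V]
    (u : V ≃ₗ[F] V) : IsProdThreeInvolutions (u : End F V) := by
  classical
  obtain ⟨ι, _, p, hp, k, ⟨Φ⟩⟩ := Module.equiv_directSum_of_isTorsion
    (AEval.isTorsion_of_finiteDimensional F V (u : End F V))
  let e : V ≃ₗ[F] ⨁ i, F[X] ⧸ (Ideal.span {p i ^ k i}) :=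
    (AEval'.of (u : End F V)).trans (Φ.restrictScalars F)
  have he (x : V) : e (u x) = DirectSum.lmap
      (fun i ↦ LinearMap.mulLeft F (AdjoinRoot.root (p i ^ k i))) (e x) := by
    have h1 : e (u x) = (X : F[X]) • e x := by
      change Φ (AEval'.of (u : End F V) ((u : End F V) x)) = X • Φ _
      rw [← AEval'.X_smul_of]
      exact Φ.map_smul X _
    rw [h1]
    refine DFinsupp.ext fun i ↦ ?_
    rfl
  refine of_conj e he (lmap fun i ↦ mul_root hF (pow_ne_zero (k i) (hp i).ne_zero) ?_)
  refine (DirectSum.lmap_surjective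
    (fun i ↦ LinearMap.mulLeft F (AdjoinRoot.root (p i ^ k i)))).mp (fun y ↦ ?_) i
  exact ⟨e (u.symm (e.symm y)), by
    rw [← he, u.apply_symm_apply]
    exact e.apply_symm_apply y⟩

end IsProdThreeInvolutions

section Shift

variable {F V : Type*} [Field F] [AddCommGroup V] [Module F V]

theorem Module.Basis.constr_comp_involutive {ι : Type*} (f : Basis ι F V) {σ : ι → ι}
    (hσ : Function.Involutive σ) :
    (f.constr F (f ∘ σ) : End F V) * f.constr F (f ∘ σ) = 1 :=
  f.ext fun i ↦ by simp [hσ i]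

/-- A bilateral shift of a basis is a product of two involutions. -/
theorem exists_involutions_of_bilateral_shift {ι : Type*} (f : Basis (ℤ × ι) F V) {t : End F V}
    (ht : ∀ n i, t (f (n, i)) = f (n + 1, i)) :
    ∃ b c : End F V, b * b = 1 ∧ c * c = 1 ∧ t = b * c := by
  refine ⟨f.constr F (f ∘ fun x ↦ (1 - x.1, x.2)), f.constr F (f ∘ fun x ↦ (-x.1, x.2)),
    f.constr_comp_involutive fun x ↦ by simp, f.constr_comp_involutive fun x ↦ by simp,
    f.ext fun ⟨n, i⟩ ↦ ?_⟩
  simp [ht, add_comm]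

theorem exists_iterate_eq_of_height_lt {J : Type*} {τ : J → J} {h : J → ℕ}
    (hτ : ∀ j, h j < h (τ j)) (j : J) : ∃ j₀ ∉ Set.range τ, ∃ n, τ^[n] j₀ = j := by
  induction hj : h j using Nat.strong_induction_on generalizing j with
  | _ m ih =>
    by_cases hr : j ∈ Set.range τ
    · obtain ⟨k, rfl⟩ := hr
      obtain ⟨j₀, h₀, n, rfl⟩ := ih (h k) (hj ▸ hτ k) k rfl
      exact ⟨j₀, h₀, n + 1, Function.iterate_succ_apply' τ n j₀⟩
    · exact ⟨j, hr, 0, rfl⟩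

theorem iterate_injective_of_notMem_range {J : Type*} {τ : J → J} (hτ : Function.Injective τ) :
    Function.Injective fun x : ℕ × {j // j ∉ Set.range τ} ↦ τ^[x.1] x.2 := by
  have aux (m k : ℕ) (a b : {j // j ∉ Set.range τ}) (h : τ^[m] a = τ^[m + k] b) : k = 0 := by
    rw [Function.iterate_add_apply] at h
    have h' := hτ.iterate m h
    cases k with
    | zero => rfl
    | succ k =>
      rw [Function.iterate_succ_apply'] at h'
      exact absurd ⟨_, h'.symm⟩ a.2
  rintro ⟨m, a⟩ ⟨n, b⟩ h
  have hmn : m = n := by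
    rcases le_total m n with hle | hle
    · obtain ⟨k, rfl⟩ := Nat.exists_eq_add_of_le hle
      simp [aux m k a b h]
    · obtain ⟨k, rfl⟩ := Nat.exists_eq_add_of_le hle
      simp [aux n k b a h.symm]
  subst hmn
  exact Prod.ext rfl (Subtype.ext (hτ.iterate m h))

theorem exists_involutions_of_unilateral_shift {J : Type*} {y : J → V}
    (hy : LinearIndependent F y) (t : V ≃ₗ[F] V) {τ : J → J} (hinj : Function.Injective τ)
    (hty : ∀ j, t (y j) = y (τ j)) {h : J → ℕ} (hτ : ∀ j, h j < h (τ j))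
    (hspan : ∀ v, ∃ n : ℕ, (t ^ n) v ∈ Submodule.span F (Set.range y)) :
    ∃ b c : End F V, b * b = 1 ∧ c * c = 1 ∧ (t : End F V) = b * c := by
  let J₀ := {j // j ∉ Set.range τ}
  let f : ℤ × J₀ → V := fun x ↦ (t ^ x.1) (y x.2)
  have hpow (n : ℕ) (j : J) : (t ^ n) (y j) = y (τ^[n] j) := by
    induction n with
    | zero => simp
    | succ n ih => rw [pow_succ', LinearEquiv.mul_apply, ih, hty, Function.iterate_succ_apply']
  have hshift (m : ℤ) (x : ℤ × J₀) : (t ^ m) (f x) = f (m + x.1, x.2) := by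
    simp only [f]
    rw [zpow_add, LinearEquiv.mul_apply]
  have hli : LinearIndependent F f := by
    rw [linearIndependent_iff_finset_linearIndependent]
    intro s
    obtain ⟨N, hN⟩ : ∃ N : ℕ, ∀ x ∈ s, 0 ≤ (N : ℤ) + x.1 := by
      refine ⟨s.sup fun x ↦ x.1.natAbs, fun x hx ↦ ?_⟩
      have : x.1.natAbs ≤ s.sup fun x ↦ x.1.natAbs := Finset.le_sup (f := fun x ↦ x.1.natAbs) hx
      omega
    refine LinearIndependent.of_comp ((t ^ (N : ℤ) : V ≃ₗ[F] V) : V →ₗ[F] V) ?_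
    have hcomp : ⇑((t ^ (N : ℤ) : V ≃ₗ[F] V) : V →ₗ[F] V) ∘ (f ∘ (Subtype.val : s → ℤ × J₀)) =
        y ∘ ((fun x : ℕ × J₀ ↦ τ^[x.1] x.2) ∘
          fun x : s ↦ (((N : ℤ) + x.1.1).toNat, x.1.2)) := by
      funext x
      simp only [Function.comp_apply, LinearEquiv.coe_coe, hshift]
      rw [← hpow, ← zpow_natCast, Int.toNat_of_nonneg (hN x x.2)]
    rw [hcomp]
    refine hy.comp _ ((iterate_injective_of_notMem_range hinj).comp ?_)
    rintro ⟨⟨m, a⟩, hm⟩ ⟨⟨n, b⟩, hn⟩ hab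
    have h1 := hN _ hm
    have h2 := hN _ hn
    simp only [Prod.mk.injEq, Subtype.mk.injEq] at hab h1 h2 ⊢
    exact ⟨by omega, hab.2⟩
  have hinv (m : ℤ) (v : V) (hv : v ∈ Submodule.span F (Set.range f)) :
      (t ^ m) v ∈ Submodule.span F (Set.range f) := by
    induction hv using Submodule.span_induction with
    | mem x hx =>
      obtain ⟨x, rfl⟩ := hx
      exact hshift m x ▸ Submodule.subset_span ⟨_, rfl⟩
    | zero => simp
    | add x y _ _ hx hy => rw [map_add]; exact add_mem hx hy
    | smul c x _ hx => rw [map_smul]; exact Submodule.smul_mem _ _ hx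
  have hyf : Submodule.span F (Set.range y) ≤ Submodule.span F (Set.range f) := by
    rw [Submodule.span_le]
    rintro _ ⟨j, rfl⟩
    obtain ⟨j₀, h₀, n, rfl⟩ := exists_iterate_eq_of_height_lt hτ j
    refine Submodule.subset_span ⟨(n, ⟨j₀, h₀⟩), ?_⟩
    simp only [f, zpow_natCast, hpow]
  have htop : ⊤ ≤ Submodule.span F (Set.range f) := by
    intro v _
    obtain ⟨n, hn⟩ := hspan v
    have := hinv (-n) _ (hyf hn)
    rwa [← zpow_natCast, ← LinearEquiv.mul_apply, ← zpow_add, neg_add_cancel, zpow_zero] at this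
  refine exists_involutions_of_bilateral_shift (Basis.mk hli htop) fun n i ↦ ?_
  have := hshift 1 (n, i)
  rw [zpow_one] at this
  simp [this, add_comm]

end Shift

namespace IsProdThreeInvolutions

variable {F V : Type*} [Field F] [AddCommGroup V] [Module F V]

/-- Let `a` be the involution exchanging `B (inr j)` and `B (inl (σ j))`. Then `u * a` restricts to
a unilateral shift on the span of the vectors `B (inr j)`, and is locally nilpotent modulo it. -/
theorem of_basis {I J : Type*} (u : V ≃ₗ[F] V) (B : Basis (I × ℕ ⊕ J) F V) {γ : I × ℕ → J}
    (hγ : Function.Injective γ) (huγ : ∀ k, u (B (.inl k)) = B (.inr (γ k))) (σ : J ≃ I × ℕ)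
    (hσγ : ∀ k, k.2 < (σ (γ k)).2)
    (hσ : ∀ j k, B.repr (u (B (.inr j))) (.inl k) ≠ 0 → k.2 < (σ j).2) :
    IsProdThreeInvolutions (u : End F V) := by
  let s : I × ℕ ⊕ J → I × ℕ ⊕ J := Sum.elim (fun k ↦ .inr (σ.symm k)) (fun j ↦ .inl (σ j))
  have hs : Function.Involutive s := by rintro (k | j) <;> simp [s]
  let a : End F V := B.constr F (B ∘ s)
  have haa : a * a = 1 := B.constr_comp_involutive hs
  let t : V ≃ₗ[F] V := (LinearEquiv.ofInvolutive a fun x ↦ LinearMap.congr_fun haa x).trans u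
  have ht (x : V) : t x = u (a x) := rfl
  have htj (j : J) : t (B (.inr j)) = B (.inr (γ (σ j))) := by
    rw [ht, ← huγ]
    simp [a, s]
  have htk (k : I × ℕ) : t (B (.inl k)) = u (B (.inr (σ.symm k))) := by
    rw [ht]
    simp [a, s]
  let Y := Submodule.span F (Set.range (B ∘ Sum.inr))
  have htY (v : V) (hv : v ∈ Y) : t v ∈ Y := by
    induction hv using Submodule.span_induction with
    | mem x hx =>
      obtain ⟨j, rfl⟩ := hx
      exact Submodule.subset_span ⟨γ (σ j), (htj j).symm⟩
    | zero => simp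
    | add x y _ _ hx hy => rw [map_add]; exact add_mem hx hy
    | smul c x _ hx => rw [map_smul]; exact Submodule.smul_mem _ _ hx
  have htnY (n : ℕ) (v : V) (hv : v ∈ Y) : (t ^ n) v ∈ Y := by
    induction n with
    | zero => simpa
    | succ n ih => rw [pow_succ', LinearEquiv.mul_apply]; exact htY _ ih
  have hmono {m n : ℕ} (hmn : m ≤ n) {v : V} (hv : (t ^ m) v ∈ Y) : (t ^ n) v ∈ Y := by
    obtain ⟨d, rfl⟩ := Nat.exists_eq_add_of_le' hmn
    rw [pow_add, LinearEquiv.mul_apply]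
    exact htnY _ _ hv
  have hrepr {n : ℕ} {v : V} (hv : ∀ k, B.repr v (.inl k) ≠ 0 → (t ^ n) (B (.inl k)) ∈ Y) :
      (t ^ n) v ∈ Y := by
    rw [← B.linearCombination_repr v, Finsupp.linearCombination_apply, Finsupp.sum, map_sum]
    refine sum_mem fun i hi ↦ ?_
    rw [map_smul]
    refine Submodule.smul_mem _ _ ?_
    rcases i with k | j
    · exact hv k (Finsupp.mem_support_iff.mp hi)
    · exact htnY _ _ (Submodule.subset_span ⟨j, rfl⟩)
  have hnil (k : I × ℕ) : (t ^ (k.2 + 1)) (B (.inl k)) ∈ Y := by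
    induction hk : k.2 using Nat.strong_induction_on generalizing k with
    | _ m ih =>
      rw [pow_succ, LinearEquiv.mul_apply, htk]
      refine hrepr fun l hl ↦ ?_
      have := hσ _ l hl
      rw [Equiv.apply_symm_apply, hk] at this
      exact hmono this (ih _ this l rfl)
  have hspan (v : V) : ∃ n : ℕ, (t ^ n) v ∈ Y := by
    refine ⟨(B.repr v).support.sup fun i ↦ Sum.elim (fun k ↦ k.2 + 1) (fun _ ↦ 0) i,
      hrepr fun k hk ↦ hmono ?_ (hnil k)⟩
    exact Finset.le_sup (f := fun i : I × ℕ ⊕ J ↦ Sum.elim (fun k ↦ k.2 + 1) (fun _ ↦ 0) i)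
      (Finsupp.mem_support_iff.mpr hk)
  obtain ⟨b, c, hb, hc, hbc⟩ := exists_involutions_of_unilateral_shift
    (B.linearIndependent.comp _ Sum.inr_injective) t (τ := γ ∘ σ) (hγ.comp σ.injective) htj
    (h := fun j ↦ (σ j).2) (fun j ↦ hσγ (σ j)) hspan
  refine ⟨b, c, a, hb, hc, haa, ?_⟩
  rw [← hbc]
  refine LinearMap.ext fun x ↦ ?_
  change u x = u (a (a x))
  rw [← End.mul_apply a a, haa, End.one_apply]

end IsProdThreeInvolutions

theorem exists_equiv_prod_nat_snd_eq {I J : Type*} (h : J → ℕ)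
    (hI : ∀ n, Nonempty ({j // h j = n} ≃ I)) : ∃ σ : J ≃ I × ℕ, ∀ j, (σ j).2 = h j := by
  exact ⟨(Equiv.sigmaFiberEquiv h).symm.trans <|
    (Equiv.sigmaCongrRight fun n ↦ (hI n).some).trans <|
      (Equiv.sigmaEquivProd ℕ I).trans (Equiv.prodComm ℕ I), fun j ↦ rfl⟩

theorem Module.Basis.sumExtend_inl {K V ι : Type*} [DivisionRing K] [AddCommGroup V] [Module K V]
    {v : ι → V} (hv : LinearIndependent K v) (i : ι) : Basis.sumExtend hv (.inl i) = v i := by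
  rw [Basis.sumExtend, Basis.reindex_apply, Basis.extend_apply_self]
  rfl

namespace IsProdThreeInvolutions

universe v

variable {F : Type*} {V : Type v} [Field F] [AddCommGroup V] [Module F V]

theorem of_linearIndependent {I : Type v} [Infinite I] (hI : Module.rank F V ≤ #I)
    (u : V ≃ₗ[F] V) {z : I → V} (hz : LinearIndependent F (Sum.elim z (u ∘ z))) :
    IsProdThreeInvolutions (u : End F V) := by
  have hIN : #(I × ℕ) = #I := by
    simp [Cardinal.mul_eq_left (aleph0_le_mk I) (aleph0_le_mk I) aleph0_ne_zero]
  obtain ⟨ε⟩ : Nonempty (I × ℕ ⊕ I × ℕ ≃ I) := by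
    rw [← Cardinal.eq, mk_sum, lift_id, hIN, add_eq_self (aleph0_le_mk I)]
  have hz' := hz.comp (Sum.map ε ε) (Sum.map_injective.mpr ⟨ε.injective, ε.injective⟩)
  let B₀ := Basis.sumExtend hz'
  have hB₀ (x) : B₀ (.inl x) = Sum.elim z (u ∘ z) (Sum.map ε ε x) := Basis.sumExtend_inl hz' x
  let X := Basis.sumExtendIndex hz'
  let J := (I × ℕ ⊕ (I × ℕ ⊕ I × ℕ)) ⊕ X
  let B : Basis (I × ℕ ⊕ J) F V := B₀.reindex <|
    ((Equiv.sumAssoc (I × ℕ) (I × ℕ) (I × ℕ ⊕ I × ℕ)).sumCongr (Equiv.refl X)).trans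
      (Equiv.sumAssoc _ _ _)
  let η : I × ℕ → J := fun k ↦ .inl (.inl k)
  let γ : I × ℕ → J := fun k ↦ .inl (.inr (.inl k))
  have hBζ (k) : B (.inl k) = z (ε (.inl k)) :=
    (B₀.reindex_apply _ _).trans (hB₀ (.inl (.inl k)))
  have hBη (k) : B (.inr (η k)) = z (ε (.inr k)) :=
    (B₀.reindex_apply _ _).trans (hB₀ (.inl (.inr k)))
  have hBγ (k) : B (.inr (γ k)) = u (z (ε (.inl k))) :=
    (B₀.reindex_apply _ _).trans (hB₀ (.inr (.inl k)))
  have hBuη (k) : B (.inr (.inl (.inr (.inr k)))) = u (z (ε (.inr k))) :=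
    (B₀.reindex_apply _ _).trans (hB₀ (.inr (.inr k)))
  have hη (k l) : B.repr (u (B (.inr (η k)))) (.inl l) = 0 := by
    rw [hBη, ← hBuη]
    simp
  let h₀ : J → ℕ := fun j ↦ (B.repr (u (B (.inr j)))).support.sup
    (Sum.elim (fun k ↦ k.2 + 1) fun _ ↦ 0)
  have hh₀ (j k) (hk : B.repr (u (B (.inr j))) (.inl k) ≠ 0) : k.2 < h₀ j :=
    Finset.le_sup (f := Sum.elim (fun k : I × ℕ ↦ k.2 + 1) fun _ : J ↦ 0)
      (Finsupp.mem_support_iff.mpr hk)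
  let h : J → ℕ := Sum.elim (Sum.elim Prod.snd fun x ↦
    max (h₀ (.inl (.inr x))) (Sum.elim (fun k ↦ k.2 + 1) (fun _ ↦ 0) x)) fun x ↦ h₀ (.inr x)
  have hJ : #J ≤ #I := by
    rw [← B.mk_eq_rank''] at hI
    exact (mk_le_of_injective Sum.inr_injective).trans hI
  obtain ⟨σ, hσ⟩ := exists_equiv_prod_nat_snd_eq (I := I) h fun n ↦ by
    rw [← Cardinal.eq]
    refine le_antisymm ((mk_subtype_le _).trans hJ) ?_
    refine mk_le_of_injective (f := fun i ↦ ⟨η (i, n), rfl⟩) fun i i' hi ↦ ?_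
    exact congrArg Prod.fst (Sum.inl_injective (Sum.inl_injective (Subtype.mk.inj hi)))
  refine of_basis u B (γ := γ) (Sum.inl_injective.comp (Sum.inr_injective.comp Sum.inl_injective))
    (fun k ↦ by rw [hBζ, hBγ]) σ (fun k ↦ ?_)
    fun j k hjk ↦ ?_
  · rw [hσ]
    exact lt_of_lt_of_le (Nat.lt_succ_self k.2) (le_max_right _ _)
  · rw [hσ]
    rcases j with (l | x) | x
    · exact absurd (hη l k) hjk
    · exact (hh₀ _ k hjk).trans_le (le_max_left _ _)
    · exact hh₀ _ k hjk

end IsProdThreeInvolutions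

section Dichotomy

variable {F V : Type*} [Field F] [AddCommGroup V] [Module F V]

theorem exists_sub_smul_mem_of_forall {T : Submodule F V} {u : End F V}
    (hT : ∀ x, T ⊔ Submodule.span F {x} ≠ ⊤)
    (h : ∀ x, x ∈ T ∨ ∃ r : F, u x - r • x ∈ T) : ∃ r : F, ∀ x, u x - r • x ∈ T := by
  have huT : T ≤ T.comap u := by
    intro z hz
    by_contra huz
    obtain ⟨x, hx⟩ : ∃ x, x ∉ T ⊔ Submodule.span F {u z} := by
      by_contra! hall
      exact hT (u z) (eq_top_iff.mpr fun x _ ↦ hall x)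
    have hxT : x ∉ T := fun hx' ↦ hx (Submodule.mem_sup_left hx')
    obtain ⟨r, hr⟩ := (h x).resolve_left hxT
    obtain ⟨s, hs⟩ := (h (x + z)).resolve_left
      fun h' ↦ hxT ((Submodule.add_mem_iff_left T hz).mp h')
    have key : u z - (s - r) • x ∈ T := by
      have := T.add_mem (T.sub_mem hs hr) (T.smul_mem s hz)
      rw [map_add] at this
      convert this using 1
      module
    by_cases hsr : s - r = 0
    · rw [hsr, zero_smul, sub_zero] at key
      exact huz key
    · refine hx ((Submodule.smul_mem_iff _ hsr).mp ?_)
      have := Submodule.sub_mem _ (Submodule.mem_sup_right (Submodule.mem_span_singleton_self (u z)))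
        (Submodule.mem_sup_left (T := Submodule.span F {u z}) key)
      rwa [sub_sub_cancel] at this
  obtain ⟨r, hr⟩ := LinearMap.exists_eq_smul_id_of_forall_notLinearIndependent
    (f := T.mapQ T u huT) fun v ↦ by
      induction v using Submodule.Quotient.induction_on with
      | _ x =>
        rw [LinearIndependent.pair_iff]
        intro hli
        rcases h x with hx | ⟨r, hr⟩
        · have := hli 1 0 (by simp [(Submodule.Quotient.mk_eq_zero T).mpr hx])
          exact one_ne_zero this.1
        · have hr' := (Submodule.Quotient.mk_eq_zero T).mpr hr
          have := hli (-r) 1 (by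
            rw [Submodule.Quotient.mk_sub, Submodule.Quotient.mk_smul] at hr'
            simpa [add_comm, sub_eq_add_neg] using hr')
          exact one_ne_zero this.2
  refine ⟨r, fun x ↦ ?_⟩
  have := LinearMap.congr_fun hr (Submodule.Quotient.mk x)
  rw [← Submodule.Quotient.mk_eq_zero, Submodule.Quotient.mk_sub, Submodule.Quotient.mk_smul,
    sub_eq_zero]
  simpa using this

theorem exists_linearIndependent_or_exists_rank_lt (hV : ℵ₀ ≤ Module.rank F V) (u : End F V) :
    (∃ S : Set V, Module.rank F V ≤ #S ∧
      LinearIndependent F (Sum.elim (Subtype.val : S → V) (u ∘ (Subtype.val : S → V)))) ∨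
    ∃ T : Submodule F V, Module.rank F T < Module.rank F V ∧ ∃ r : F, ∀ x, u x - r • x ∈ T := by
  let φ : V ⊕ V → V := Sum.elim id u
  let pre : Set V → Set (V ⊕ V) := fun S ↦ Sum.elim id id ⁻¹' S
  obtain ⟨S, hS, hmax⟩ := zorn_subset {S | LinearIndepOn F φ (pre S)} fun c hc hchain ↦ by
    refine ⟨⋃₀ c, ?_, fun s hs ↦ Set.subset_sUnion_of_mem hs⟩
    have : pre (⋃₀ c) = ⋃ s : c, pre s := by
      simp only [pre, Set.sUnion_eq_iUnion, Set.preimage_iUnion]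
    rw [Set.mem_ofPred_eq, this]
    refine linearIndepOn_iUnion_of_directed (fun s t ↦ ?_) fun s ↦ hc s.2
    rcases hchain.total s.2 t.2 with h | h
    · exact ⟨t, Set.preimage_mono h, subset_rfl⟩
    · exact ⟨s, subset_rfl, Set.preimage_mono h⟩
  by_cases hcard : Module.rank F V ≤ #S
  · refine .inl ⟨S, hcard, ?_⟩
    have hinj : Function.Injective fun x : S ⊕ S ↦ (⟨Sum.map Subtype.val Subtype.val x, by
        rcases x with x | x <;> exact x.2⟩ : pre S) := fun x y hxy ↦
      Sum.map_injective.mpr ⟨Subtype.val_injective, Subtype.val_injective⟩ (Subtype.mk.inj hxy)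
    convert LinearIndependent.comp hS _ hinj using 1
    funext x
    rcases x with x | x <;> rfl
  · let T := Submodule.span F (φ '' pre S)
    have hT : Module.rank F T < Module.rank F V := by
      refine (rank_span_le _).trans_lt (mk_image_le.trans_lt ?_)
      have : pre S = Sum.inl '' S ∪ Sum.inr '' S := by
        ext x
        rcases x with x | x <;> simp [pre]
      rw [this]
      refine (mk_union_le _ _).trans_lt (add_lt_of_lt hV ?_ ?_) <;>
        exact mk_image_le.trans_lt (not_le.mp hcard)
    refine .inr ⟨T, hT, exists_sub_smul_mem_of_forall (fun x hx ↦ ?_) fun x ↦ ?_⟩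
    · refine (lt_irrefl (Module.rank F V)) ?_
      calc Module.rank F V = Module.rank F ↥(T ⊔ Submodule.span F {x}) := by rw [hx, rank_top]
        _ ≤ Module.rank F T + Module.rank F (Submodule.span F {x}) :=
          Submodule.rank_add_le_rank_add_rank _ _
        _ < Module.rank F V := add_lt_of_lt hV hT <|
          ((rank_span_le _).trans_eq (mk_singleton x)).trans_lt (one_lt_aleph0.trans_le hV)
    · by_contra! hx
      obtain ⟨hxT, hux⟩ := hx
      have hxS : x ∉ S := fun hxS ↦ hxT (Submodule.subset_span ⟨.inl x, hxS, rfl⟩)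
      have hins : pre (insert x S) = insert (.inr x) (insert (.inl x) (pre S)) := by
        ext y
        rcases y with y | y <;> simp [pre]
      refine hxS (hmax ?_ (Set.subset_insert x S) (Set.mem_insert x S))
      change LinearIndepOn F φ (pre (insert x S))
      rw [hins, linearIndepOn_insert (by simpa [pre] using hxS),
        linearIndepOn_insert (by simpa [pre] using hxS)]
      refine ⟨⟨hS, hxT⟩, fun hmem ↦ ?_⟩
      rw [Set.image_insert_eq, Submodule.mem_span_insert] at hmem
      obtain ⟨r, y, hy, hxy⟩ := hmem
      refine hux r ?_
      have : u x = r • x + y := hxy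
      rwa [this, add_sub_cancel_left]

end Dichotomy

namespace IsProdThreeInvolutions

universe v

variable {F : Type*} [Field F]

theorem of_isCompl {V : Type v} [AddCommGroup V] [Module F V] {u : V ≃ₗ[F] V} {r : F}
    (hr : r * r = 1) {W D : Submodule F V} (hWD : IsCompl W D) (hW : ∀ x, u x - r • x ∈ W)
    (hD : ∀ x ∈ D, u x = r • x)
    (ih : ∀ w : W ≃ₗ[F] W, IsProdThreeInvolutions (w : End F W)) :
    IsProdThreeInvolutions (u : End F V) := by
  have hr0 : r ≠ 0 := left_ne_zero_of_mul_eq_one hr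
  have huW (x : V) : u x ∈ W ↔ x ∈ W := by
    rw [← sub_add_cancel (u x) (r • x), Submodule.add_mem_iff_right W (hW x),
      Submodule.smul_mem_iff W hr0]
  let w : W ≃ₗ[F] W := LinearEquiv.ofBijective
    ((u : End F V).restrict fun x hx ↦ (huW x).mpr hx)
    ⟨fun x y hxy ↦ Subtype.ext (u.injective (congrArg Subtype.val hxy)), fun y ↦
      ⟨⟨u.symm y, (huW _).mp (by simp)⟩, Subtype.ext (u.apply_symm_apply _)⟩⟩
  let e := Submodule.prodEquivOfIsCompl W D hWD
  refine of_conj e.symm (g := (w : End F W).prodMap (r • 1)) (fun x ↦ ?_)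
    ((ih w).prodMap (smul_one hr))
  obtain ⟨⟨x, y⟩, rfl⟩ := e.surjective x
  rw [e.symm_apply_apply, LinearEquiv.symm_apply_eq]
  simp [e, w, hD]
  rfl

theorem of_linearEquiv (hF : ∀ x : F, x ≠ 0 → x * x = 1) {V : Type v} [AddCommGroup V]
    [Module F V] (u : V ≃ₗ[F] V) : IsProdThreeInvolutions (u : End F V) := by
  induction hκ : Module.rank F V using WellFoundedLT.induction generalizing V with
  | _ κ ih =>
    rcases lt_or_ge κ ℵ₀ with hfin | hinf
    · have : FiniteDimensional F V := Module.rank_lt_aleph0_iff.mp (hκ ▸ hfin)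
      exact of_finiteDimensional hF u
    rw [← hκ] at hinf
    rcases exists_linearIndependent_or_exists_rank_lt hinf (u : End F V) with
      ⟨S, hS, hli⟩ | ⟨T, hT, r, hr⟩
    · have : Infinite S := infinite_iff.mpr (hinf.trans hS)
      exact of_linearIndependent hS u hli
    let f : End F V := u - r • 1
    have hfx (x : V) : f x = u x - r • x := rfl
    have hrange : Module.rank F f.range < Module.rank F V := by
      refine (Submodule.rank_mono ?_).trans_lt hT
      rintro _ ⟨x, rfl⟩
      exact hr x
    obtain ⟨C, hC⟩ := f.ker.exists_isCompl
    have hCrank : Module.rank F C < Module.rank F V := by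
      refine lt_of_eq_of_lt ?_ hrange
      exact ((Submodule.quotientEquivOfIsCompl _ _ hC).symm.trans f.quotKerEquivRange).rank_eq
    let W := C ⊔ f.range
    have hW : Module.rank F W < Module.rank F V :=
      (Submodule.rank_add_le_rank_add_rank _ _).trans_lt (add_lt_of_lt hinf hCrank hrange)
    obtain ⟨D, hD, hWD⟩ : ∃ D ≤ f.ker, IsCompl W D := by
      obtain ⟨D, hD⟩ := (W.comap f.ker.subtype).exists_isCompl
      refine ⟨D.map f.ker.subtype, Submodule.map_subtype_le _ _, ?_, ?_⟩
      · rw [Submodule.disjoint_def]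
        rintro _ hxW ⟨x, hx, rfl⟩
        exact congrArg _ ((Submodule.disjoint_def.mp hD.disjoint) x hxW hx)
      · rw [codisjoint_iff, eq_top_iff, ← hC.sup_eq_top]
        refine sup_le ?_ (le_sup_of_le_left le_sup_left)
        intro x hx
        obtain ⟨y, hy, z, hz, hyz⟩ := Submodule.mem_sup.mp
          (hD.sup_eq_top ▸ Submodule.mem_top : (⟨x, hx⟩ : f.ker) ∈ _ ⊔ D)
        exact Submodule.mem_sup.mpr ⟨y, hy, z, ⟨z, hz, rfl⟩, congrArg Subtype.val hyz⟩
    have hr0 : r ≠ 0 := by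
      rintro rfl
      have : f.range = ⊤ := by
        rw [LinearMap.range_eq_top]
        intro y
        exact ⟨u.symm y, by simp [hfx]⟩
      rw [this, rank_top] at hrange
      exact hrange.false
    exact of_isCompl (hF r hr0) hWD (fun x ↦ Submodule.mem_sup_right ⟨x, rfl⟩)
      (fun x hx ↦ sub_eq_zero.mp (hD hx)) fun w ↦ ih _ (hκ ▸ hW) w rfl

end IsProdThreeInvolutions

theorem product_of_three_involutions_of_small_field
    {F V : Type*} [Field F] [AddCommGroup V] [Module F V]
    (hF : Cardinal.mk F ≤ 3)
    (hV : ℵ₀ ≤ Module.rank F V) (u : V ≃ₗ[F] V) :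
    ∃ a b c : Module.End F V, a * a = 1 ∧ b * b = 1 ∧ c * c = 1 ∧
      (u : Module.End F V) = a * b * c :=
  IsProdThreeInvolutions.of_linearEquiv (fun _ hx ↦ mul_self_eq_one_of_mk_le_three hF hx) u
end

section
/- Let F be a field, V an infinite-dimensional F-vector space, and u a linear automorphism of V. Then u is the product of one unipotent automorphism with index 2 and two involutions if and only if none of the following conditions holds: (i) there is a scalar λ ∈ F such that rank(u − λ·id_V) < dim V and λ² ≠ 1; (ii) there is a scalar λ ∈ {1, −1} such that u − λ·id_V has finite rank and the determinant of the automorphism of im(u − λ·id_V) induced by u is neither 1 nor −1. -/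
open Cardinal Polynomial

/-- `u` maps the range of `u - lam • id` into itself. -/
theorem maps_range_self {F V : Type*} [Field F] [AddCommGroup V] [Module F V]
    (u : Module.End F V) (lam : F) :
    ∀ x ∈ LinearMap.range (u - lam • (1 : Module.End F V)),
      u x ∈ LinearMap.range (u - lam • (1 : Module.End F V)) := by
  rintro x ⟨y, rfl⟩
  exact ⟨u y, by simp [LinearMap.sub_apply, LinearMap.smul_apply, map_sub, map_smul]⟩

/-- Determinant of the automorphism induced by `u` on `im(u - lam • id)`. -/
noncomputable def inducedDet {F V : Type*} [Field F] [AddCommGroup V] [Module F V]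
    (u : Module.End F V) (lam : F) : F :=
  LinearMap.det (LinearMap.restrict u (maps_range_self u lam))

/-- `u` is a product of a unipotent endomorphism of index `2` and two involutions. -/
def IsUnipInvolProd {F V : Type*} [Field F] [AddCommGroup V] [Module F V]
    (u : Module.End F V) : Prop :=
  ∃ a b c : Module.End F V, (a - 1) ^ 2 = 0 ∧ b * b = 1 ∧ c * c = 1 ∧ u = a * b * c

/-- `x` is a product of two involutions. -/
def IsInvolProd {F V : Type*} [Field F] [AddCommGroup V] [Module F V]
    (x : Module.End F V) : Prop :=
  ∃ b c : Module.End F V, b * b = 1 ∧ c * c = 1 ∧ x = b * c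

/-- An injective map `ψ` intertwining `u₀` and `u`, whose range together with the fixed vectors
of `u` spans the space, induces a multiplicative extension of endomorphisms by the identity. -/
theorem exists_extension_hom {F S V : Type*} [Field F] [AddCommGroup V] [Module F V]
    [AddCommGroup S] [Module F S] (ψ : S →ₗ[F] V) (hψ : Function.Injective ψ)
    (u : Module.End F V) (hsup : LinearMap.ker (u - 1) ⊔ LinearMap.range ψ = ⊤) :
    ∃ Φ : Module.End F S →* Module.End F V,
      (∀ u₀ : Module.End F S, u ∘ₗ ψ = ψ ∘ₗ u₀ → Φ u₀ = u) ∧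
      (∀ a, (a - 1) ^ 2 = 0 → (Φ a - 1) ^ 2 = 0) := by
  obtain ⟨K, hK, hc⟩ := (codisjoint_iff.2 hsup).exists_isCompl
  let e : (S × K) ≃ₗ[F] V :=
    ((LinearEquiv.ofInjective ψ hψ).prodCongr (LinearEquiv.refl F K)) ≪≫ₗ
      Submodule.prodEquivOfIsCompl _ _ hc.symm
  have he : ∀ s k, e (s, k) = ψ s + k := fun s k => by simp [e]
  let Φ : Module.End F S →* Module.End F V :=
    { toFun := fun a => e.conj (a.prodMap 1)
      map_one' := by ext v; simp [LinearEquiv.conj_apply]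
      map_mul' := fun a b => by ext v; simp [LinearEquiv.conj_apply] }
  have hΦ : ∀ a s k, Φ a (e (s, k)) = e (a s, k) := fun a s k => by
    simp only [Φ, MonoidHom.coe_mk, OneHom.coe_mk, LinearEquiv.conj_apply_apply,
      LinearEquiv.symm_apply_apply, LinearMap.prodMap_apply, Module.End.one_apply]
  refine ⟨Φ, ?_, ?_⟩
  · intro u₀ hu
    ext v
    obtain ⟨⟨s, k⟩, rfl⟩ := e.surjective v
    have h1 := LinearMap.congr_fun hu s
    have h2 : u k - k = 0 := by simpa using hK k.2
    simp only [LinearMap.comp_apply] at h1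
    rw [hΦ, he, he, map_add, h1, sub_eq_zero.1 h2]
  · intro a ha
    ext v
    obtain ⟨⟨s, k⟩, rfl⟩ := e.surjective v
    have h1 := LinearMap.congr_fun ha s
    simp only [sq, Module.End.mul_apply, LinearMap.sub_apply, Module.End.one_apply,
      LinearMap.zero_apply, map_sub] at h1 ⊢
    have h2 := congrArg ψ h1
    simp only [map_sub, map_zero] at h2
    rw [hΦ, hΦ, he, he, he, ← h2]
    abel

theorem IsUnipInvolProd.extend {F S V : Type*} [Field F] [AddCommGroup V] [Module F V]
    [AddCommGroup S] [Module F S] {u₀ : Module.End F S} (h : IsUnipInvolProd u₀)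
    (ψ : S →ₗ[F] V) (hψ : Function.Injective ψ) (u : Module.End F V)
    (hu : u ∘ₗ ψ = ψ ∘ₗ u₀) (hsup : LinearMap.ker (u - 1) ⊔ LinearMap.range ψ = ⊤) :
    IsUnipInvolProd u := by
  obtain ⟨Φ, h1, h2⟩ := exists_extension_hom ψ hψ u hsup
  obtain ⟨a, b, c, ha, hb, hc, rfl⟩ := h
  refine ⟨Φ a, Φ b, Φ c, h2 a ha, ?_, ?_, ?_⟩
  · rw [← map_mul, hb, map_one]
  · rw [← map_mul, hc, map_one]
  · rw [← map_mul, ← map_mul, h1 _ hu]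

theorem IsInvolProd.extend {F S V : Type*} [Field F] [AddCommGroup V] [Module F V]
    [AddCommGroup S] [Module F S] {u₀ : Module.End F S} (h : IsInvolProd u₀)
    (ψ : S →ₗ[F] V) (hψ : Function.Injective ψ) (u : Module.End F V)
    (hu : u ∘ₗ ψ = ψ ∘ₗ u₀) (hsup : LinearMap.ker (u - 1) ⊔ LinearMap.range ψ = ⊤) :
    IsInvolProd u := by
  obtain ⟨Φ, h1, -⟩ := exists_extension_hom ψ hψ u hsup
  obtain ⟨b, c, hb, hc, rfl⟩ := h
  refine ⟨Φ b, Φ c, ?_, ?_, ?_⟩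
  · rw [← map_mul, hb, map_one]
  · rw [← map_mul, hc, map_one]
  · rw [← map_mul, h1 _ hu]

/-- If an involution `b` conjugates `x` to its inverse `y`, then `x` is a product of two
involutions. -/
theorem IsInvolProd.of_reverses {F V : Type*} [Field F] [AddCommGroup V] [Module F V]
    {x y b : Module.End F V} (hyx : y * x = 1) (hb : b * b = 1) (h : b * x = y * b) :
    IsInvolProd x := by
  refine ⟨b, b * x, hb, ?_, ?_⟩
  · calc b * x * (b * x) = y * (b * b) * x := by rw [h]; simp only [mul_assoc]; rw [h]
      _ = 1 := by rw [hb, mul_one, hyx]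
  · rw [← mul_assoc, hb, one_mul]

/-- Multiplying a product of two involutions by a unipotent of index two. -/
theorem IsInvolProd.isUnipInvolProd {F V : Type*} [Field F] [AddCommGroup V] [Module F V]
    {u x n : Module.End F V} (hx : IsInvolProd x) (hn : n * n = 0) (h : x = (1 - n) * u) :
    IsUnipInvolProd u := by
  obtain ⟨b, c, hb, hc, hbc⟩ := hx
  refine ⟨1 + n, b, c, by simp [sq, hn], hb, hc, ?_⟩
  have : (1 + n) * (1 - n) = 1 := by rw [mul_sub, add_mul, add_mul, hn]; simp
  rw [mul_assoc, ← hbc, h, ← mul_assoc, this, one_mul]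

theorem IsUnipInvolProd.smul {F V : Type*} [Field F] [AddCommGroup V] [Module F V]
    {u : Module.End F V} (h : IsUnipInvolProd u) {l : F} (hl : l * l = 1) :
    IsUnipInvolProd (l • u) := by
  obtain ⟨a, b, c, ha, hb, hc, rfl⟩ := h
  exact ⟨a, l • b, c, ha, by simp [smul_smul, hl, hb], hc, by simp⟩

theorem exists_det_eq_det_mul_pow {F S V : Type*} [Field F] [AddCommGroup V] [Module F V]
    [FiniteDimensional F V] [AddCommGroup S] [Module F S] (ψ : S →ₗ[F] V)
    (hψ : Function.Injective ψ) (u : Module.End F V) (u₀ : Module.End F S)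
    (hu : u ∘ₗ ψ = ψ ∘ₗ u₀) (l : F) (hl : ∀ v, u v - l • v ∈ LinearMap.range ψ) :
    ∃ k : ℕ, LinearMap.det u = LinearMap.det u₀ * l ^ k := by
  have he : LinearMap.range ψ ≤ (LinearMap.range ψ).comap u := by
    rintro _ ⟨s, rfl⟩
    exact ⟨u₀ s, (LinearMap.congr_fun hu s).symm⟩
  refine ⟨Module.finrank F (V ⧸ LinearMap.range ψ), ?_⟩
  rw [LinearMap.det_eq_det_mul_det (LinearMap.range ψ) u he]
  congr 1
  · rw [← LinearMap.det_conj u₀ (LinearEquiv.ofInjective ψ hψ)]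
    congr 1
    ext v
    obtain ⟨s, rfl⟩ := (LinearEquiv.ofInjective ψ hψ).surjective v
    simp only [LinearMap.comp_apply, LinearEquiv.coe_coe, LinearEquiv.symm_apply_apply,
      LinearMap.coe_restrict_apply, LinearEquiv.ofInjective_apply]
    exact LinearMap.congr_fun hu s
  · have : (LinearMap.range ψ).mapQ (LinearMap.range ψ) u he = l • LinearMap.id := by
      ext v
      simpa [Submodule.mapQ_apply] using (Submodule.Quotient.eq _).2 (hl v)
    rw [this, LinearMap.det_smul, LinearMap.det_id, mul_one]

theorem det_eq_one_of_sub_one_sq_eq_zero {F V : Type*} [Field F] [AddCommGroup V] [Module F V]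
    [FiniteDimensional F V] {a : Module.End F V} (ha : (a - 1) ^ 2 = 0) :
    LinearMap.det a = 1 := by
  obtain ⟨k, hk⟩ := exists_det_eq_det_mul_pow (LinearMap.ker (a - 1)).subtype
    (Submodule.subtype_injective _) a 1 (by
      ext ⟨v, hv⟩
      simpa [sub_eq_zero] using hv) 1 (fun v => by
      simpa [sq] using LinearMap.congr_fun ha v)
  simpa using hk

theorem involution_sum_identity {F V : Type*} [Field F] [AddCommGroup V] [Module F V]
    {b c m u : Module.End F V} (hb : b * b = 1) (hc : c * c = 1)
    (hm : m * m = 0) (hu : u = (1 + m) * b * c) (l : F) :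
    (l ^ 2) • (b * m * b) + m = (l ^ 2 - 1) • (1 : Module.End F V) +
      (l • (b * (1 - m) * (u - l • 1) * b) + (u - l • 1) * (b * (1 - m) * u * b)) := by
  have h1 : (1 - m) * u = b * c := by
    rw [hu, mul_assoc, ← mul_assoc (1 - m)]
    have : (1 - m) * (1 + m) = 1 := by rw [mul_add, sub_mul, sub_mul, hm]; simp
    rw [this, one_mul]
  have h2 : u * (b * (1 - m) * u * b) = 1 + m := by
    calc u * (b * (1 - m) * u * b) = u * (b * ((1 - m) * u) * b) := by simp only [mul_assoc]
      _ = (1 + m) * b * c * ((b * b) * c * b) := by rw [h1, hu]; simp only [mul_assoc]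
      _ = (1 + m) * (b * (c * c) * b) := by rw [hb]; simp only [mul_assoc, one_mul]
      _ = 1 + m := by rw [hc, mul_one, hb, mul_one]
  have h3 : l • (b * (1 - m) * (u - l • 1) * b) = l • (b * (1 - m) * u * b)
      - l ^ 2 • ((1 : Module.End F V) - b * m * b) := by
    have : (1 : Module.End F V) - b * m * b = b * (1 - m) * b := by
      rw [mul_sub, sub_mul, mul_one, hb]
    rw [this, sq]
    simp only [mul_sub, sub_mul, mul_smul_comm, smul_mul_assoc, mul_one, smul_sub, smul_smul]
  rw [h3, sub_mul, h2, smul_mul_assoc, one_mul, smul_sub, sub_smul, one_smul]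
  abel

theorem sq_eq_one_of_rank_sub_lt {F V : Type*} [Field F] [AddCommGroup V] [Module F V]
    (hV : ℵ₀ ≤ Module.rank F V) {b c m u : Module.End F V} (hb : b * b = 1) (hc : c * c = 1)
    (hm : m * m = 0) (hu : u = (1 + m) * b * c) {l : F}
    (hl : LinearMap.rank (u - l • 1) < Module.rank F V) : l ^ 2 = 1 := by
  let J : Submodule F (Module.End F V) :=
    { carrier := {f | LinearMap.rank f < Module.rank F V}
      add_mem' := fun {f g} hf hg =>
        (LinearMap.rank_add_le f g).trans_lt (Cardinal.add_lt_of_lt hV hf hg)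
      zero_mem' := by
        simpa using Cardinal.aleph0_pos.trans_le hV
      smul_mem' := fun r f hf => by
        show LinearMap.rank (r • f) < _
        exact (Submodule.rank_mono (LinearMap.range_smul_le_range _ _)).trans_lt hf }
  have hJl : ∀ f g, g ∈ J → f * g ∈ J := fun f g hg =>
    (LinearMap.rank_comp_le_right g f).trans_lt hg
  have hJr : ∀ f g, f ∈ J → f * g ∈ J := fun f g hf =>
    (LinearMap.rank_comp_le_left g f).trans_lt hf
  have hf : u - l • 1 ∈ J := hl
  by_contra hne
  set μ := l ^ 2 - 1 with hμ
  have hμ0 : μ ≠ 0 := sub_ne_zero.2 hne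
  have key := involution_sum_identity hb hc hm hu l
  set G := l • (b * (1 - m) * (u - l • 1) * b) + (u - l • 1) * (b * (1 - m) * u * b) with hG
  have hGJ : G ∈ J := J.add_mem (J.smul_mem _ (hJr _ _ (hJl _ _ hf))) (hJr _ _ hf)
  set X := (l ^ 2) • (b * m * b) with hX
  have hXX : X * X = 0 := by
    rw [hX, smul_mul_smul_comm]
    have : b * m * b * (b * m * b) = b * (m * (b * b) * m) * b := by simp only [mul_assoc]
    rw [this, hb, mul_one, hm]; simp
  have hXG : X = (μ • 1 - m) + G := by rw [← hμ] at key; rw [eq_sub_of_add_eq key]; abel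
  have h1 : (μ • 1 - m) * (μ • 1 - m) ∈ J := by
    have e : (μ • 1 - m) * (μ • 1 - m) = X * X - G * X - (μ • 1 - m) * G := by
      rw [hXG]
      generalize (μ • 1 - m : Module.End F V) = Y
      noncomm_ring
    rw [e, hXX]
    exact J.sub_mem (J.sub_mem J.zero_mem (hJr _ _ hGJ)) (hJl _ _ hGJ)
  have h2 : m ∈ J := by
    have e : m * ((μ • 1 - m) * (μ • 1 - m)) = (μ * μ) • m := by
      simp [mul_sub, sub_mul, hm, smul_smul]
    have := hJl m _ h1
    rw [e] at this
    exact (J.smul_mem_iff (mul_ne_zero hμ0 hμ0)).1 this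
  have h3 : (1 : Module.End F V) ∈ J := by
    have e : (μ • 1 - m) * (μ • 1 - m) + (2 * μ) • m = (μ * μ) • (1 : Module.End F V) := by
      simp only [mul_sub, sub_mul, hm, smul_mul_assoc, mul_smul_comm, one_mul, mul_one,
        smul_smul, smul_sub, two_mul, add_smul, sub_zero]
      abel
    have := J.add_mem h1 (J.smul_mem (2 * μ) h2)
    rw [e] at this
    exact (J.smul_mem_iff (mul_ne_zero hμ0 hμ0)).1 this
  have h4 : LinearMap.rank (1 : Module.End F V) < Module.rank F V := h3
  rw [LinearMap.rank, Module.End.one_eq_id, LinearMap.range_id, rank_top] at h4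
  exact lt_irrefl _ h4

theorem exists_invariant_finiteDimensional {F V : Type*} [Field F] [AddCommGroup V] [Module F V]
    {b c m u : Module.End F V} (hb : b * b = 1) (hc : c * c = 1)
    (hm : m * m = 0) (hu : u = (1 + m) * b * c) {l : F} (hl : l ^ 2 = 1)
    (hfin : LinearMap.rank (u - l • 1) < ℵ₀) :
    ∃ W : Submodule F V, FiniteDimensional F W ∧ LinearMap.range (u - l • 1) ≤ W ∧
      W ≤ W.comap m ∧ W ≤ W.comap b ∧ W ≤ W.comap c ∧ W ≤ W.comap u := by
  have key := involution_sum_identity hb hc hm hu l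
  rw [hl, one_smul, sub_self, zero_smul, zero_add] at key
  set f := u - l • (1 : Module.End F V) with hf
  have hfd : FiniteDimensional F (LinearMap.range f) := Module.rank_lt_aleph0_iff.1 hfin
  have hbb : ∀ v, b (b v) = v := fun v => LinearMap.congr_fun hb v
  have hmm : ∀ v, m (m v) = 0 := fun v => LinearMap.congr_fun hm v
  let R := LinearMap.range f
  let E₀ := R ⊔ R.map m
  let E := E₀ ⊔ E₀.map b
  let W₀ := E.map m
  let W := E ⊔ W₀ ⊔ W₀.map b
  have hE₀ : E₀ ≤ E := le_sup_left
  have hR : R ≤ E := le_sup_left.trans hE₀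
  have hEb : E ≤ E.comap b := by
    refine sup_le (fun v hv => ?_) ?_
    · exact le_sup_right (a := E₀) (Submodule.mem_map_of_mem hv)
    · rintro _ ⟨v, hv, rfl⟩
      simpa [hbb] using hE₀ hv
  have hG : ∀ v, b (m (b v)) + m v ∈ E := fun v => by
    have := LinearMap.congr_fun key v
    simp only [LinearMap.add_apply, Module.End.mul_apply, LinearMap.smul_apply,
      LinearMap.sub_apply, Module.End.one_apply, map_sub b] at this
    rw [this]
    refine E.add_mem (E.smul_mem _ (E.sub_mem (hEb (hR ⟨_, rfl⟩)) (hEb (hE₀ ?_)))) (hR ⟨_, rfl⟩)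
    exact le_sup_right (a := R) (Submodule.mem_map_of_mem ⟨_, rfl⟩)
  have hEW : E ≤ W := le_sup_left.trans le_sup_left
  have hW₀W : W₀ ≤ W := le_sup_right.trans (le_sup_left (b := W₀.map b))
  have hWb : W ≤ W.comap b := by
    refine sup_le (sup_le (hEb.trans (Submodule.comap_mono hEW)) fun v hv => ?_) ?_
    · exact le_sup_right (a := E ⊔ W₀) (Submodule.mem_map_of_mem hv)
    · rintro _ ⟨v, hv, rfl⟩
      simpa [hbb] using hW₀W hv
  have hWm : W ≤ W.comap m := by
    refine sup_le (sup_le (fun v hv => hW₀W (Submodule.mem_map_of_mem hv)) ?_) ?_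
    · rintro _ ⟨v, hv, rfl⟩
      simp [hmm]
    · rintro _ ⟨_, ⟨v, hv, rfl⟩, rfl⟩
      have h1 := hEb (hG (m v))
      simp only [hmm, add_zero, Submodule.mem_comap, hbb] at h1
      exact hEW h1
  have hWu : W ≤ W.comap u := fun v hv => by
    have : u v = f v + l • v := by simp [hf]
    rw [Submodule.mem_comap, this]
    exact W.add_mem (hEW (hR ⟨_, rfl⟩)) (W.smul_mem _ hv)
  have hcu : c = b * (u - m * u) := by
    have : u - m * u = b * c := by
      rw [hu]
      have : (1 + m) * b * c - m * ((1 + m) * b * c) = b * c - m * m * b * c := by noncomm_ring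
      rw [this, hm]; simp
    rw [this, ← mul_assoc, hb, one_mul]
  refine ⟨W, inferInstance, hR.trans hEW, hWm, hWb, fun v hv => ?_, hWu⟩
  rw [Submodule.mem_comap, hcu]
  exact hWb (W.sub_mem (hWu hv) (hWm (hWu hv)))

theorem restrict_mul_restrict_eq_one {F V : Type*} [Field F] [AddCommGroup V] [Module F V]
    {b : Module.End F V} (hb : b * b = 1) {W : Submodule F V} (hW : W ≤ W.comap b) :
    LinearMap.restrict b hW * LinearMap.restrict b hW = 1 := by
  ext v
  exact LinearMap.congr_fun hb v.1

theorem inducedDet_sq_eq_one {F V : Type*} [Field F] [AddCommGroup V] [Module F V]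
    {b c m u : Module.End F V} (hb : b * b = 1) (hc : c * c = 1)
    (hm : m * m = 0) (hu : u = (1 + m) * b * c) {l : F} (hl : l ^ 2 = 1)
    (hfin : LinearMap.rank (u - l • 1) < ℵ₀) : inducedDet u l ^ 2 = 1 := by
  obtain ⟨W, hWf, hRW, hWm, hWb, hWc, hWu⟩ := exists_invariant_finiteDimensional hb hc hm hu hl hfin
  obtain ⟨k, hk⟩ := exists_det_eq_det_mul_pow (Submodule.inclusion hRW)
    (Submodule.inclusion_injective hRW) (u.restrict hWu)
    (LinearMap.restrict u (maps_range_self u l)) (by ext v; rfl) l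
    (fun v => ⟨⟨(u - l • 1) v.1, ⟨_, rfl⟩⟩, by ext; rfl⟩)
  have hprod : u.restrict hWu = (1 + m.restrict hWm) * b.restrict hWb * c.restrict hWc := by
    ext v
    exact LinearMap.congr_fun hu v.1
  have h1 : LinearMap.det (1 + m.restrict hWm) = 1 := by
    refine det_eq_one_of_sub_one_sq_eq_zero ?_
    rw [add_sub_cancel_left, sq]
    ext v
    exact LinearMap.congr_fun hm v.1
  have h2 := congrArg LinearMap.det (restrict_mul_restrict_eq_one hb hWb)
  have h3 := congrArg LinearMap.det (restrict_mul_restrict_eq_one hc hWc)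
  rw [map_mul, map_one] at h2 h3
  rw [hprod, map_mul, map_mul, h1, one_mul] at hk
  change _ = inducedDet u l * l ^ k at hk
  calc inducedDet u l ^ 2 = (inducedDet u l * l ^ k) ^ 2 := by
        rw [mul_pow, ← pow_mul, mul_comm k, pow_mul, hl, one_pow, mul_one]
    _ = 1 := by rw [← hk, mul_pow, sq, sq, h2, h3, one_mul]

theorem not_dominant_of_isProd {F V : Type*} [Field F] [AddCommGroup V] [Module F V]
    (hV : ℵ₀ ≤ Module.rank F V) {u : Module.End F V}
    (h : ∃ a b c : Module.End F V, (a - 1) ^ 2 = 0 ∧ b * b = 1 ∧ c * c = 1 ∧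
        u = a * b * c) :
      ¬ ((∃ lam : F, LinearMap.rank (u - lam • 1) < Module.rank F V ∧ lam ^ 2 ≠ 1) ∨
         (∃ lam : F, (lam = 1 ∨ lam = -1) ∧ LinearMap.rank (u - lam • 1) < ℵ₀ ∧
            inducedDet u lam ≠ 1 ∧ inducedDet u lam ≠ -1)) := by
  obtain ⟨a, b, c, ha, hb, hc, hu⟩ := h
  have hm : (a - 1) * (a - 1) = 0 := by rw [← sq, ha]
  have hu' : u = (1 + (a - 1)) * b * c := by rw [hu]; congr 2; abel
  rintro (⟨l, hl, hl'⟩ | ⟨l, hl, hfin, h1, h2⟩)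
  · exact hl' (sq_eq_one_of_rank_sub_lt hV hb hc hm hu' hl)
  · have hl2 : l ^ 2 = 1 := by rcases hl with rfl | rfl <;> simp
    rcases sq_eq_one_iff.1 (inducedDet_sq_eq_one hb hc hm hu' hl2 hfin) with h | h
    · exact h1 h
    · exact h2 h

/-- If `u x ∈ F x` modulo `Z` for every vector `x`, then `u` is scalar modulo `Z`, provided that
`Z` has codimension at least two. -/
theorem exists_range_sub_smul_le {F V : Type*} [Field F] [AddCommGroup V] [Module F V]
    (u : Module.End F V) (Z : Submodule F V) (hZ : 1 < Module.rank F (V ⧸ Z))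
    (h : ∀ v, v ∉ Z → ∃ l : F, u v - l • v ∈ Z) :
    ∃ l : F, LinearMap.range (u - l • 1) ≤ Z := by
  have hmem : ∀ v, Z.mkQ v = 0 ↔ v ∈ Z := fun v => by simp
  have hq : ∀ v, v ∉ Z → ∃ l : F, Z.mkQ (u v) = l • Z.mkQ v := fun v hv => by
    obtain ⟨l, hl⟩ := h v hv
    exact ⟨l, by rwa [← sub_eq_zero, ← map_smul, ← map_sub, hmem]⟩
  have hspan : ∀ z ∈ Z, ∀ w, w ∉ Z → ∃ l : F, Z.mkQ (u z) = l • Z.mkQ w := fun z hz w hw => by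
    obtain ⟨l, hl⟩ := hq w hw
    obtain ⟨k, hk⟩ := hq (w + z) (fun hwz => hw (by simpa using Z.sub_mem hwz hz))
    refine ⟨k - l, ?_⟩
    rw [map_add, map_add, hl, map_add, (hmem z).2 hz, add_zero] at hk
    rw [sub_smul, ← hk]; abel
  have hinv : Z ≤ Z.comap u := fun z hz => by
    obtain ⟨x, hx⟩ : ∃ x : V ⧸ Z, x ≠ 0 :=
      (rank_pos_iff_exists_ne_zero.1 (zero_lt_one.trans hZ))
    obtain ⟨y, hxy⟩ := exists_linearIndependent_pair_of_one_lt_rank hZ hx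
    obtain ⟨w, rfl⟩ := Z.mkQ_surjective x
    obtain ⟨w', rfl⟩ := Z.mkQ_surjective y
    have hx' : Z.mkQ w' ≠ 0 := hxy.ne_zero 1
    obtain ⟨a, ha⟩ := hspan z hz w (fun hw => hx ((hmem w).2 hw))
    obtain ⟨b, hb⟩ := hspan z hz w' (fun hw => hx' ((hmem w').2 hw))
    have := LinearIndependent.pair_iff.1 hxy a (-b) (by rw [← ha, neg_smul, ← hb]; abel)
    rw [this.1, zero_smul, hmem] at ha
    exact ha
  obtain ⟨l, hl⟩ := LinearMap.exists_eq_smul_id_of_forall_notLinearIndependent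
    (f := Z.mapQ Z u hinv) (fun x hx => by
      obtain ⟨v, rfl⟩ := Z.mkQ_surjective x
      have hv : v ∉ Z := fun hv => hx.ne_zero 0 ((hmem v).2 hv)
      obtain ⟨l, hl⟩ := hq v hv
      have := LinearIndependent.pair_iff.1 hx l (-1) (by
        change l • Z.mkQ v + (-1 : F) • Z.mkQ (u v) = 0
        rw [hl]; simp)
      simpa using this.2)
  refine ⟨l, ?_⟩
  rintro _ ⟨v, rfl⟩
  have := LinearMap.congr_fun hl (Z.mkQ v)
  change Z.mkQ (u v) = l • Z.mkQ v at this
  rw [← hmem]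
  simp only [LinearMap.sub_apply, LinearMap.smul_apply, Module.End.one_apply, map_sub, map_smul,
    this, sub_self]

/-- An automorphism without dominant eigenvalue maps some subspace of full dimension to a subspace
that is independent of it. -/
theorem exists_disjoint_map_of_rank_sub {F V : Type*} [Field F] [AddCommGroup V] [Module F V]
    (hV : ℵ₀ ≤ Module.rank F V) (u : V ≃ₗ[F] V)
    (h : ∀ l : F, ¬ LinearMap.rank ((u : Module.End F V) - l • 1) < Module.rank F V) :
    ∃ N : Submodule F V, Disjoint N (N.map (u : V →ₗ[F] V)) ∧
      Module.rank F N = Module.rank F V := by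
  obtain ⟨N, -, hN⟩ := zorn_le_nonempty₀ {N : Submodule F V | Disjoint N (N.map (u : V →ₗ[F] V))}
    (fun c hc hchain y hy => by
      refine ⟨sSup c, ?_, fun z hz => le_sSup hz⟩
      have hd := hchain.directedOn
      rw [Set.mem_ofPred_eq, Submodule.disjoint_def]
      rintro _ hx ⟨y, hy', rfl⟩
      obtain ⟨N₁, h₁, hx₁⟩ := (Submodule.mem_sSup_of_directed ⟨_, hy⟩ hd).1 hx
      obtain ⟨N₂, h₂, hy₂⟩ := (Submodule.mem_sSup_of_directed ⟨_, hy⟩ hd).1 hy'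
      obtain ⟨N₃, h₃, h13, h23⟩ := hd N₁ h₁ N₂ h₂
      exact Submodule.disjoint_def.1 (hc h₃) _ (h13 hx₁) ⟨y, h23 hy₂, rfl⟩)
    ⊥ (by simp)
  refine ⟨N, hN.prop, (Submodule.rank_le N).antisymm (not_lt.1 fun hlt => ?_)⟩
  set Z := N ⊔ N.map (u : V →ₗ[F] V) with hZ
  have hZlt : Module.rank F Z < Module.rank F V :=
    (Submodule.rank_add_le_rank_add_rank _ _).trans_lt
      (Cardinal.add_lt_of_lt hV hlt ((rank_map_le _ _).trans_lt hlt))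
  have hdisj := Submodule.disjoint_def.1 hN.prop
  have hq : 1 < Module.rank F (V ⧸ Z) := by
    by_contra hle
    have := Submodule.rank_quotient_add_rank Z
    refine (Cardinal.add_lt_of_lt hV ?_ hZlt).ne this
    exact (not_lt.1 hle).trans_lt (Cardinal.one_lt_aleph0.trans_le hV)
  obtain ⟨l, hl⟩ := exists_range_sub_smul_le (u : Module.End F V) Z hq (fun v hv => by
    by_contra! hcon
    refine hv (le_sup_left (a := N) (hN.le_of_ge (y := N ⊔ F ∙ v) ?_ le_sup_left
      (le_sup_right (a := N) (Submodule.mem_span_singleton_self v))))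
    rw [Set.mem_ofPred_eq, Submodule.disjoint_def]
    rintro _ hx ⟨y, hy, rfl⟩
    obtain ⟨n, hn, _, hav, hx⟩ := Submodule.mem_sup.1 hx
    obtain ⟨a, rfl⟩ := Submodule.mem_span_singleton.1 hav
    obtain ⟨n', hn', _, hbv, rfl⟩ := Submodule.mem_sup.1 hy
    obtain ⟨b, rfl⟩ := Submodule.mem_span_singleton.1 hbv
    have hZ1 : n ∈ Z := le_sup_left (a := N) hn
    have hZ2 : (u : V →ₗ[F] V) n' ∈ Z := le_sup_right (a := N) ⟨n', hn', rfl⟩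
    have key : b • u v - a • v = n - u n' := by
      simp only [LinearEquiv.coe_coe, map_add, map_smul] at hx
      rw [sub_eq_sub_iff_add_eq_add, add_comm, ← hx]
    have hmem : b • u v - a • v ∈ Z := key ▸ Z.sub_mem hZ1 hZ2
    by_cases hb : b = 0
    · subst hb
      by_cases ha : a = 0
      · subst ha
        simp only [zero_smul, add_zero] at hx ⊢
        rw [← hx]
        exact hdisj _ hn ⟨n', hn', hx.symm⟩
      · rw [zero_smul, zero_sub, Z.neg_mem_iff, Z.smul_mem_iff ha] at hmem
        exact absurd hmem hv
    · refine absurd ?_ (hcon (b⁻¹ * a))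
      have := Z.smul_mem b⁻¹ hmem
      rwa [smul_sub, smul_smul, smul_smul, inv_mul_cancel₀ hb, one_smul] at this)
  exact h l ((Submodule.rank_mono hl).trans_lt hZlt)

theorem exists_wellFounded_recursion {I V : Type*} [LinearOrder I] [WellFoundedLT I]
    (Φ : I → (I → V) → V) (hΦ : ∀ k γ γ', (∀ l < k, γ l = γ' l) → Φ k γ = Φ k γ') [Zero V] :
    ∃ β : I → V, ∀ k, β k = Φ k β := by
  classical
  refine ⟨(wellFounded_lt (α := I)).fix
    (fun k γ => Φ k fun l => if h : l < k then γ l h else 0), fun k => ?_⟩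
  rw [WellFounded.fix_eq]
  refine hΦ _ _ _ fun l hl => ?_
  rw [dif_pos hl]

theorem exists_injective_forall_lt {D I : Type*} [LinearOrder I] [Infinite I]
    (p : D × I → I) (hp : Function.Injective p) (hI : ∀ i : I, #(Set.Iio i) < #I)
    (S : D → Finset I) :
    ∃ σ : D → I, Function.Injective σ ∧ ∀ d, ∀ l ∈ S d, l < σ d := by
  have key : ∀ d, ∃ s, ∀ l ∈ S d, l < p (d, s) := fun d => by
    by_contra! hcon
    have hne : (S d).Nonempty := by
      obtain ⟨l, hl, -⟩ := hcon (Classical.arbitrary I)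
      exact ⟨l, hl⟩
    have hle : ∀ s, p (d, s) ∈ Set.Iic ((S d).max' hne) := fun s => by
      obtain ⟨l, hl, hs⟩ := hcon s
      exact hs.trans ((S d).le_max' l hl)
    have hinj : Function.Injective
        (fun s => (⟨p (d, s), hle s⟩ : Set.Iic ((S d).max' hne))) := fun s t hst => by
      simpa using hp (congrArg Subtype.val hst)
    have h1 := Cardinal.mk_le_of_injective hinj
    have h2 : #(Set.Iic ((S d).max' hne)) ≤ #(Set.Iio ((S d).max' hne)) + 1 := by
      rw [← Set.Iio_insert]
      exact Cardinal.mk_insert_le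
    exact absurd (h1.trans h2) (not_le.2 (Cardinal.add_lt_of_lt (Cardinal.aleph0_le_mk I) (hI _)
      (Cardinal.one_lt_aleph0.trans_le (Cardinal.aleph0_le_mk I))))
  choose s hs using key
  exact ⟨fun d => p (d, s d), fun d d' h => congrArg Prod.fst (hp h), hs⟩

theorem isUnipInvolProd_of_basis {F V I J : Type*} [Field F] [AddCommGroup V] [Module F V]
    [LinearOrder I] [WellFoundedLT I] (B : Module.Basis ((I ⊕ I) ⊕ J) F V) (u : V ≃ₗ[F] V)
    (hu : ∀ i, u (B (.inl (.inl i))) = B (.inl (.inr i)))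
    (idx : (I ⊕ I) ⊕ J → I) (hidx₁ : ∀ i, idx (.inl (.inl i)) = i)
    (hidx₂ : ∀ i, idx (.inl (.inr i)) = i)
    (g : I ⊕ J → V) (hg₁ : ∀ i, g (.inl i) = B (.inl (.inr i))) (hg₂ : ∀ j, g (.inr j) = B (.inr j))
    (σ : I ⊕ J → I) (hσ : Function.Injective σ)
    (hg : ∀ d, g d ∈ Submodule.span F (B '' {t | idx t < σ d}))
    (hug : ∀ d, u (g d) ∈ Submodule.span F (B '' {t | idx t < σ d})) :
    IsUnipInvolProd (u : Module.End F V) := by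
  classical
  set f : I → V := fun i => B (.inl (.inl i)) with hf
  set e : I → V := fun i => B (.inl (.inr i)) with he
  set m : Module.End F V := B.constr F
    (Sum.elim (Sum.elim (fun _ => 0) fun i => e (σ (.inl i))) fun j => e (σ (.inr j))) with hm
  have hmf : ∀ i, m (f i) = 0 := fun i => by simp [hm, hf, B.constr_basis]
  have hmg : ∀ d, m (g d) = e (σ d) := by
    rintro (i | j)
    · rw [hg₁]; simp [hm, B.constr_basis]
    · rw [hg₂]; simp [hm, B.constr_basis]
  have huf : ∀ i, u (f i) = e i := hu
  have huf' : ∀ i, u.symm (e i) = f i := fun i => by rw [← huf, u.symm_apply_apply]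
  have ext_basis : ∀ p q : Module.End F V, (∀ i, p (f i) = q (f i)) → (∀ d, p (g d) = q (g d)) →
      p = q := fun p q h1 h2 => B.ext fun t => by
    rcases t with (i | i) | j
    · exact h1 i
    · simpa only [hg₁] using h2 (.inl i)
    · simpa only [hg₂] using h2 (.inr j)
  set v : Module.End F V := (u.symm : Module.End F V) with hv
  have huv : (u : Module.End F V) * v = 1 := by ext; simp [hv]
  have hvu : v * (u : Module.End F V) = 1 := by ext; simp [hv]
  have hmvm : m * v * m = 0 := ext_basis _ _ (fun i => by simp [hmf])
    (fun d => by simp [hmg, hv, huf', hmf])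
  set x : Module.End F V := u + m with hx
  set y : Module.End F V := v - v * m * v with hy
  have hyx : y * x = 1 := by
    have : y * x = v * u + v * m - v * m * (v * u) - v * (m * v * m) := by
      rw [hx, hy]; noncomm_ring
    rw [this, hvu, hmvm]; simp
  have hxy : x * y = 1 := by
    have : x * y = u * v + m * v - (u * v) * m * v - (m * v * m) * v := by
      rw [hx, hy]; noncomm_ring
    rw [this, huv, hmvm]; simp
  have hyx' : ∀ w, y (x w) = w := fun w => LinearMap.congr_fun hyx w
  have hxf : ∀ i, x (f i) = e i := fun i => by simp [hx, hmf, huf]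
  have hxg : ∀ d, x (g d) = u (g d) + e (σ d) := fun d => by simp [hx, hmg]
  let b' : (I → V) → Module.End F V := fun γ =>
    B.constr F (Sum.elim (Sum.elim γ fun i => y (γ i)) fun j => B (.inr j))
  have hb'f : ∀ γ i, b' γ (f i) = γ i := fun γ i => by simp [b', hf, B.constr_basis]
  have hb'e : ∀ γ i, b' γ (e i) = y (γ i) := fun γ i => by simp [b', he, B.constr_basis]
  have hb'c : ∀ γ j, b' γ (B (.inr j)) = B (.inr j) := fun γ j => by simp [b', B.constr_basis]
  have hcongr : ∀ k γ γ', (∀ l < k, γ l = γ' l) →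
      ∀ w ∈ Submodule.span F (B '' {t | idx t < k}), b' γ w = b' γ' w := fun k γ γ' h w hw => by
    refine LinearMap.eqOn_span (f := b' γ) (g := b' γ') ?_ hw
    rintro _ ⟨(i | i) | j, ht, rfl⟩
    · have ht : i < k := by simpa only [Set.mem_ofPred_eq, hidx₁] using ht
      change b' γ (f i) = b' γ' (f i)
      rw [hb'f, hb'f, h i ht]
    · have ht : i < k := by simpa only [Set.mem_ofPred_eq, hidx₂] using ht
      change b' γ (e i) = b' γ' (e i)
      rw [hb'e, hb'e, h i ht]
    · rw [hb'c, hb'c]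
  obtain ⟨β, hβ⟩ := exists_wellFounded_recursion (I := I) (V := V)
    (fun k γ => if h : ∃ d, σ d = k then b' γ (g h.choose) - x (b' γ (u (g h.choose))) else f k)
    (fun k γ γ' h => by
      by_cases hk : ∃ d, σ d = k
      · simp only [dif_pos hk]
        have h1 := hg hk.choose
        have h2 := hug hk.choose
        rw [hk.choose_spec] at h1 h2
        rw [hcongr k γ γ' h _ h1, hcongr k γ γ' h _ h2]
      · simp only [dif_neg hk])
  set b := b' β with hb
  have hβσ : ∀ d, β (σ d) = b (g d) - x (b (u (g d))) := fun d => by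
    have hk : ∃ d', σ d' = σ d := ⟨d, rfl⟩
    rw [hβ, dif_pos hk, hσ hk.choose_spec]
  have hbx : b * x = y * b := by
    refine ext_basis _ _ (fun i => ?_) (fun d => ?_)
    · simp only [Module.End.mul_apply, hxf, hb, hb'e, hb'f]
    · simp only [Module.End.mul_apply, hxg, map_add]
      rw [hb, hb'e, ← hb, hβσ, map_sub, hyx']
      abel
  have hxb : x * b = b * y := by
    calc x * b = x * b * (x * y) := by rw [hxy, mul_one]
      _ = x * (b * x) * y := by simp only [mul_assoc]
      _ = (x * y) * b * y := by rw [hbx]; simp only [mul_assoc]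
      _ = b * y := by rw [hxy, one_mul]
  have hbbx : ∀ w, b (b (x w)) = x (b (b w)) := fun w => by
    have : b * (b * x) = x * (b * b) := by rw [hbx, ← mul_assoc, ← hxb, mul_assoc]
    exact LinearMap.congr_fun this w
  have hbbf : ∀ k, b (b (f k)) = f k := fun k => by
    induction k using WellFoundedLT.induction with
    | ind k ih =>
      have hspan : ∀ w ∈ Submodule.span F (B '' {t | idx t < k}), (b * b) w = w :=
        fun w hw => by
          refine LinearMap.eqOn_span (f := b * b) (g := LinearMap.id) ?_ hw
          rintro _ ⟨(i | i) | j, ht, rfl⟩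
          · exact ih i (by simpa only [Set.mem_ofPred_eq, hidx₁] using ht)
          · have := ih i (by simpa only [Set.mem_ofPred_eq, hidx₂] using ht)
            change b (b (e i)) = e i
            rw [← hxf, hbbx, this]
          · change b (b (B (.inr j))) = B (.inr j)
            rw [hb, hb'c, hb'c]
      rw [hb, hb'f, ← hb]
      by_cases hk : ∃ d, σ d = k
      · obtain ⟨d, rfl⟩ := hk
        have h1 := hspan _ (hg d)
        have h2 := hspan _ (hug d)
        have h3 : b (x (b (u (g d)))) = y ((b * b) (u (g d))) := LinearMap.congr_fun hbx _
        rw [hβσ, map_sub, h3, h2]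
        change (b * b) (g d) - _ = _
        have h4 := hyx' (g d)
        have h5 := hyx' (f (σ d))
        rw [hxf] at h5
        rw [hxg, map_add, h5] at h4
        rw [h1, sub_eq_iff_eq_add', h4]
      · rw [hβ, dif_neg hk, hb, hb'f, hβ, dif_neg hk]
  have hbb : b * b = 1 := B.ext fun t => by
    rcases t with (i | i) | j
    · exact hbbf i
    · change b (b (e i)) = e i
      rw [← hxf, hbbx, hbbf]
    · change b (b (B (.inr j))) = B (.inr j)
      rw [hb, hb'c, hb'c]
  refine (IsInvolProd.of_reverses hyx hbb hbx).isUnipInvolProd (n := -(m * v)) ?_ ?_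
  · have : -(m * v) * -(m * v) = m * v * m * v := by noncomm_ring
    rw [this, hmvm, zero_mul]
  · have : (1 - -(m * v)) * u = u + m * (v * u) := by noncomm_ring
    rw [this, hvu, mul_one]

theorem isUnipInvolProd_of_forall_rank_sub {F V : Type*} [Field F] [AddCommGroup V] [Module F V]
    (hV : ℵ₀ ≤ Module.rank F V) (u : V ≃ₗ[F] V)
    (h : ∀ l : F, ¬ LinearMap.rank ((u : Module.End F V) - l • 1) < Module.rank F V) :
    IsUnipInvolProd (u : Module.End F V) := by
  classical
  obtain ⟨N, hN, hrank⟩ := exists_disjoint_map_of_rank_sub hV u h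
  let I := (Module.rank F V).ord.ToType
  have hI : #I = Module.rank F V := by simp [I]
  have : Infinite I := Cardinal.infinite_iff.2 (hI ▸ hV)
  let BN := Module.Basis.ofVectorSpace F N
  obtain ⟨ε⟩ : Nonempty (I ≃ Module.Basis.ofVectorSpaceIndex F N) := by
    rw [← Cardinal.eq, hI, ← hrank, ← BN.mk_eq_rank'']
  let b : Module.Basis I F N := BN.reindex ε.symm
  have hbi : LinearIndependent F (fun i => (b i : V)) :=
    b.linearIndependent.map' N.subtype N.ker_subtype
  have hbi' : LinearIndependent F (fun i => u (b i)) :=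
    hbi.map' (u : V →ₗ[F] V) u.ker
  have hli : LinearIndependent F (Sum.elim (fun i => (b i : V)) fun i => u (b i)) := by
    refine hbi.sum_type hbi' (hN.mono ?_ ?_)
    · rw [Submodule.span_le]
      rintro _ ⟨i, rfl⟩
      exact (b i).2
    · rw [Submodule.span_le]
      rintro _ ⟨i, rfl⟩
      exact ⟨_, (b i).2, rfl⟩
  let J := Module.Basis.sumExtendIndex hli
  let B : Module.Basis ((I ⊕ I) ⊕ J) F V := Module.Basis.sumExtend hli
  have hB : ∀ t, B (.inl t) = Sum.elim (fun i => (b i : V)) (fun i => u (b i)) t := fun t => by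
    simp only [B, Module.Basis.sumExtend, Module.Basis.reindex_apply, Module.Basis.extend_apply_self]
    rfl
  have hcard := B.mk_eq_rank''
  have hDI : #((I ⊕ J) × I) ≤ #I := by
    have h1 : #(I ⊕ J) ≤ #I := by
      rw [hI, ← hcard]
      exact Cardinal.mk_le_of_injective (f := Sum.map Sum.inl id)
        (Sum.map_injective.2 ⟨Sum.inl_injective, Function.injective_id⟩)
    rw [Cardinal.mk_prod, Cardinal.lift_id, Cardinal.lift_id]
    exact (mul_le_mul_left h1 _).trans (Cardinal.mul_eq_self (hI ▸ hV)).le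
  obtain ⟨⟨p, hp⟩⟩ := (Cardinal.le_def _ _).1 hDI
  let idx : (I ⊕ I) ⊕ J → I := Sum.elim (Sum.elim id id) fun _ => Classical.arbitrary I
  let g : I ⊕ J → V := Sum.elim (fun i => B (.inl (.inr i))) fun j => B (.inr j)
  obtain ⟨σ, hσ, hlt⟩ := exists_injective_forall_lt p hp
    (fun i => Cardinal.mk_Iio_lt i (by simp [I]))
    (fun d => ((B.repr (g d)).support ∪ (B.repr (u (g d))).support).image idx)
  refine isUnipInvolProd_of_basis B u (fun i => by simp [hB]) idx (fun _ => rfl) (fun _ => rfl) g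
    (fun _ => rfl) (fun _ => rfl) σ hσ (fun d => ?_) (fun d => ?_)
  · refine Submodule.span_mono (Set.image_mono fun t ht => ?_) (B.mem_span_repr_support (g d))
    exact hlt d _ (Finset.mem_image_of_mem _ (Finset.mem_union_left _ ht))
  · refine Submodule.span_mono (Set.image_mono fun t ht => ?_) (B.mem_span_repr_support (u (g d)))
    exact hlt d _ (Finset.mem_image_of_mem _ (Finset.mem_union_right _ ht))

theorem exists_submodule_rank_eq {F V : Type*} [Field F] [AddCommGroup V] [Module F V]
    (K : Submodule F V) {c : Cardinal} (hc : c ≤ Module.rank F K) :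
    ∃ P ≤ K, Module.rank F P = c := by
  obtain ⟨s, hs, hli⟩ := le_rank_iff_exists_linearIndependent.1 hc
  refine ⟨(Submodule.span F s).map K.subtype, Submodule.map_subtype_le _ _, ?_⟩
  rw [LinearEquiv.rank_eq (Submodule.equivSubtypeMap K (Submodule.span F s)).symm, rank_span_set hli,
    hs]

theorem isUnipInvolProd_of_infinite_rank_sub_one {F V : Type*} [Field F] [AddCommGroup V]
    [Module F V] (u : V ≃ₗ[F] V) (h₁ : ℵ₀ ≤ LinearMap.rank ((u : Module.End F V) - 1))
    (h₂ : LinearMap.rank ((u : Module.End F V) - 1) < Module.rank F V) :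
    IsUnipInvolProd (u : Module.End F V) := by
  set f : Module.End F V := (u : Module.End F V) - 1 with hf
  have huf : ∀ v, u v = v + f v := fun v => by simp [hf]
  have hK : LinearMap.rank f ≤ Module.rank F (LinearMap.ker f) := by
    by_contra! hlt
    exact (Cardinal.add_lt_of_lt (h₁.trans h₂.le) h₂ (hlt.trans h₂)).ne
      (LinearMap.rank_range_add_rank_ker f)
  obtain ⟨P, hPK, hP⟩ := exists_submodule_rank_eq (LinearMap.ker f) hK
  obtain ⟨Q, hQ⟩ := (LinearMap.ker f).exists_isCompl
  have hQr : Module.rank F Q = LinearMap.rank f := by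
    rw [← (Submodule.quotientEquivOfIsCompl _ _ hQ).rank_eq]
    exact f.quotKerEquivRange.rank_eq
  let S := LinearMap.range f ⊔ Q ⊔ P
  have hRS : LinearMap.range f ≤ S := le_sup_left.trans le_sup_left
  have hQS : Q ≤ S := le_sup_right.trans (le_sup_left (b := P))
  have hPS : P ≤ S := le_sup_right
  have hSr : Module.rank F S ≤ LinearMap.rank f := by
    refine (Submodule.rank_add_le_rank_add_rank _ _).trans ?_
    rw [hP]
    refine (add_le_add_left ((Submodule.rank_add_le_rank_add_rank _ _).trans ?_) _).trans
      (Cardinal.add_eq_self h₁).le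
    rw [hQr]
    exact (Cardinal.add_eq_self h₁).le
  have hSu : ∀ v ∈ S, u v ∈ S := fun v hv => by
    rw [huf]
    exact S.add_mem hv (hRS ⟨v, rfl⟩)
  have hSu' : ∀ v ∈ S, u.symm v ∈ S := fun v hv => by
    have : u.symm v = v - f (u.symm v) := by rw [eq_sub_iff_add_eq, ← huf, u.apply_symm_apply]
    rw [this]
    exact S.sub_mem hv (hRS ⟨_, rfl⟩)
  let uS : S ≃ₗ[F] S := LinearEquiv.ofLinearMap ((u : V →ₗ[F] V).restrict hSu)
    ((u.symm : V →ₗ[F] V).restrict hSu') (by ext; simp) (by ext; simp)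
  have huS : ∀ s : S, ((uS s : S) : V) = u s := fun s => rfl
  have hlow : ∀ l : F, Module.rank F P ≤ LinearMap.rank ((uS : Module.End F S) - l • 1) := by
    intro l
    by_cases hl : l = 1
    · rw [hP, LinearMap.rank, LinearMap.rank]
      refine (Submodule.rank_mono ?_).trans (rank_map_le S.subtype _)
      rintro _ ⟨v, rfl⟩
      obtain ⟨k, hk, q, hq, rfl⟩ := Submodule.mem_sup.1 (hQ.sup_eq_top ▸ Submodule.mem_top (x := v))
      refine ⟨_, ⟨⟨q, hQS hq⟩, rfl⟩, ?_⟩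
      rw [map_add, LinearMap.mem_ker.1 hk, zero_add]
      simp [hl, huS, huf]
    · rw [LinearMap.rank]
      refine (Submodule.rank_mono ?_).trans (rank_map_le S.subtype _)
      intro v hv
      refine ⟨_, ⟨(1 - l)⁻¹ • ⟨v, hPS hv⟩, rfl⟩, ?_⟩
      have hfv : f v = 0 := hPK hv
      have hl' : 1 - l ≠ 0 := sub_ne_zero.2 (Ne.symm hl)
      have : u v - l • v = (1 - l) • v := by rw [huf, hfv, sub_smul, one_smul, add_zero]
      rw [map_smul, map_smul]
      simp only [LinearMap.sub_apply, LinearMap.smul_apply, Module.End.one_apply,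
        LinearEquiv.coe_coe, map_sub, map_smul, Submodule.subtype_apply, huS, this]
      rw [smul_smul, inv_mul_cancel₀ hl', one_smul]
  rw [hP] at hlow
  refine (isUnipInvolProd_of_forall_rank_sub ?_ uS fun l hl =>
    (hl.trans_le (hSr.trans (hlow l))).false).extend S.subtype S.subtype_injective _ ?_ ?_
  · rw [← hP] at h₁
    exact h₁.trans (Submodule.rank_mono hPS)
  · ext s
    rfl
  · rw [Submodule.range_subtype, eq_top_iff, ← hQ.sup_eq_top]
    exact sup_le_sup_left hQS _

/-- An invertible cyclic endomorphism `x` whose annihilator also annihilates its inverse `y` is a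
product of two involutions. -/
theorem IsInvolProd.of_cyclic {F V : Type*} [Field F] [AddCommGroup V] [Module F V]
    {x y : Module.End F V} (hyx : y * x = 1) (e : V)
    (he : ∀ v, ∃ q : F[X], aeval x q e = v) (hq : ∀ q : F[X], aeval x q = 0 → aeval y q = 0)
    (r : F[X]) (hr : aeval x r = y) : IsInvolProd x := by
  let L : Module.End F V → F[X] →ₗ[F] V := fun z =>
    (LinearMap.applyₗ e) ∘ₗ (aeval (R := F) z).toLinearMap
  have hL : ∀ z q, L z q = aeval z q e := fun z q => rfl
  have hsurj : LinearMap.range (L x) = ⊤ := LinearMap.range_eq_top.2 he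
  obtain ⟨s, hs⟩ := (L x).exists_rightInverse_of_surjective hsurj
  have hker : ∀ q, L x q = 0 → L y q = 0 := fun q h0 => by
    have : aeval x q = 0 := by
      ext v
      obtain ⟨p, rfl⟩ := he v
      rw [← Module.End.mul_apply, ← map_mul, mul_comm, map_mul, Module.End.mul_apply, ← hL x q, h0]
      simp
    rw [hL, hq q this, LinearMap.zero_apply]
  set b : Module.End F V := L y ∘ₗ s with hb
  have hbL : ∀ q, b (L x q) = L y q := fun q => by
    rw [hb, LinearMap.comp_apply, ← sub_eq_zero, ← map_sub]
    refine hker _ ?_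
    rw [map_sub, sub_eq_zero]
    exact LinearMap.congr_fun hs _
  have hyr : aeval y r = x := by
    have h1 : aeval x (r * X - 1) = 0 := by simp [hr, hyx]
    have h2 := hq _ h1
    have h3 : aeval y (r * X - 1) = aeval y r * y - 1 := by simp
    rw [h3, sub_eq_zero] at h2
    calc aeval y r = aeval y r * (y * x) := by rw [hyx, mul_one]
      _ = x := by rw [← mul_assoc, h2, one_mul]
  refine IsInvolProd.of_reverses (b := b) hyx ?_ ?_
  · ext v
    obtain ⟨q, rfl⟩ := he v
    have h1 : L y q = L x (q.comp r) := by rw [hL, hL, aeval_comp, hr]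
    rw [← hL, Module.End.mul_apply, hbL, h1, hbL, hL, aeval_comp, hyr]
    rfl
  · ext v
    obtain ⟨q, rfl⟩ := he v
    have h1 : ∀ z : Module.End F V, L z (X * q) = z (L z q) := fun z => by
      rw [hL, map_mul, aeval_X]; rfl
    rw [← hL, Module.End.mul_apply, Module.End.mul_apply, hbL, ← h1, hbL, h1]

theorem IsInvolProd.conj {F S V : Type*} [Field F] [AddCommGroup V] [Module F V]
    [AddCommGroup S] [Module F S] {x : Module.End F S} (h : IsInvolProd x) (e : S ≃ₗ[F] V)
    {x' : Module.End F V} (hx : ∀ s, x' (e s) = e (x s)) : IsInvolProd x' :=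
  h.extend (e : S →ₗ[F] V) e.injective x' (by ext s; exact hx s) (by simp)

theorem aeval_inverse_eq_zero {F A : Type*} [Field F] [Ring A] [Algebra F A] {x y : A}
    (hxy : x * y = 1) (hyx : y * x = 1) {q : F[X]} {k l : ℕ}
    (hP : aeval x ((X - 1 : F[X]) ^ k * (X + 1) ^ l) = 0) (h : aeval x q = 0) :
    aeval y q = 0 := by
  obtain ⟨q₁, q₂, h₁, h₂, hq⟩ := exists_dvd_and_dvd_of_dvd_mul (minpoly.dvd F x hP)
  have hp₁ : Prime (X - 1 : F[X]) := by simpa using prime_X_sub_C (1 : F)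
  have hp₂ : Prime (X + 1 : F[X]) := by simpa using prime_X_sub_C (-1 : F)
  obtain ⟨a, -, ha⟩ := (dvd_prime_pow hp₁ _).1 h₁
  obtain ⟨b, -, hb⟩ := (dvd_prime_pow hp₂ _).1 h₂
  have hassoc := ha.mul_mul hb
  obtain ⟨w, hw⟩ := hassoc.dvd
  obtain ⟨w', hw'⟩ := hassoc.symm.dvd
  have hx : (x - 1) ^ a * (x + 1) ^ b = 0 := by
    have := congrArg (aeval x) hw
    rw [map_mul _ (q₁ * q₂), ← hq, minpoly.aeval, zero_mul] at this
    simpa using this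
  have hcomm : Commute x y := hxy.trans hyx.symm
  have hsub : y - 1 = -y * (x - 1) := by rw [mul_sub, neg_mul, hyx, mul_one]; abel
  have hadd : y + 1 = y * (x + 1) := by rw [mul_add, hyx, mul_one, add_comm]
  have hc₁ : Commute (-y) (x - 1) := (hcomm.symm.sub_right (Commute.one_right _)).neg_left
  have hc₂ : Commute y (x + 1) := hcomm.symm.add_right (Commute.one_right _)
  have hc₃ : Commute ((x - 1) ^ a) (y ^ b) :=
    (hcomm.sub_left (Commute.one_left _)).pow_pow a b
  have hy : (y - 1) ^ a * (y + 1) ^ b = 0 := by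
    rw [hsub, hadd, hc₁.mul_pow, hc₂.mul_pow, mul_assoc, ← mul_assoc ((x - 1) ^ a), hc₃.eq,
      mul_assoc, hx, mul_zero, mul_zero]
  have hy' : aeval y ((X - 1 : F[X]) ^ a * (X + 1) ^ b) = 0 := by simpa using hy
  obtain ⟨w, rfl⟩ := minpoly.dvd F x h
  rw [hq, hw', map_mul, map_mul, hy', zero_mul, zero_mul]

theorem isInvolProd_lsmul_X {F M : Type*} [Field F] [AddCommGroup M] [Module F M]
    [Module F[X] M] [IsScalarTower F F[X] M] (e : M) (he : ∀ v, ∃ p : F[X], p • e = v) {k l : ℕ}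
    (h : ∀ v : M, ((X - 1 : F[X]) ^ k * (X + 1) ^ l) • v = 0) :
    IsInvolProd (Algebra.lsmul F F M (X : F[X])) := by
  set P : F[X] := (X - 1) ^ k * (X + 1) ^ l with hP
  have hP0 : P.coeff 0 ≠ 0 := by
    rw [coeff_zero_eq_eval_zero, hP]
    simp
  let Φ : F[X] →ₐ[F] Module.End F M := Algebra.lsmul F F M
  have hΦ : ∀ p : F[X], aeval (Φ X) p = Φ p := fun p => by
    rw [aeval_algHom_apply, aeval_X_left_apply]
  have hΦP : Φ P = 0 := by
    ext v
    exact h v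
  set r : F[X] := -(C (P.coeff 0)⁻¹ * P.divX) with hr
  have hXr : Φ (X * r) = 1 := by
    have h1 : X * r = 1 - C (P.coeff 0)⁻¹ * P := by
      have h2 : X * P.divX = P - C (P.coeff 0) := by
        rw [eq_sub_iff_add_eq, mul_comm, divX_mul_X_add]
      rw [hr, mul_neg, mul_left_comm, h2, mul_sub, ← C_mul, inv_mul_cancel₀ hP0, C_1]
      ring
    rw [h1, map_sub, map_one, map_mul, hΦP, mul_zero, sub_zero]
  have hrX : Φ (r * X) = 1 := by rw [mul_comm, hXr]
  rw [map_mul] at hXr hrX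
  refine IsInvolProd.of_cyclic (x := Φ X) (y := Φ r) hrX e (fun v => ?_)
    (fun p hp => aeval_inverse_eq_zero hXr hrX (k := k) (l := l) ?_ hp) r (hΦ r)
  · obtain ⟨p, rfl⟩ := he v
    refine ⟨p, ?_⟩
    rw [hΦ]
    rfl
  · rw [hΦ, ← hP, hΦP]

theorem isInvolProd_lsmul_directSum {F A ι : Type*} [Field F] [CommRing A] [Algebra F A]
    (M : ι → Type*) [∀ i, AddCommGroup (M i)] [∀ i, Module F (M i)] [∀ i, Module A (M i)]
    [∀ i, IsScalarTower F A (M i)] (a : A)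
    (h : ∀ i, IsInvolProd (Algebra.lsmul F F (M i) a)) :
    IsInvolProd (Algebra.lsmul F F (Π₀ i, M i) a) := by
  choose b c hb hc hbc using h
  refine ⟨DFinsupp.mapRange.linearMap b, DFinsupp.mapRange.linearMap c, ?_, ?_, ?_⟩
  · ext v i
    exact LinearMap.congr_fun (hb i) (v i)
  · ext v i
    exact LinearMap.congr_fun (hc i) (v i)
  · ext v i
    exact LinearMap.congr_fun (hbc i) (v i)

theorem IsInvolProd.of_sub_one_pow_mul_add_one_pow {F V : Type*} [Field F] [AddCommGroup V]
    [Module F V] [FiniteDimensional F V] {x : Module.End F V} {k l : ℕ}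
    (h : (x - 1) ^ k * (x + 1) ^ l = 0) : IsInvolProd x := by
  classical
  set P : F[X] := (X - 1) ^ k * (X + 1) ^ l with hP
  have hPx : aeval x P = 0 := by simpa [hP] using h
  have hPmonic : P.Monic := by
    have h₁ : (X - 1 : F[X]).Monic := by simpa using monic_X_sub_C (1 : F)
    have h₂ : (X + 1 : F[X]).Monic := by simpa using monic_X_add_C (1 : F)
    exact (h₁.pow k).mul (h₂.pow l)
  let e₀ := Module.AEval'.of x
  have hkillV : ∀ v, P • e₀ v = 0 := fun v => by
    rw [← Module.AEval.of_aeval_smul, hPx]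
    simp
  have htors : Module.IsTorsion F[X] (Module.AEval' x) := fun {v} => by
    obtain ⟨v, rfl⟩ := e₀.surjective v
    refine ⟨⟨P, mem_nonZeroDivisors_of_ne_zero hPmonic.ne_zero⟩, ?_⟩
    exact hkillV v
  obtain ⟨ι, _, p, hp, n, ⟨E⟩⟩ := Module.equiv_directSum_of_isTorsion htors
  let M : ι → Type _ := fun i => F[X] ⧸ F[X] ∙ p i ^ n i
  have hsum := isInvolProd_lsmul_directSum (F := F) M X fun i =>
    isInvolProd_lsmul_X (k := k) (l := l) (Submodule.Quotient.mk 1 : M i) (fun v => by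
      obtain ⟨v, rfl⟩ := Submodule.Quotient.mk_surjective _ v
      exact ⟨v, by rw [← Submodule.Quotient.mk_smul, smul_eq_mul, mul_one]⟩) (fun v => by
      have h1 : P • E.symm (DirectSum.lof F[X] ι M i v) = 0 := by
        obtain ⟨w, hw⟩ := e₀.surjective (E.symm (DirectSum.lof F[X] ι M i v))
        rw [← hw]
        exact hkillV w
      rw [← map_smul, LinearEquiv.map_eq_zero_iff, ← map_smul] at h1
      have h2 := congrArg (DirectSum.component F[X] ι M i) h1
      rwa [DirectSum.component.lof_self, map_zero] at h2)
  let E' : (Π₀ i, M i) →ₗ[F] Module.AEval' x :=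
    { E.symm with
      map_smul' := fun c v => by
        have := E.symm.map_smul (algebraMap F F[X] c) v
        rwa [algebraMap_smul, algebraMap_smul] at this }
  let E'' : (Π₀ i, M i) ≃ₗ[F] Module.AEval' x :=
    LinearEquiv.ofBijective E' E.symm.bijective
  refine hsum.conj (E'' ≪≫ₗ e₀.symm) fun s => ?_
  apply e₀.injective
  have h1 : e₀ (x (e₀.symm (E'' s))) = (X : F[X]) • E'' s := by
    have := (Module.AEval'.X_smul_of x (e₀.symm (E'' s))).symm
    rwa [LinearEquiv.apply_symm_apply] at this
  simp only [LinearEquiv.trans_apply, LinearEquiv.apply_symm_apply]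
  rw [h1]
  exact (E.symm.map_smul X s).symm

theorem finrank_le_natDegree_minpoly {F V : Type*} [Field F] [AddCommGroup V] [Module F V]
    [FiniteDimensional F V] (x : Module.End F V) (e : V) (he : ∀ v, ∃ q : F[X], aeval x q e = v) :
    Module.finrank F V ≤ (minpoly F x).natDegree := by
  have hm := minpoly.monic (Algebra.IsIntegral.isIntegral (R := F) x)
  let L : degreeLT F (minpoly F x).natDegree →ₗ[F] V :=
    ((LinearMap.applyₗ e) ∘ₗ (aeval (R := F) x).toLinearMap) ∘ₗ Submodule.subtype _
  have hL : Function.Surjective L := fun v => by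
    obtain ⟨q, rfl⟩ := he v
    refine ⟨⟨q %ₘ minpoly F x, mem_degreeLT.2 ?_⟩, ?_⟩
    · rw [← degree_eq_natDegree hm.ne_zero]
      exact degree_modByMonic_lt _ hm
    · change aeval x (q %ₘ minpoly F x) e = _
      rw [aeval_modByMonic_eq_self_of_root (minpoly.aeval F x)]
  have : FiniteDimensional F (degreeLT F (minpoly F x).natDegree) :=
    (degreeLTEquiv F _).symm.finiteDimensional
  have := LinearMap.finrank_le_finrank_of_surjective hL
  rwa [(degreeLTEquiv F (minpoly F x).natDegree).finrank_eq, Module.finrank_fin_fun] at this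

theorem IsInvolProd.of_cyclic_of_pow_eq {F V : Type*} [Field F] [AddCommGroup V] [Module F V]
    [FiniteDimensional F V] {x : Module.End F V} {c : F} (hc : c * c = 1)
    (hN : 0 < Module.finrank F V) (hx : x ^ Module.finrank F V = c • 1) (e : V)
    (he : ∀ v, ∃ q : F[X], aeval x q e = v) : IsInvolProd x := by
  obtain ⟨N, hN'⟩ := Nat.exists_eq_add_of_lt hN
  rw [zero_add] at hN'
  have hc0 : c ≠ 0 := left_ne_zero_of_mul_eq_one hc
  set P : F[X] := X ^ (N + 1) - C c with hP
  have hPx : aeval x P = 0 := by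
    rw [hN'] at hx
    simp [hP, hx, Algebra.algebraMap_eq_smul_one]
  have hmin : P = minpoly F x := by
    refine eq_of_monic_of_dvd_of_natDegree_le
      (minpoly.monic (Algebra.IsIntegral.isIntegral (R := F) x))
      (monic_X_pow_sub_C c N.succ_ne_zero) (minpoly.dvd F x hPx) ?_
    rw [natDegree_X_pow_sub_C, ← hN']
    exact finrank_le_natDegree_minpoly x e he
  set y : Module.End F V := c • x ^ N with hy
  have hyx : y * x = 1 := by
    rw [hy, smul_mul_assoc, ← pow_succ, ← hN', hx, smul_smul, hc, one_smul]
  have hxy : x * y = 1 := by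
    rw [hy, mul_smul_comm, ← pow_succ', ← hN', hx, smul_smul, hc, one_smul]
  have hyP : aeval y P = 0 := by
    have h1 : y ^ (N + 1) * x ^ (N + 1) = 1 := by
      rw [← (show Commute y x from hyx.trans hxy.symm).mul_pow, hyx, one_pow]
    rw [← hN', hx, mul_smul_comm, mul_one, hN'] at h1
    have h2 : y ^ (N + 1) = c • 1 := by rw [← h1, smul_smul, hc, one_smul]
    simp [hP, h2, Algebra.algebraMap_eq_smul_one]
  refine IsInvolProd.of_cyclic hyx e he (fun q hq => ?_) (C c * X ^ N) (by
    simp [hy, Algebra.algebraMap_eq_smul_one])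
  obtain ⟨w, rfl⟩ := minpoly.dvd F x hq
  rw [← hmin, map_mul, hyP, zero_mul]

theorem aeval_dickson_one {F A : Type*} [Field F] [Ring A] [Algebra F A] {x z : A} {l : F}
    (hxz : x * z = algebraMap F A l) (hzx : z * x = algebraMap F A l) (n : ℕ) :
    aeval (x + z) (dickson 1 l n) = x ^ n + z ^ n := by
  induction n using Nat.twoStepInduction with
  | zero =>
    have : dickson 1 l 0 = 1 + 1 := by rw [dickson_zero]; norm_num
    rw [this, map_add, map_one, pow_zero, pow_zero]
  | one => simp
  | more n ih₀ ih₁ =>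
    rw [dickson_add_two, map_sub, map_mul, map_mul, aeval_X, aeval_C, ih₀, ih₁]
    have h1 : x * z ^ (n + 1) = algebraMap F A l * z ^ n := by rw [pow_succ', ← mul_assoc, hxz]
    have h2 : z * x ^ (n + 1) = algebraMap F A l * x ^ n := by rw [pow_succ', ← mul_assoc, hzx]
    rw [add_mul, mul_add, mul_add, h1, h2, mul_add, ← pow_succ', ← pow_succ']
    abel

theorem monic_natDegree_dickson_one {F : Type*} [Field F] (l : F) (n : ℕ) :
    (dickson 1 l (n + 1)).Monic ∧ (dickson 1 l (n + 1)).natDegree = n + 1 := by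
  induction n using Nat.twoStepInduction with
  | zero => simp [monic_X]
  | one =>
    have : dickson 1 l 2 = X ^ 2 - C (l * 2) := by
      rw [dickson_two, C_mul, map_ofNat]; norm_num
    rw [this]
    exact ⟨monic_X_pow_sub_C _ two_ne_zero, natDegree_X_pow_sub_C⟩
  | more n ih₀ ih₁ =>
    rw [dickson_add_two]
    have hm : (X * dickson 1 l (n + 1 + 1)).Monic := monic_X.mul ih₁.1
    have hd : (X * dickson 1 l (n + 1 + 1)).natDegree = n + 3 := by
      rw [monic_X.natDegree_mul ih₁.1, ih₁.2, natDegree_X]; ring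
    have hlt : (C l * dickson 1 l (n + 1)).natDegree < (X * dickson 1 l (n + 1 + 1)).natDegree := by
      refine (natDegree_C_mul_le _ _).trans_lt ?_
      rw [hd, ih₀.2]; omega
    refine ⟨hm.sub_of_left (degree_lt_degree hlt), ?_⟩
    rw [natDegree_sub_eq_left_of_natDegree_lt hlt, hd]

theorem isUnipInvolProd_prodMap_smul_of_generator {F W : Type*} [Field F] [CommRing W]
    [Algebra F W] [FiniteDimensional F W] [Nontrivial W] {l : F} (hl : l ≠ 1) {r : ℕ}
    (hr : Module.finrank F W = r) (hlr : l ^ r * l ^ r = 1) (T : W)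
    (hT : aeval T (dickson 1 l r) = 0) (hgen : ∀ w, ∃ q : F[X], aeval T q = w) :
    IsUnipInvolProd (LinearMap.prodMap (l • 1) 1 : Module.End F (W × W)) := by
  have hr0 : 0 < r := hr ▸ Module.finrank_pos
  have hl0 : l ≠ 0 := by
    rintro rfl
    rw [zero_pow hr0.ne', zero_mul] at hlr
    exact zero_ne_one hlr
  set L := algebraMap F W l with hL
  set δ := algebraMap F W (l - 1)⁻¹ with hδ
  set ε := algebraMap F W l⁻¹ with hε
  have hδL : δ * (L - 1) = 1 := by
    rw [hδ, hL, ← map_one (algebraMap F W), ← map_sub, ← map_mul,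
      inv_mul_cancel₀ (sub_ne_zero.2 hl)]
  have hεL : ε * L = 1 := by
    rw [hε, hL, ← map_mul, inv_mul_cancel₀ hl0, map_one]
  set u : Module.End F (W × W) := LinearMap.prodMap (l • 1) 1 with hu
  have hu' : ∀ w, u w = (L * w.1, w.2) := fun w => by
    simp [hu, hL, Algebra.smul_def]
  let n : Module.End F (W × W) :=
    { toFun := fun w => (-(L * (T - (1 + L)) * (δ * ε * (w.1 - L * w.2))),
        -((T - (1 + L)) * (δ * ε * (w.1 - L * w.2))))
      map_add' := fun v w => by ext <;> simp <;> ring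
      map_smul' := fun c w => by ext <;> simp [Algebra.smul_def] <;> ring }
  have hn' : ∀ w, n w = (-(L * (T - (1 + L)) * (δ * ε * (w.1 - L * w.2))),
        -((T - (1 + L)) * (δ * ε * (w.1 - L * w.2)))) := fun w => rfl
  have hn : n * n = 0 := by
    refine LinearMap.ext fun w => ?_
    ext <;> simp only [Module.End.mul_apply, hn', LinearMap.zero_apply, Prod.fst_zero,
      Prod.snd_zero] <;> ring
  set x : Module.End F (W × W) := (1 - n) * u with hx
  have hx' : ∀ w, x w = (L * w.1 + L * (T - (1 + L)) * (δ * (w.1 - w.2)),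
      w.2 + (T - (1 + L)) * (δ * (w.1 - w.2))) := fun w => by
    simp only [hx, Module.End.mul_apply, LinearMap.sub_apply, Module.End.one_apply, hu', hn']
    ext
    · simp only [Prod.fst_sub]
      linear_combination L * (T - (1 + L)) * δ * (w.1 - w.2) * hεL
    · simp only [Prod.snd_sub]
      linear_combination (T - (1 + L)) * δ * (w.1 - w.2) * hεL
  let Tm : Module.End F (W × W) := Algebra.lsmul F F (W × W) T
  have hTm : ∀ w, Tm w = (T * w.1, T * w.2) := fun w => rfl
  set z := Tm - x with hz
  have hxz : x * z = algebraMap F _ l := by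
    refine LinearMap.ext fun w => ?_
    rw [Module.algebraMap_end_apply]
    ext
    · rw [Prod.smul_fst, Algebra.smul_def, ← hL]
      simp only [hz, Module.End.mul_apply, LinearMap.sub_apply, hTm, hx', Prod.fst_sub,
        Prod.snd_sub]
      linear_combination (-L * (T - (1 + L)) ^ 2 * δ * (w.1 - w.2) - L * (T - (1 + L)) * w.1) * hδL
    · rw [Prod.smul_snd, Algebra.smul_def, ← hL]
      simp only [hz, Module.End.mul_apply, LinearMap.sub_apply, hTm, hx', Prod.fst_sub,
        Prod.snd_sub]
      linear_combination (-(T - (1 + L)) ^ 2 * δ * (w.1 - w.2) - (T - (1 + L)) * w.2) * hδL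
  have hcomm : Commute Tm x := by
    refine LinearMap.ext fun w => ?_
    ext <;> simp only [Module.End.mul_apply, hTm, hx'] <;> ring
  have hzx : z * x = algebraMap F _ l := by
    rw [← hxz, hz, sub_mul, mul_sub, hcomm.eq]
  have hcomm' : Commute x z := hxz.trans hzx.symm
  have hsum : x ^ r + z ^ r = 0 := by
    rw [← aeval_dickson_one hxz hzx, hz, add_sub_cancel, aeval_algHom_apply, hT, map_zero]
  have hpow : x ^ (2 * r) = (-(l ^ r)) • 1 := by
    calc x ^ (2 * r) = x ^ r * (x ^ r + z ^ r) - x ^ r * z ^ r := by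
          rw [two_mul, pow_add, mul_add, add_sub_cancel_right]
      _ = _ := by
          rw [hsum, mul_zero, ← hcomm'.mul_pow, hxz, ← map_pow, Algebra.algebraMap_eq_smul_one,
            zero_sub]
          exact (neg_smul _ _).symm
  have hfr : Module.finrank F (W × W) = 2 * r := by rw [Module.finrank_prod, hr]; ring
  have hc : -(l ^ r) * -(l ^ r) = 1 := by rw [neg_mul_neg, hlr]
  obtain ⟨p, hp⟩ : ∃ p : F[X], aeval x p = Tm := by
    refine ⟨X + C (l * -(l ^ r)) * X ^ (2 * r - 1), ?_⟩
    have h1 : z = (l * -(l ^ r)) • x ^ (2 * r - 1) := by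
      calc z = -(l ^ r) • ((-(l ^ r) • (1 : Module.End F (W × W))) * z) := by
            rw [smul_mul_assoc, one_mul, smul_smul, hc, one_smul]
        _ = -(l ^ r) • (x ^ (2 * r - 1) * (x * z)) := by
            rw [← hpow, ← mul_assoc, ← pow_succ, Nat.sub_add_cancel (by omega)]
        _ = _ := by
            rw [hxz, Algebra.algebraMap_eq_smul_one, mul_smul_comm, mul_one, smul_smul, mul_comm]
    rw [map_add, map_mul, aeval_X, aeval_C, map_pow, aeval_X, Algebra.algebraMap_eq_smul_one,
      smul_mul_assoc, one_mul, ← h1, hz, add_sub_cancel]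
  refine (IsInvolProd.of_cyclic_of_pow_eq (x := x) hc (by rw [hfr]; omega) (by rw [hfr, hpow])
    (1, 1) fun w => ?_).isUnipInvolProd hn hx
  obtain ⟨q₁, hq₁⟩ := hgen (w.2 - δ * (w.1 - w.2))
  obtain ⟨q₂, hq₂⟩ := hgen (δ * (w.1 - w.2))
  refine ⟨q₁.comp p + q₂.comp p * X, ?_⟩
  rw [map_add, map_mul, aeval_comp, aeval_comp, hp, aeval_X, aeval_algHom_apply,
    aeval_algHom_apply, hq₁, hq₂, LinearMap.add_apply, Module.End.mul_apply, hx']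
  simp only [Algebra.lsmul_coe]
  ext
  · simp
    linear_combination (w.1 - w.2) * hδL
  · simp

theorem isUnipInvolProd_prodMap_smul {F E : Type*} [Field F] [AddCommGroup E] [Module F E]
    [FiniteDimensional F E] [Nontrivial E] {l : F} (hl : l ≠ 1)
    (hlr : l ^ Module.finrank F E * l ^ Module.finrank F E = 1) :
    IsUnipInvolProd (LinearMap.prodMap (l • 1) 1 : Module.End F (E × E)) := by
  obtain ⟨r, hr⟩ := Nat.exists_eq_add_of_lt (Module.finrank_pos (R := F) (M := E))
  rw [zero_add] at hr
  rw [hr] at hlr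
  obtain ⟨hm, hd⟩ := monic_natDegree_dickson_one l r
  let W := AdjoinRoot (dickson 1 l (r + 1))
  have : FiniteDimensional F W := (AdjoinRoot.powerBasis' hm).finite
  have hW : Module.finrank F W = r + 1 := by
    rw [(AdjoinRoot.powerBasis' hm).finrank, AdjoinRoot.powerBasis'_dim, hd]
  have : Nontrivial W := Module.nontrivial_of_finrank_pos (R := F) (by omega)
  have key := isUnipInvolProd_prodMap_smul_of_generator (W := W) hl hW hlr
    (AdjoinRoot.root _) (by rw [AdjoinRoot.aeval_eq, AdjoinRoot.mk_self]) (fun w => by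
      obtain ⟨q, rfl⟩ := AdjoinRoot.mk_surjective w
      exact ⟨q, AdjoinRoot.aeval_eq q⟩)
  let φ : W ≃ₗ[F] E := LinearEquiv.ofFinrankEq W E (by rw [hW, hr])
  refine key.extend (φ.prodCongr φ : (W × W) →ₗ[F] (E × E)) (φ.prodCongr φ).injective _ ?_ (by simp)
  refine LinearMap.ext fun w => ?_
  ext <;> simp

/-- `A` is a product `B * C` with `B` unipotent and `C` annihilated by `(X - 1) ^ N * (X - d)`. -/
def HasUnipotentFactorization {F E : Type*} [Field F] [AddCommGroup E] [Module F E]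
    (A : Module.End F E) (d : F) : Prop :=
  ∃ (B C : Module.End F E) (N : ℕ), A = B * C ∧ (B - 1) ^ N = 0 ∧ (C - 1) ^ N * (C - d • 1) = 0

section SchurComplement

variable {F E : Type*} [Field F] [AddCommGroup E] [Module F E]

/-- The projection onto `ker ℓ` along `v`. -/
def kerProj (ℓ : E →ₗ[F] F) (v : E) (hv : ℓ v = 1) : E →ₗ[F] LinearMap.ker ℓ :=
  LinearMap.codRestrict _ (LinearMap.id - ℓ.smulRight v) fun x => by simp [hv]

theorem coe_kerProj (ℓ : E →ₗ[F] F) (v : E) (hv : ℓ v = 1) (x : E) :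
    (kerProj ℓ v hv x : E) = x - ℓ x • v := rfl

/-- The Schur complement of `A` on `ker ℓ`. -/
def schurCompl (A : Module.End F E) (ℓ : E →ₗ[F] F) (v : E) (hv : ℓ (A v) = 1) :
    Module.End F (LinearMap.ker ℓ) :=
  LinearMap.codRestrict _ ((A - (ℓ ∘ₗ A).smulRight (A v)) ∘ₗ (LinearMap.ker ℓ).subtype)
    fun x => by simp [hv]

theorem coe_schurCompl (A : Module.End F E) (ℓ : E →ₗ[F] F) (v : E) (hv : ℓ (A v) = 1)
    (w : LinearMap.ker ℓ) : (schurCompl A ℓ v hv w : E) = A w - ℓ (A w) • A v := rfl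

/-- Factoring the Schur complement yields a factorization of `A` into triangular blocks. -/
theorem exists_triangular_factorization (A : Module.End F E) (ℓ : E →ₗ[F] F) (v : E)
    (hv : ℓ v = 1) (hAv : ℓ (A v) = 1) (B₁ C₁ : Module.End F (LinearMap.ker ℓ))
    (h : schurCompl A ℓ v hAv = B₁ * C₁) :
    ∃ B C : Module.End F E, A = B * C ∧ (∀ x, ℓ (B x) = ℓ x) ∧ (∀ w : LinearMap.ker ℓ, B w = B₁ w) ∧
      (∀ x, kerProj ℓ v hv (C x) = C₁ (kerProj ℓ v hv x)) ∧ C v = v := by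
  have hpv : kerProj ℓ v hv v = 0 := by ext; simp [coe_kerProj, hv]
  have hpw : ∀ w : LinearMap.ker ℓ, kerProj ℓ v hv w = w := fun w => by
    ext; simp [coe_kerProj]
  have hℓw : ∀ w : LinearMap.ker ℓ, ℓ w = 0 := fun w => w.2
  let B : Module.End F E :=
    ℓ.smulRight (A v) + (LinearMap.ker ℓ).subtype ∘ₗ B₁ ∘ₗ kerProj ℓ v hv
  let C : Module.End F E :=
    (ℓ ∘ₗ A).smulRight v + (LinearMap.ker ℓ).subtype ∘ₗ C₁ ∘ₗ kerProj ℓ v hv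
  have hB : ∀ x, B x = ℓ x • A v + B₁ (kerProj ℓ v hv x) := fun x => rfl
  have hC : ∀ x, C x = ℓ (A x) • v + C₁ (kerProj ℓ v hv x) := fun x => rfl
  have hpC : ∀ x, kerProj ℓ v hv (C x) = C₁ (kerProj ℓ v hv x) := fun x => by
    rw [hC, map_add, map_smul, hpv, smul_zero, zero_add, hpw]
  refine ⟨B, C, LinearMap.ext fun x => ?_, fun x => ?_, fun w => ?_, hpC, ?_⟩
  · have hS := coe_schurCompl A ℓ v hAv (kerProj ℓ v hv x)
    rw [h, Module.End.mul_apply] at hS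
    have hℓC : ℓ (C x) = ℓ (A x) := by rw [hC, map_add, hℓw, map_smul, hv]; simp
    rw [Module.End.mul_apply, hB, hpC, hS, hℓC, coe_kerProj]
    simp only [map_sub, map_smul, hAv, smul_eq_mul, mul_one, sub_smul]
    abel
  · rw [hB, map_add, hℓw, map_smul, hAv]; simp
  · rw [hB, hℓw, hpw]; simp
  · rw [hC, hpv, hAv]; simp

theorem HasUnipotentFactorization.of_schurCompl (A : Module.End F E) (ℓ : E →ₗ[F] F) (v : E)
    (hv : ℓ v = 1) (hAv : ℓ (A v) = 1) {d : F}
    (h : HasUnipotentFactorization (schurCompl A ℓ v hAv) d) : HasUnipotentFactorization A d := by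
  obtain ⟨B₁, C₁, N, h, hB₁, hC₁⟩ := h
  obtain ⟨B, C, hBC, hℓB, hB, hC, hCv⟩ := exists_triangular_factorization A ℓ v hv hAv B₁ C₁ h
  refine ⟨B, C, N + 1, hBC, ?_, ?_⟩
  · have hpow := Module.End.commute_pow_left_of_commute (f := (LinearMap.ker ℓ).subtype)
      (g := B₁ - 1) (g₂ := B - 1) (by ext w; simp [hB]) N
    ext x
    have hmem : (B - 1) x ∈ LinearMap.ker ℓ := by simp [hℓB]
    have := LinearMap.congr_fun hpow ⟨_, hmem⟩
    rw [hB₁] at this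
    rw [pow_succ, Module.End.mul_apply]
    exact this
  · have hpow := Module.End.commute_pow_left_of_commute (f := kerProj ℓ v hv)
      (g := C - 1) (g₂ := C₁ - 1) (by ext w; simp [hC]) N
    ext x
    set z := ((C - 1) ^ N * (C - d • 1)) x with hz
    have hpz : kerProj ℓ v hv z = 0 := by
      have h1 := LinearMap.congr_fun hpow ((C - d • 1) x)
      have h2 : kerProj ℓ v hv ((C - d • 1) x) = (C₁ - d • 1) (kerProj ℓ v hv x) := by
        simp [hC]
      rw [LinearMap.comp_apply, LinearMap.comp_apply, h2] at h1
      rw [hz, Module.End.mul_apply, ← h1, ← Module.End.mul_apply, hC₁, LinearMap.zero_apply]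
    have hzv : z = ℓ z • v := by
      have := congrArg Subtype.val hpz
      rwa [coe_kerProj, Submodule.coe_zero, sub_eq_zero] at this
    rw [pow_succ', mul_assoc, Module.End.mul_apply, ← hz, hzv]
    simp [hCv]

theorem det_schurCompl [FiniteDimensional F E] (A : Module.End F E) (ℓ : E →ₗ[F] F) (v : E)
    (hv : ℓ v = 1) (hAv : ℓ (A v) = 1) :
    LinearMap.det (schurCompl A ℓ v hAv) = LinearMap.det A := by
  obtain ⟨B, C, hBC, hℓB, hB, hC, hCv⟩ :=
    exists_triangular_factorization A ℓ v hv hAv _ 1 (mul_one _).symm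
  have h1 : LinearMap.det C = 1 := by
    refine det_eq_one_of_sub_one_sq_eq_zero ?_
    ext x
    have hx := congrArg Subtype.val (hC x)
    rw [Module.End.one_apply, coe_kerProj, coe_kerProj] at hx
    have hx' : (C - 1) x = (ℓ (C x) - ℓ x) • v := by
      rw [LinearMap.sub_apply, Module.End.one_apply, sub_smul, sub_eq_sub_iff_sub_eq_sub]
      exact hx
    rw [sq, Module.End.mul_apply, hx', map_smul]
    simp [hCv]
  obtain ⟨k, hk⟩ := exists_det_eq_det_mul_pow (LinearMap.ker ℓ).subtype
    (Submodule.subtype_injective _) B (schurCompl A ℓ v hAv) (by ext w; exact hB w) 1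
    (fun x => by simp [hℓB])
  rw [one_pow, mul_one] at hk
  have hdet := congrArg LinearMap.det hBC
  rw [map_mul, h1, mul_one, hk] at hdet
  exact hdet.symm

end SchurComplement

theorem exists_functional_apply_eq_one {F E : Type*} [Field F] [AddCommGroup E] [Module F E]
    {v w : E} (h : LinearIndependent F ![v, w]) : ∃ ℓ : E →ₗ[F] F, ℓ v = 1 ∧ ℓ w = 1 := by
  have hv : v ∉ F ∙ (w - v) := fun hv => by
    obtain ⟨a, ha⟩ := Submodule.mem_span_singleton.1 hv
    have := LinearIndependent.pair_iff.1 h (-a - 1) a (by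
      rw [sub_smul, neg_smul, one_smul]; nth_rewrite 2 [← ha]; rw [smul_sub]; abel)
    rw [this.2] at this
    simp at this
  obtain ⟨f, hf, hle⟩ := Submodule.exists_le_ker_of_notMem hv
  have hw : f w = f v := by
    have : f (w - v) = 0 := hle (Submodule.mem_span_singleton_self _)
    rwa [map_sub, sub_eq_zero] at this
  exact ⟨(f v)⁻¹ • f, by simp [hf], by simp [hw, hf]⟩

theorem exists_schurCompl_ne_smul {F E : Type*} [Field F] [AddCommGroup E] [Module F E]
    [FiniteDimensional F E] (hE : 2 < Module.finrank F E) (A : Module.End F E)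
    (hA : LinearMap.det A ≠ 0) {v : E} (hAv : LinearIndependent F ![v, A v]) :
    ∃ (ℓ : E →ₗ[F] F) (_ : ℓ v = 1) (h₁ : ℓ (A v) = 1), ∀ c : F, schurCompl A ℓ v h₁ ≠ c • 1 := by
  obtain ⟨ℓ, hv, h₁⟩ := exists_functional_apply_eq_one hAv
  by_cases hS : ∀ c : F, schurCompl A ℓ v h₁ ≠ c • 1
  · exact ⟨ℓ, hv, h₁, hS⟩
  push Not at hS
  obtain ⟨μ, hμ⟩ := hS
  have hAvv : A v - v ≠ 0 := fun h0 => by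
    have := LinearIndependent.pair_iff.1 hAv (-1) 1 (by rw [neg_smul, one_smul, one_smul, ← h0]; abel)
    exact one_ne_zero this.2
  have hμ0 : μ ≠ 0 := by
    rintro rfl
    have hdet := det_schurCompl A ℓ v hv h₁
    have : Nontrivial (LinearMap.ker ℓ) :=
      ⟨⟨⟨A v - v, by simp [hv, h₁]⟩, 0, fun h => hAvv (congrArg Subtype.val h)⟩⟩
    rw [hμ, zero_smul, LinearMap.det_zero, zero_pow Module.finrank_pos.ne'] at hdet
    exact hA hdet.symm
  obtain ⟨y, hy0, hy⟩ := Submodule.exists_le_ker_of_lt_top (Submodule.span F {v, A v})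
    (lt_top_iff_ne_top.2 fun htop => by
      have h2 := finrank_range_le_card (R := F) ![v, A v]
      rw [Matrix.range_cons, Matrix.range_cons, Matrix.range_empty, Set.union_empty,
        Set.singleton_union, Set.finrank, htop, finrank_top, Fintype.card_fin] at h2
      omega)
  have hyv : y v = 0 := hy (Submodule.subset_span (by simp))
  have hyAv : y (A v) = 0 := hy (Submodule.subset_span (by simp))
  have hAw : ∀ w, ℓ w = 0 → A w = μ • w + ℓ (A w) • A v := fun w hw => by
    have := congrArg Subtype.val (LinearMap.congr_fun hμ ⟨w, hw⟩)
    rw [coe_schurCompl, sub_eq_iff_eq_add] at this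
    exact this
  refine ⟨ℓ + y, by simp [hv, hyv], by simp [h₁, hyAv], fun c hc => ?_⟩
  have key : ∀ w, ℓ w = 0 → μ • w - (μ * y w) • A v = c • (w - y w • v) := fun w hw => by
    have h2 := congrArg Subtype.val (LinearMap.congr_fun hc
      ⟨w - y w • v, by simp [hw, hyv, hv]⟩)
    rw [coe_schurCompl] at h2
    have h3 : A (w - y w • v) = μ • w + (ℓ (A w) - y w) • A v := by
      rw [map_sub, map_smul]
      nth_rewrite 1 [hAw w hw]
      rw [sub_smul]; abel
    rw [h3] at h2
    simp only [LinearMap.add_apply, map_add, map_smul, hw, hyAv, h₁, smul_eq_mul, mul_one,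
      add_zero, zero_add] at h2
    refine Eq.trans ?_ h2
    module
  have hcμ : μ = c := by
    have := key (A v - v) (by simp [hv, h₁])
    rw [map_sub, hyAv, hyv] at this
    simp only [sub_zero, mul_zero, zero_smul] at this
    exact smul_left_injective F hAvv this
  subst hcμ
  obtain ⟨w, hw⟩ : ∃ w, y w ≠ 0 := by
    by_contra! h0
    exact hy0 (LinearMap.ext h0)
  have := key (w - ℓ w • v) (by simp [hv])
  rw [map_sub, map_smul, hyv, smul_zero, sub_zero, smul_sub μ _ (y w • v), smul_sub, sub_right_inj,
    mul_smul] at this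
  have h4 := smul_right_injective E hw (smul_right_injective E hμ0 this)
  exact hAvv (sub_eq_zero.2 h4)

theorem hasUnipotentFactorization_of_ne_smul {F E : Type*} [Field F] [AddCommGroup E] [Module F E]
    [FiniteDimensional F E] (A : Module.End F E) (hA : LinearMap.det A ≠ 0)
    (hns : ∀ c : F, A ≠ c • 1) : HasUnipotentFactorization A (LinearMap.det A) := by
  induction hn : Module.finrank F E using Nat.strong_induction_on generalizing E with
  | _ n ih =>
  subst hn
  obtain ⟨v, hv⟩ : ∃ v, LinearIndependent F ![v, A v] := by
    by_contra! h
    obtain ⟨c, hc⟩ := LinearMap.exists_eq_smul_id_of_forall_notLinearIndependent h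
    exact hns c hc
  have hfin : ∀ ℓ : E →ₗ[F] F, ℓ v = 1 →
      Module.finrank F (LinearMap.ker ℓ) + 1 = Module.finrank F E := fun ℓ hℓ => by
    have hr : LinearMap.range ℓ = ⊤ := LinearMap.range_eq_top.2 fun c => ⟨c • v, by simp [hℓ]⟩
    rw [← LinearMap.finrank_range_add_finrank_ker ℓ, hr, finrank_top, Module.finrank_self,
      add_comm]
  by_cases h2 : 2 < Module.finrank F E
  · obtain ⟨ℓ, h₀, h₁, hS⟩ := exists_schurCompl_ne_smul h2 A hA hv
    refine HasUnipotentFactorization.of_schurCompl A ℓ v h₀ h₁ ?_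
    rw [← det_schurCompl A ℓ v h₀ h₁]
    have := hfin ℓ h₀
    exact ih _ (by omega) _ (by rwa [det_schurCompl A ℓ v h₀ h₁]) hS rfl
  · obtain ⟨ℓ, h₀, h₁⟩ := exists_functional_apply_eq_one hv
    refine HasUnipotentFactorization.of_schurCompl A ℓ v h₀ h₁ ?_
    have h3 : 2 ≤ Module.finrank F E := by
      simpa using hv.fintype_card_le_finrank
    have h4 := hfin ℓ h₀
    have h5 : Module.finrank F (LinearMap.ker ℓ) = 1 := by omega
    obtain ⟨c, hc, -⟩ :=
      LinearMap.existsUnique_eq_smul_id_of_finrank_eq_one h5 (schurCompl A ℓ v h₁)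
    have hdet := det_schurCompl A ℓ v h₀ h₁
    rw [hc, LinearMap.det_smul, h5, pow_one] at hdet
    refine ⟨1, schurCompl A ℓ v h₁, 1, (one_mul _).symm, by simp, ?_⟩
    rw [← hdet, hc]
    simp [Module.End.one_eq_id]

theorem exists_injective_comp_eq_zero {F V E G : Type*} [Field F] [AddCommGroup V] [Module F V]
    [AddCommGroup E] [Module F E] [AddCommGroup G] [Module F G] [FiniteDimensional F E]
    [FiniteDimensional F G] (hV : ℵ₀ ≤ Module.rank F V) (f : V →ₗ[F] G) :
    ∃ j : E →ₗ[F] V, Function.Injective j ∧ ∀ e, f (j e) = 0 := by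
  have hker : ℵ₀ ≤ Module.rank F (LinearMap.ker f) := by
    by_contra! hlt
    have h1 : FiniteDimensional F (LinearMap.ker f) := Module.rank_lt_aleph0_iff.1 hlt
    have h2 : FiniteDimensional F (V ⧸ LinearMap.ker f) :=
      LinearEquiv.finiteDimensional f.quotKerEquivRange.symm
    have h3 : FiniteDimensional F V := Module.Finite.of_submodule_quotient (LinearMap.ker f)
    exact hV.not_gt (Module.rank_lt_aleph0 F V)
  obtain ⟨j, hj⟩ := lift_rank_le_iff_exists_linearMap.1
    ((Cardinal.lift_lt_aleph0.2 (Module.rank_lt_aleph0 F E)).le.trans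
      (Cardinal.aleph0_le_lift.2 hker))
  exact ⟨(LinearMap.ker f).subtype ∘ₗ j, (Submodule.subtype_injective _).comp hj,
    fun e => (j e).2⟩

theorem IsInvolProd.of_finiteDimensional_range {F V : Type*} [Field F] [AddCommGroup V]
    [Module F V] {x : Module.End F V} [FiniteDimensional F (LinearMap.range (x - 1))] {k l : ℕ}
    (h : (x - 1) ^ k * (x + 1) ^ l = 0) : IsInvolProd x := by
  obtain ⟨Q, hQ⟩ := (LinearMap.ker (x - 1)).exists_isCompl
  have : FiniteDimensional F Q := LinearEquiv.finiteDimensional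
    ((x - 1).quotKerEquivRange.symm ≪≫ₗ Submodule.quotientEquivOfIsCompl _ _ hQ)
  let S := LinearMap.range (x - 1) ⊔ Q
  have hS : ∀ v ∈ S, x v ∈ S := fun v hv => by
    have : x v = v + (x - 1) v := by simp
    rw [this]
    exact S.add_mem hv (Submodule.mem_sup_left ⟨v, rfl⟩)
  have hcomm : ((x - 1) ^ k * (x + 1) ^ l) ∘ₗ S.subtype =
      S.subtype ∘ₗ ((x.restrict hS - 1) ^ k * (x.restrict hS + 1) ^ l) := by
    have h₁ := Module.End.commute_pow_left_of_commute (f := S.subtype) (g := x.restrict hS - 1)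
      (g₂ := x - 1) (by ext; rfl) k
    have h₂ := Module.End.commute_pow_left_of_commute (f := S.subtype) (g := x.restrict hS + 1)
      (g₂ := x + 1) (by ext; rfl) l
    rw [Module.End.mul_eq_comp, Module.End.mul_eq_comp, LinearMap.comp_assoc, h₂,
      ← LinearMap.comp_assoc, h₁, LinearMap.comp_assoc]
  have key : IsInvolProd (x.restrict hS) := by
    refine IsInvolProd.of_sub_one_pow_mul_add_one_pow (k := k) (l := l) ?_
    ext s
    have := LinearMap.congr_fun hcomm s
    rw [LinearMap.zero_apply, Submodule.coe_zero]
    exact this.symm.trans (LinearMap.congr_fun h (s : V))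
  refine key.extend S.subtype S.subtype_injective x (by ext; rfl) ?_
  rw [Submodule.range_subtype, eq_top_iff, ← hQ.sup_eq_top]
  exact sup_le_sup_left le_sup_right _

theorem isUnipInvolProd_of_hasUnipotentFactorization {F V E : Type*} [Field F] [AddCommGroup V]
    [Module F V] [AddCommGroup E] [Module F E] [FiniteDimensional F E]
    (hV : ℵ₀ ≤ Module.rank F V) {u : Module.End F V} {g : E →ₗ[F] V} {h : V →ₗ[F] E}
    (hu : u = 1 + g ∘ₗ h) (hg : Function.Injective g) (hh : Function.Surjective h)
    (hdet : LinearMap.det (1 + h ∘ₗ g : Module.End F E) ≠ 0) {d : F} (hd : d = 1 ∨ d = -1)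
    (hA : HasUnipotentFactorization (1 + h ∘ₗ g : Module.End F E) d) : IsUnipInvolProd u := by
  obtain ⟨B, C, N, hBC, hB, hC⟩ := hA
  obtain ⟨s, hs⟩ := h.exists_rightInverse_of_surjective (LinearMap.range_eq_top.2 hh)
  let W := LinearMap.range g ⊔ LinearMap.range s
  obtain ⟨p, hp⟩ := W.subtype.exists_leftInverse_of_injective (by simp)
  obtain ⟨j, hj, hj0⟩ := exists_injective_comp_eq_zero (E := E) hV (h.prod p)
  have hhj : ∀ e, h (j e) = 0 := fun e => congrArg Prod.fst (hj0 e)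
  have hpj : ∀ e, p (j e) = 0 := fun e => congrArg Prod.snd (hj0 e)
  have hhs : ∀ e, h (s e) = e := LinearMap.congr_fun hs
  have hjW : ∀ e, j e ∈ W → e = 0 := fun e he => by
    have h1 : p (j e) = ⟨j e, he⟩ := LinearMap.congr_fun hp ⟨j e, he⟩
    rw [hpj] at h1
    exact hj ((congrArg Subtype.val h1).symm.trans (map_zero j).symm)
  have hCu : IsUnit C := by
    rw [hBC, map_mul] at hdet
    exact (LinearMap.isUnit_iff_isUnit_det C).2 (isUnit_iff_ne_zero.2 (right_ne_zero_of_mul hdet))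
  let C' : Module.End F E := ↑hCu.unit⁻¹
  have hCC' : C * C' = 1 := hCu.mul_val_inv
  have hC'₁ : ∀ e, C' (C e) = e := LinearMap.congr_fun hCu.val_inv_mul
  let g₂ : E →ₗ[F] V := s ∘ₗ (C - 1) + j
  let g₁ : E →ₗ[F] V := g - g₂
  have hg₂ : ∀ e, g₂ e = s ((C - 1) e) + j e := fun e => rfl
  have hg₁ : ∀ e, g e = g₁ e + g₂ e := fun e => by simp [g₁]
  have hhg₂ : ∀ e, h (g₂ e) = C e - e := fun e => by simp [hg₂, hhs, hhj]
  have hhg₁ : ∀ e, h (g₁ e) = B (C e) - C e := fun e => by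
    have h1 := LinearMap.congr_fun hBC e
    simp only [LinearMap.add_apply, Module.End.one_apply, LinearMap.comp_apply, hg₁, map_add,
      hhg₂, Module.End.mul_apply] at h1
    rw [← h1]; abel
  obtain ⟨q, hq⟩ := (LinearMap.coprod g₁ g₂).exists_leftInverse_of_injective (by
    refine LinearMap.ker_eq_bot'.2 fun e he => ?_
    rw [LinearMap.coprod_apply] at he
    have h0 : g e.1 = g₂ (e.1 - e.2) := by
      rw [hg₁, map_sub, eq_sub_iff_add_eq, add_right_comm, he, zero_add]
    have h1 : j (e.1 - e.2) = g e.1 - s ((C - 1) (e.1 - e.2)) := by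
      rw [h0, hg₂, add_sub_cancel_left]
    have h2 := hjW _ (h1 ▸ W.sub_mem (Submodule.mem_sup_left ⟨_, rfl⟩)
      (Submodule.mem_sup_right ⟨_, rfl⟩))
    rw [h2, map_zero] at h0
    have h3 : e.1 = 0 := hg (h0.trans (map_zero g).symm)
    rw [h3, zero_sub, neg_eq_zero] at h2
    exact Prod.ext h3 h2)
  let ρ : V →ₗ[F] E := LinearMap.snd F E E ∘ₗ q
  have hρ₁ : ∀ e, ρ (g₁ e) = 0 := fun e => by
    have := congrArg Prod.snd (LinearMap.congr_fun hq (e, 0))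
    simpa [ρ] using this
  have hρ₂ : ∀ e, ρ (g₂ e) = e := fun e => by
    have := congrArg Prod.snd (LinearMap.congr_fun hq (0, e))
    simpa [ρ] using this
  let n : Module.End F V := g₁ ∘ₗ (1 - C') ∘ₗ ρ
  have hn : ∀ v, n v = g₁ (ρ v - C' (ρ v)) := fun v => rfl
  let x : Module.End F V := (1 - n) * u
  have hx : ∀ v, (x - 1) v = g₁ (C' (h v) - ρ v + C' (ρ v)) + g₂ (h v) := fun v => by
    have : (x - 1) v = g (h v) - n v - n (g (h v)) := by
      simp only [x, hu, LinearMap.sub_apply, Module.End.mul_apply, LinearMap.add_apply,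
        Module.End.one_apply, LinearMap.comp_apply, map_add]
      abel
    rw [this, hg₁, hn, hn, map_add, hρ₁, hρ₂, zero_add]
    simp only [map_add, map_sub]
    abel
  have hx₂ : ∀ e, x (g₂ e) = g₂ (C e) := fun e => by
    have h1 : x (g₂ e) = g₂ e + (x - 1) (g₂ e) := by simp
    rw [h1, hx, hhg₂, hρ₂, map_sub C', hC'₁]
    simp
  have hx₁ : ∀ e, (x - 1) (g₁ e) = g₁ ((C' * (B - 1) * C) e) + g₂ ((B - 1) (C e)) := fun e => by
    rw [hx, hhg₁, hρ₁]
    simp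
  have hpow₂ : ∀ (k : ℕ) e, ((x - 1) ^ k) (g₂ e) = g₂ (((C - 1) ^ k) e) := fun k e =>
    LinearMap.congr_fun (Module.End.commute_pow_left_of_commute (f := g₂) (g := C - 1)
      (g₂ := x - 1) (by ext e; simp [hx₂]) k) e
  have hpow₁ : ∀ (k : ℕ) e, ∃ e', ((x - 1) ^ k) (g₁ e) = g₁ ((C' * (B - 1) ^ k * C) e) + g₂ e' := by
    intro k e
    induction k with
    | zero => exact ⟨0, by simp [hC'₁]⟩
    | succ k ih =>
      obtain ⟨e', he'⟩ := ih
      refine ⟨(B - 1) (C ((C' * (B - 1) ^ k * C) e)) + (C - 1) e', ?_⟩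
      have h1 : C' * (B - 1) ^ (k + 1) * C = C' * (B - 1) * C * (C' * (B - 1) ^ k * C) := by
        rw [pow_succ']
        simp only [mul_assoc]
        rw [← mul_assoc C C', hCC', one_mul]
      have h2 : (x - 1) (g₂ e') = g₂ ((C - 1) e') := by simp [hx₂]
      rw [pow_succ', Module.End.mul_apply, he', map_add, hx₁, h1, h2, map_add g₂, add_assoc]
      rfl
  have htot : (x - 1) ^ N * (x - d • 1) * ((x - 1) ^ N * (x - 1)) = 0 := by
    ext v
    obtain ⟨e, he⟩ : ∃ e, ((x - 1) ^ N * (x - 1)) v = g₂ e := by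
      obtain ⟨e, he⟩ := hpow₁ N (C' (h v) - ρ v + C' (ρ v))
      refine ⟨e + ((C - 1) ^ N) (h v), ?_⟩
      rw [Module.End.mul_apply, hx, map_add, he, hpow₂, hB, map_add g₂]
      simp
    have h1 : (x - d • 1) (g₂ e) = g₂ ((C - d • 1) e) := by simp [hx₂]
    rw [Module.End.mul_apply, he, Module.End.mul_apply, h1, hpow₂, ← Module.End.mul_apply, hC]
    simp
  have hfin : FiniteDimensional F (LinearMap.range (x - 1)) := by
    refine Submodule.finiteDimensional_of_le (S₂ := LinearMap.range g₁ ⊔ LinearMap.range g₂) ?_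
    rintro _ ⟨v, rfl⟩
    rw [hx]
    exact Submodule.add_mem_sup ⟨_, rfl⟩ ⟨_, rfl⟩
  have hinv : IsInvolProd x := by
    rcases hd with rfl | rfl
    · refine IsInvolProd.of_finiteDimensional_range (k := N + 1 + (N + 1)) (l := 0) ?_
      rw [pow_zero, mul_one, pow_add, pow_succ]
      rwa [one_smul] at htot
    · refine IsInvolProd.of_finiteDimensional_range (k := N + (N + 1)) (l := 1) ?_
      have hcomm : Commute (x - 1) (x + 1) :=
        ((Commute.refl x).add_right (Commute.one_right x)).sub_left (Commute.one_left _)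
      rw [neg_smul, one_smul, sub_neg_eq_add, ← pow_succ, mul_assoc,
        ← (hcomm.pow_left (N + 1)).eq, ← mul_assoc, ← pow_add] at htot
      rwa [pow_one]
  refine hinv.isUnipInvolProd (n := n) ?_ rfl
  ext v
  rw [Module.End.mul_apply, hn v, hn, hρ₁]
  simp

theorem isUnipInvolProd_of_det_eq {F V E : Type*} [Field F] [AddCommGroup V]
    [Module F V] [AddCommGroup E] [Module F E] [FiniteDimensional F E]
    (hV : ℵ₀ ≤ Module.rank F V) {u : Module.End F V} {g : E →ₗ[F] V} {h : V →ₗ[F] E}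
    (hu : u = 1 + g ∘ₗ h) (hg : Function.Injective g) (hh : Function.Surjective h)
    {A : Module.End F E} (hA : A = 1 + h ∘ₗ g)
    (hdet : LinearMap.det A = 1 ∨ LinearMap.det A = -1) : IsUnipInvolProd u := by
  have hdet0 : LinearMap.det A ≠ 0 := by
    rcases hdet with h | h <;> rw [h] <;> simp
  by_cases hns : ∀ c : F, A ≠ c • 1
  · refine isUnipInvolProd_of_hasUnipotentFactorization hV hu hg hh (hA ▸ hdet0) hdet ?_
    rw [← hA]
    exact hasUnipotentFactorization_of_ne_smul A hdet0 hns
  push Not at hns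
  obtain ⟨c, hc⟩ := hns
  by_cases hc1 : A = 1
  · refine isUnipInvolProd_of_hasUnipotentFactorization hV hu hg hh (hA ▸ hdet0) (Or.inl rfl) ?_
    rw [← hA, hc1]
    exact ⟨1, 1, 1, by simp, by simp, by simp⟩
  have hc1' : c ≠ 1 := fun h1 => hc1 (by rw [hc, h1, one_smul])
  have : Nontrivial E := not_subsingleton_iff_nontrivial.1 fun hs => hc1 (Subsingleton.elim _ _)
  obtain ⟨j, hj, hj0⟩ := exists_injective_comp_eq_zero (E := E) hV h
  have hhg : ∀ e, h (g e) = (c - 1) • e := fun e => by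
    rw [sub_smul, one_smul, eq_sub_iff_add_eq, add_comm]
    exact LinearMap.congr_fun (hA.symm.trans hc) e
  have hc0 : c - 1 ≠ 0 := sub_ne_zero.2 hc1'
  refine (isUnipInvolProd_prodMap_smul (E := E) hc1' ?_).extend (g.coprod j) ?_ u ?_ ?_
  · rw [hc, LinearMap.det_smul, Module.End.one_eq_id, LinearMap.det_id, mul_one] at hdet
    rcases hdet with h | h <;> rw [h] <;> simp
  · refine LinearMap.ker_eq_bot.1 (LinearMap.ker_eq_bot'.2 fun e he => ?_)
    rw [LinearMap.coprod_apply] at he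
    have h1 := congrArg h he
    rw [map_add, map_zero, hhg, hj0, add_zero] at h1
    have h3 : e.1 = 0 := (smul_eq_zero.1 h1).resolve_left hc0
    rw [h3, map_zero, zero_add] at he
    exact Prod.ext h3 (hj (he.trans (map_zero j).symm))
  · refine LinearMap.ext fun e => ?_
    simp only [hu, LinearMap.comp_apply, LinearMap.coprod_apply, LinearMap.add_apply,
      Module.End.one_apply, map_add, hhg, hj0, LinearMap.prodMap_apply, LinearMap.smul_apply,
      map_smul, sub_smul, one_smul, map_zero, map_sub]
    abel
  · refine eq_top_iff.2 fun v _ => ?_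
    rw [← sub_add_cancel v ((c - 1)⁻¹ • g (h v))]
    refine Submodule.add_mem_sup ?_ ⟨((c - 1)⁻¹ • h v, 0), by simp⟩
    rw [hu, add_sub_cancel_left, LinearMap.mem_ker, LinearMap.comp_apply, map_sub, map_smul, hhg,
      smul_smul, inv_mul_cancel₀ hc0, one_smul, sub_self, map_zero]

theorem isUnipInvolProd_of_inducedDet_eq {F V : Type*} [Field F] [AddCommGroup V] [Module F V]
    (hV : ℵ₀ ≤ Module.rank F V) (u : Module.End F V) {l : F} (hl : l * l = 1)
    (hfin : LinearMap.rank (u - l • 1) < ℵ₀) (hdet : inducedDet u l = 1 ∨ inducedDet u l = -1) :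
    IsUnipInvolProd (l • u) := by
  have : FiniteDimensional F (LinearMap.range (u - l • 1)) := Module.rank_lt_aleph0_iff.1 hfin
  have hl0 : l ≠ 0 := left_ne_zero_of_mul_eq_one hl
  refine isUnipInvolProd_of_det_eq hV (g := (LinearMap.range (u - l • 1)).subtype)
    (h := l • (u - l • 1).rangeRestrict) (A := l • u.restrict (maps_range_self u l)) ?_
    (Submodule.subtype_injective _) ?_ ?_ ?_
  · ext v
    simp [smul_sub, smul_smul, hl]
  · intro e
    obtain ⟨v, rfl⟩ := (u - l • 1).surjective_rangeRestrict e
    exact ⟨l • v, by rw [LinearMap.smul_apply, map_smul, smul_smul, hl, one_smul]⟩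
  · ext e
    simp [smul_sub, smul_smul, hl]
  · rw [← mul_self_eq_one_iff] at hdet ⊢
    rw [LinearMap.det_smul]
    rw [inducedDet] at hdet
    rw [mul_mul_mul_comm, hdet, mul_one, ← mul_pow, hl, one_pow]

theorem isUnipInvolProd_of_not_exceptional {F V : Type*} [Field F] [AddCommGroup V] [Module F V]
    (hV : ℵ₀ ≤ Module.rank F V) (u : V ≃ₗ[F] V)
    (h : ∀ l : F, LinearMap.rank ((u : Module.End F V) - l • 1) < Module.rank F V → l ^ 2 = 1)
    (hdet : ∀ l : F, l = 1 ∨ l = -1 → LinearMap.rank ((u : Module.End F V) - l • 1) < ℵ₀ →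
      inducedDet (u : Module.End F V) l = 1 ∨ inducedDet (u : Module.End F V) l = -1) :
    IsUnipInvolProd (u : Module.End F V) := by
  by_cases hdom : ∀ l : F, ¬ LinearMap.rank ((u : Module.End F V) - l • 1) < Module.rank F V
  · exact isUnipInvolProd_of_forall_rank_sub hV u hdom
  push Not at hdom
  obtain ⟨l, hlt⟩ := hdom
  have hl : l * l = 1 := by rw [← sq, h l hlt]
  have hl0 : l ≠ 0 := left_ne_zero_of_mul_eq_one hl
  suffices hs : IsUnipInvolProd (l • (u : Module.End F V)) by
    have := hs.smul hl
    rwa [smul_smul, hl, one_smul] at this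
  rcases lt_or_ge (LinearMap.rank ((u : Module.End F V) - l • 1)) ℵ₀ with hfin | hinf
  · exact isUnipInvolProd_of_inducedDet_eq hV _ hl hfin (hdet l (mul_self_eq_one_iff.1 hl) hfin)
  · have hu' : ((u ≪≫ₗ LinearEquiv.smulOfNeZero F V l hl0 : V ≃ₗ[F] V) : Module.End F V) =
        l • (u : Module.End F V) := rfl
    have hr : LinearMap.rank (l • (u : Module.End F V) - 1) =
        LinearMap.rank ((u : Module.End F V) - l • 1) := by
      have : l • (u : Module.End F V) - 1 = l • ((u : Module.End F V) - l • 1) := by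
        rw [smul_sub, smul_smul, hl, one_smul]
      rw [this, LinearMap.rank, LinearMap.rank, LinearMap.range_smul _ _ hl0]
    rw [← hu']
    rw [← hr, ← hu'] at hinf hlt
    exact isUnipInvolProd_of_infinite_rank_sub_one _ hinf hlt

theorem product_of_one_unipotent_and_two_involutions_characterization
    {F V : Type*} [Field F] [AddCommGroup V] [Module F V]
    (hV : ℵ₀ ≤ Module.rank F V) (u : V ≃ₗ[F] V) :
    (∃ a b c : Module.End F V, (a - 1) ^ 2 = 0 ∧ b * b = 1 ∧ c * c = 1 ∧
        (u : Module.End F V) = a * b * c) ↔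
      ¬ ((∃ lam : F,
            LinearMap.rank ((u : Module.End F V) - lam • 1) < Module.rank F V ∧
            lam ^ 2 ≠ 1) ∨
         (∃ lam : F, (lam = 1 ∨ lam = -1) ∧
            LinearMap.rank ((u : Module.End F V) - lam • 1) < ℵ₀ ∧
            inducedDet (u : Module.End F V) lam ≠ 1 ∧
            inducedDet (u : Module.End F V) lam ≠ -1)) := by
  refine ⟨not_dominant_of_isProd hV, fun h => ?_⟩
  push Not at h
  exact isUnipInvolProd_of_not_exceptional hV u h.1
    fun l hl hfin => or_iff_not_imp_left.2 (h.2 l hl hfin)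
end

section
/- Let F be a field, A an associative unital F-algebra, and p, q ∈ F[t] monic non-derogatory polynomials of degree 2. Let a, b ∈ A satisfy p(a) = 0 and q(b) = 0. Then a and b are units of A, and both a and b commute with the element a·b + N(p)·N(q)·(a·b)⁻¹, where N(p) = p(0) and N(q) = q(0). -/
open Polynomial

/-- A root of a monic quadratic polynomial with nonzero norm is a unit `u`, and its conjugate
`N(p) • u⁻¹` equals `s - u` for a scalar `s` (the trace of the polynomial). -/
theorem exists_unit_of_aeval_quadratic_eq_zero
    {F A : Type*} [Field F] [Ring A] [Algebra F A] (p : F[X])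
    (hp : p.Monic ∧ p.degree = 2 ∧ p.eval 0 ≠ 0) (a : A) (ha : aeval a p = 0) :
    ∃ (u : Aˣ) (s : F), (u : A) = a ∧ p.eval 0 • (↑u⁻¹ : A) = algebraMap F A s - a := by
  obtain ⟨hm, hd, h0⟩ := hp
  have hn : p.natDegree = 2 := natDegree_eq_of_degree_eq_some hd
  have hc : p.coeff 2 = 1 := by rw [← hn]; exact hm
  have hs : p.coeff 1 • a + p.eval 0 • (1 : A) + a * a = 0 := by
    rw [aeval_eq_sum_range, hn] at ha
    simp only [Finset.sum_range_succ, Finset.sum_range_zero, hc, pow_zero, pow_one, one_smul,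
      zero_add, pow_two, coeff_zero_eq_eval_zero] at ha
    rw [← ha]; abel
  have hcomm : a * algebraMap F A (-p.coeff 1) = algebraMap F A (-p.coeff 1) * a :=
    (Algebra.commutes _ _).symm
  have hl : (algebraMap F A (-p.coeff 1) - a) * a = p.eval 0 • (1 : A) := by
    rw [sub_mul, ← Algebra.smul_def, neg_smul, ← sub_eq_zero, ← neg_eq_zero, ← hs]
    abel
  have hr : a * (algebraMap F A (-p.coeff 1) - a) = p.eval 0 • (1 : A) := by
    rw [← hl, mul_sub, sub_mul, hcomm]
  refine ⟨⟨a, (p.eval 0)⁻¹ • (algebraMap F A (-p.coeff 1) - a), ?_, ?_⟩, -p.coeff 1, rfl, ?_⟩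
  · rw [mul_smul_comm, hr, inv_smul_smul₀ h0]
  · rw [smul_mul_assoc, hl, inv_smul_smul₀ h0]
  · exact smul_inv_smul₀ h0 _

/-- If `s` and `t` are central and `a * (s - a)` is central, then `a` commutes with
`a * b + (t - b) * (s - a)`. -/
theorem commute_mul_add_conj_mul_conj {A : Type*} [Ring A] {a b s t : A}
    (hs : ∀ x, Commute s x) (ht : ∀ x, Commute t x) (h : Commute (a * (s - a)) b) :
    Commute a (a * b + (t - b) * (s - a)) := by
  have hsa := (hs a).eq
  have hsb := (hs b).eq
  have hta := (ht a).eq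
  have h' := h.eq
  simp only [Commute, SemiconjBy]
  calc a * (a * b + (t - b) * (s - a))
      = a * t * (s - a) + a * b * a + a * (s * b - b * s) - a * (s - a) * b := by noncomm_ring
    _ = t * a * (s - a) + a * b * a - b * (a * (s - a)) := by
      rw [hsb, sub_self, mul_zero, add_zero, h', hta]
    _ = (a * b + (t - b) * (s - a)) * a + (t - b) * (a * s - s * a) := by noncomm_ring
    _ = (a * b + (t - b) * (s - a)) * a := by rw [hsa, sub_self, mul_zero, add_zero]

theorem commute_with_ab_add_norm_smul_inv
    {F A : Type*} [Field F] [Ring A] [Algebra F A]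
    (p q : F[X])
    (hp : p.Monic ∧ p.degree = 2 ∧ p.eval 0 ≠ 0)
    (hq : q.Monic ∧ q.degree = 2 ∧ q.eval 0 ≠ 0)
    (a b : A) (ha : aeval a p = 0) (hb : aeval b q = 0) :
    IsUnit a ∧ IsUnit b ∧
      Commute a (a * b + (p.eval 0 * q.eval 0) • Ring.inverse (a * b)) ∧
      Commute b (a * b + (p.eval 0 * q.eval 0) • Ring.inverse (a * b)) := by
  obtain ⟨u, s, rfl, hu⟩ := exists_unit_of_aeval_quadratic_eq_zero p hp a ha
  obtain ⟨v, t, rfl, hv⟩ := exists_unit_of_aeval_quadratic_eq_zero q hq b hb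
  have central (r : F) (x : A) : Commute (algebraMap F A r) x := Algebra.commutes r x
  have hun : (u : A) * (algebraMap F A s - u) = algebraMap F A (p.eval 0) := by
    rw [← hu, mul_smul_comm, Units.mul_inv, Algebra.algebraMap_eq_smul_one]
  have hvn : (v : A) * (algebraMap F A t - v) = algebraMap F A (q.eval 0) := by
    rw [← hv, mul_smul_comm, Units.mul_inv, Algebra.algebraMap_eq_smul_one]
  have key : (p.eval 0 * q.eval 0) • Ring.inverse ((u : A) * v) =
      (algebraMap F A t - v) * (algebraMap F A s - u) := by
    rw [← Units.val_mul, Ring.inverse_unit, mul_inv_rev, Units.val_mul, ← hu, ← hv,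
      smul_mul_smul_comm, mul_comm (q.eval 0)]
  refine ⟨u.isUnit, v.isUnit, ?_, ?_⟩
  · rw [key]
    exact commute_mul_add_conj_mul_conj (central s) (central t) (hun ▸ central _ _)
  · have hswap : (u : A) * v + (algebraMap F A t - v) * (algebraMap F A s - u) =
        v * u + (algebraMap F A s - u) * (algebraMap F A t - v) := by
      have h₁ := (central s (v : A)).eq
      have h₂ := (central t (u : A)).eq
      have h₃ := (central s (algebraMap F A t)).eq
      simp only [sub_mul, mul_sub, h₁, h₂, h₃]
      abel
    rw [key, hswap]
    exact commute_mul_add_conj_mul_conj (central t) (central s) (hvn ▸ central _ _)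
end

section
/- Let F be a field and V an F-vector space. Let a, b, c be quadratic linear automorphisms of V (each annihilated by some degree-2 polynomial of F[t]). Let λ ∈ F be nonzero and w ∈ End(V) be such that λ·id_V + w = a ∘ b ∘ c. Let W be a linear subspace of V containing im(w). Then there exists a linear subspace W̄ of V containing W that is stable under a, b and c, and such that dim W̄ ≤ 8·dim W (as cardinals). In particular, if V is infinite-dimensional and dim W < dim V, then dim W̄ < dim V. -/
open Cardinal Polynomial

/-- A quadratic automorphism is a root of a monic quadratic polynomial with nonzero constant term. -/
theorem exists_apply_apply_eq_of_quadratic {F V : Type*} [Field F] [AddCommGroup V] [Module F V]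
    (a : V ≃ₗ[F] V) (ha : ∃ p : F[X], p.degree = 2 ∧ aeval (a : Module.End F V) p = 0) :
    ∃ t d : F, d ≠ 0 ∧ ∀ x, a (a x) = t • a x - d • x := by
  obtain ⟨p, hp, h⟩ := ha
  have hr : p.coeff 2 ≠ 0 := coeff_ne_zero_of_eq_degree hp
  have hx (x : V) : p.coeff 2 • a (a x) + p.coeff 1 • a x + p.coeff 0 • x = 0 := by
    have h' := LinearMap.congr_fun h x
    rw [eq_quadratic_of_degree_le_two hp.le] at h'
    simpa [Algebra.algebraMap_eq_smul_one, pow_two] using h'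
  by_cases h0 : p.coeff 0 = 0
  · have hs (x : V) : p.coeff 2 • a x + p.coeff 1 • x = 0 := by
      apply a.injective
      simpa [h0] using hx x
    by_cases h1 : p.coeff 1 = 0
    · have hz (x : V) : a x = 0 := by simpa [h1, hr] using hs x
      have hz' (x : V) : x = 0 := a.injective (by rw [hz, map_zero])
      exact ⟨0, 1, one_ne_zero, fun x ↦ by rw [hz' x]; simp⟩
    · have hax (x : V) : a x = (-(p.coeff 1 / p.coeff 2)) • x := by
        apply smul_right_injective V hr
        have e1 : p.coeff 2 * (p.coeff 1 / p.coeff 2) = p.coeff 1 := mul_div_cancel₀ _ hr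
        simp only [neg_smul, smul_neg, smul_smul, e1]
        exact eq_neg_of_add_eq_zero_left (hs x)
      refine ⟨2 * (-(p.coeff 1 / p.coeff 2)), (p.coeff 1 / p.coeff 2) ^ 2,
        pow_ne_zero _ (div_ne_zero h1 hr), fun x ↦ ?_⟩
      rw [hax x, map_smul, hax x]
      module
  · refine ⟨-(p.coeff 1 / p.coeff 2), p.coeff 0 / p.coeff 2, div_ne_zero h0 hr, fun x ↦ ?_⟩
    apply smul_right_injective V hr
    have h2 := hx x
    have e1 : p.coeff 2 * (p.coeff 1 / p.coeff 2) = p.coeff 1 := mul_div_cancel₀ _ hr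
    have e0 : p.coeff 2 * (p.coeff 0 / p.coeff 2) = p.coeff 0 := mul_div_cancel₀ _ hr
    simp only [smul_sub, neg_smul, smul_neg, smul_smul, e1, e0]
    linear_combination (norm := module) h2

section QuadraticProduct

variable {F V : Type*} [Field F] [AddCommGroup V] [Module F V] {a b c w : Module.End F V}
  {ta da tb db tc dc lam : F}

theorem conjugate_conjugate_apply
    (ha : ∀ x, a (a x) = ta • a x - da • x) (hb : ∀ x, b (b x) = tb • b x - db • x)
    (habc : ∀ x, a (b (c x)) = lam • x + w x) (z : V) :
    tb • (ta • (lam • z + w z) - a (lam • z + w z))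
      - b (ta • (lam • z + w z) - a (lam • z + w z)) = (da * db) • c z := by
  rw [← habc z, ha]
  simp only [map_sub, map_smul, hb]
  module

/-- If `a * b * c` is `lam • 1` modulo `W`, then `b * a` is, modulo `W`, `a W`, `b W` and `b (a W)`,
a linear combination of `1`, `a`, `b` and `a * b`. -/
theorem apply_apply_mem_of_quadratic_product
    (ha : ∀ x, a (a x) = ta • a x - da • x) (hb : ∀ x, b (b x) = tb • b x - db • x)
    (hc : ∀ x, c (c x) = tc • c x - dc • x) (hlam : lam ≠ 0)
    (habc : ∀ x, a (b (c x)) = lam • x + w x) {W S : Submodule F V} (hw : ∀ x, w x ∈ W)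
    (h1 : ∀ x ∈ W, x ∈ S) (h2 : ∀ x ∈ W, a x ∈ S) (h3 : ∀ x ∈ W, b x ∈ S)
    (h4 : ∀ x ∈ W, b (a x) ∈ S) {z : V} (hz : z ∈ S) (haz : a z ∈ S) (hbz : b z ∈ S)
    (habz : a (b z) ∈ S) : b (a z) ∈ S := by
  have e1 := conjugate_conjugate_apply ha hb habc z
  have e2 := habc (c z)
  rw [hc, map_sub, map_sub, map_smul, map_smul, map_smul, map_smul, habc z] at e2
  have key : (lam ^ 2) • b (a z) =
      (da * db) • (tc • (lam • z + w z) - dc • a (b z) - w (c z))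
      - (lam ^ 2 * tb * ta) • z + (lam ^ 2 * tb) • a z + (lam ^ 2 * ta) • b z
      - lam • ((tb * ta) • w z - tb • a (w z) - ta • b (w z) + b (a (w z))) := by
    simp only [map_sub, map_add, map_smul] at e1
    linear_combination (norm := module) lam • e1 - (da * db) • e2
  rw [← S.smul_mem_iff (pow_ne_zero 2 hlam), key]
  have hs : ∀ (r : F) {x : V}, x ∈ S → r • x ∈ S := fun r _ hx ↦ S.smul_mem r hx
  have m1 := h1 _ (hw z)
  have m2 := h2 _ (hw z)
  have m3 := h3 _ (hw z)
  have m4 := h4 _ (hw z)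
  have m5 := h1 _ (hw (c z))
  refine S.sub_mem (S.add_mem (S.add_mem (S.sub_mem (hs _ (S.sub_mem (S.sub_mem
    (hs _ (S.add_mem (hs _ hz) m1)) (hs _ habz)) m5)) (hs _ hz)) (hs _ haz)) (hs _ hbz))
    (hs _ (S.add_mem (S.sub_mem (S.sub_mem (hs _ m1) (hs _ m2)) (hs _ m3)) m4))

/-- The sum of the images of `W` under `1`, `a`, `b`, `b * a`, `a * b` and `a * b * a`. -/
def alternatingSpan (a b : Module.End F V) (W : Submodule F V) : Submodule F V :=
  W ⊔ W.map a ⊔ W.map b ⊔ W.map (b * a) ⊔ W.map (a * b) ⊔ W.map (a * b * a)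

theorem alternatingSpan_le_iff {W S : Submodule F V} :
    alternatingSpan a b W ≤ S ↔ (∀ x ∈ W, x ∈ S) ∧ (∀ x ∈ W, a x ∈ S) ∧ (∀ x ∈ W, b x ∈ S) ∧
      (∀ x ∈ W, b (a x) ∈ S) ∧ (∀ x ∈ W, a (b x) ∈ S) ∧ (∀ x ∈ W, a (b (a x)) ∈ S) := by
  simp only [alternatingSpan, sup_le_iff, Submodule.map_le_iff_le_comap, and_assoc]
  rfl

theorem rank_alternatingSpan_le (W : Submodule F V) :
    Module.rank F (alternatingSpan a b W) ≤ 6 * Module.rank F W := by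
  have hm (f : Module.End F V) : Module.rank F (W.map f) ≤ Module.rank F W := rank_map_le f W
  have hs (S T : Submodule F V) (n : Cardinal) (h : Module.rank F S ≤ n * Module.rank F W)
      (hT : Module.rank F T ≤ Module.rank F W) :
      Module.rank F (S ⊔ T : Submodule F V) ≤ (n + 1) * Module.rank F W := by
    rw [add_mul, one_mul]
    exact (Submodule.rank_add_le_rank_add_rank S T).trans (add_le_add h hT)
  have h := hs _ _ _ (hs _ _ _ (hs _ _ _ (hs _ _ _ (hs _ _ _ (one_mul (Module.rank F W)).ge
    (hm a)) (hm b)) (hm (b * a))) (hm (a * b))) (hm (a * b * a))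
  refine h.trans (le_of_eq ?_)
  norm_num

theorem alternatingSpan_stable
    (ha : ∀ x, a (a x) = ta • a x - da • x) (hb : ∀ x, b (b x) = tb • b x - db • x)
    (hc : ∀ x, c (c x) = tc • c x - dc • x) (hda : da ≠ 0) (hdb : db ≠ 0) (hlam : lam ≠ 0)
    (habc : ∀ x, a (b (c x)) = lam • x + w x) {W : Submodule F V} (hw : ∀ x, w x ∈ W) :
    (∀ x ∈ alternatingSpan a b W, a x ∈ alternatingSpan a b W) ∧
    (∀ x ∈ alternatingSpan a b W, b x ∈ alternatingSpan a b W) ∧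
    (∀ x ∈ alternatingSpan a b W, c x ∈ alternatingSpan a b W) := by
  set S := alternatingSpan a b W with hS
  obtain ⟨m1, ma, mb, mba, mab, maba⟩ := alternatingSpan_le_iff.1 hS.ge
  have hs : ∀ (r : F) {x : V}, x ∈ S → r • x ∈ S := fun r _ hx ↦ S.smul_mem r hx
  have hba {z : V} := apply_apply_mem_of_quadratic_product ha hb hc hlam habc hw m1 ma mb mba
    (z := z)
  have hSa : ∀ x ∈ S, a x ∈ S := by
    have haa {x : V} (hx : x ∈ S) (hax : a x ∈ S) : a (a x) ∈ S := by
      rw [ha]; exact S.sub_mem (hs _ hax) (hs _ hx)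
    change S ≤ S.comap a
    refine alternatingSpan_le_iff.2 ⟨ma, fun x hx ↦ haa (m1 x hx) (ma x hx), mab, maba,
      fun x hx ↦ haa (mb x hx) (mab x hx), fun x hx ↦ haa (mba x hx) (maba x hx)⟩
  have hSb : ∀ x ∈ S, b x ∈ S := by
    have hbb {x : V} (hx : x ∈ S) (hbx : b x ∈ S) : b (b x) ∈ S := by
      rw [hb]; exact S.sub_mem (hs _ hbx) (hs _ hx)
    have hbab {x : V} (hx : x ∈ S) (hbx : b x ∈ S) : b (a (b x)) ∈ S :=
      hba hbx (hSa _ hbx) (hbb hx hbx) (hSa _ (hbb hx hbx))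
    change S ≤ S.comap b
    refine alternatingSpan_le_iff.2 ⟨mb, mba, fun x hx ↦ hbb (m1 x hx) (mb x hx),
      fun x hx ↦ hbb (ma x hx) (mba x hx), fun x hx ↦ hbab (m1 x hx) (mb x hx),
      fun x hx ↦ hbab (ma x hx) (mba x hx)⟩
  refine ⟨hSa, hSb, fun z hz ↦ ?_⟩
  rw [← S.smul_mem_iff (mul_ne_zero hda hdb), ← conjugate_conjugate_apply ha hb habc z]
  have hy : lam • z + w z ∈ S := S.add_mem (hs _ hz) (m1 _ (hw z))
  have hy' := S.sub_mem (hs ta hy) (hSa _ hy)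
  exact S.sub_mem (hs _ hy') (hSb _ hy')

end QuadraticProduct

theorem invariant_subspace_lemma
    {F V : Type*} [Field F] [AddCommGroup V] [Module F V]
    (a b c : V ≃ₗ[F] V)
    (ha : ∃ p : F[X], p.degree = 2 ∧ aeval (a : Module.End F V) p = 0)
    (hb : ∃ p : F[X], p.degree = 2 ∧ aeval (b : Module.End F V) p = 0)
    (hc : ∃ p : F[X], p.degree = 2 ∧ aeval (c : Module.End F V) p = 0)
    (lam : F) (hlam : lam ≠ 0) (w : Module.End F V)
    (heq : lam • (1 : Module.End F V) + w =
      (a : Module.End F V) * (b : Module.End F V) * (c : Module.End F V))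
    (W : Submodule F V) (hW : LinearMap.range w ≤ W) :
    ∃ Wb : Submodule F V, W ≤ Wb ∧
      (∀ x ∈ Wb, a x ∈ Wb) ∧ (∀ x ∈ Wb, b x ∈ Wb) ∧ (∀ x ∈ Wb, c x ∈ Wb) ∧
      Module.rank F Wb ≤ 8 * Module.rank F W ∧
      (ℵ₀ ≤ Module.rank F V → Module.rank F W < Module.rank F V →
        Module.rank F Wb < Module.rank F V) := by
  obtain ⟨ta, da, hda, ha⟩ := exists_apply_apply_eq_of_quadratic a ha
  obtain ⟨tb, db, hdb, hb⟩ := exists_apply_apply_eq_of_quadratic b hb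
  obtain ⟨tc, dc, -, hc⟩ := exists_apply_apply_eq_of_quadratic c hc
  obtain ⟨hSa, hSb, hSc⟩ := alternatingSpan_stable (a := (a : Module.End F V)) (b := b) (c := c)
    ha hb hc hda hdb hlam (fun x ↦ (LinearMap.congr_fun heq x).symm)
    (fun x ↦ hW (LinearMap.mem_range_self w x))
  have hrank : Module.rank F (alternatingSpan (a : Module.End F V) b W) ≤ 8 * Module.rank F W :=
    (rank_alternatingSpan_le W).trans (mul_le_mul_left (by norm_num) _)
  refine ⟨alternatingSpan (a : Module.End F V) b W, (alternatingSpan_le_iff.1 le_rfl).1,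
    hSa, hSb, hSc, hrank, fun hV hlt ↦ hrank.trans_lt (mul_lt_of_lt hV ?_ hlt)⟩
  exact (natCast_lt_aleph0 (n := 8)).trans_le hV
end

section
/- Let F be a field, V an infinite-dimensional F-vector space, and u a linear automorphism of V. Suppose there exists a vector x ∈ V such that V is spanned by the family (u^k(x))_{k∈ℤ} of iterates of u and u⁻¹ applied to x. Then the family (u^k(x))_{k∈ℤ} is linearly independent over F (hence is a basis of V, so u is super-elementary). -/
open Cardinal

/-- A vector killed by a nonzero polynomial in `f` generates a finite-dimensional cyclic
subspace. -/
theorem finite_range_aeval_apply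
    {F V : Type*} [Field F] [AddCommGroup V] [Module F V] (f : Module.End F V) (x : V)
    {p : Polynomial F} (hp : p ≠ 0) (hpx : Polynomial.aeval f p x = 0) :
    Module.Finite F
      (LinearMap.range ((LinearMap.applyₗ x).comp (Polynomial.aeval (R := F) f).toLinearMap)) := by
  set φ := (LinearMap.applyₗ x).comp (Polynomial.aeval (R := F) f).toLinearMap
  have hle : LinearMap.range φ ≤ (Polynomial.degreeLT F p.natDegree).map φ := by
    rintro _ ⟨q, rfl⟩
    refine ⟨q % p, ?_, ?_⟩
    · rw [SetLike.mem_coe, Polynomial.mem_degreeLT, ← Polynomial.degree_eq_natDegree hp]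
      exact Polynomial.degree_mod_lt q hp
    · conv_rhs => rw [← EuclideanDomain.mod_add_div q p, mul_comm]
      simp [φ, hpx]
  have : Module.Finite F (Polynomial.degreeLT F p.natDegree) :=
    Module.Finite.equiv (Polynomial.degreeLTEquiv F p.natDegree).symm
  exact Submodule.finiteDimensional_of_le hle

/-- A linear dependence between the integer iterates of `u` on `x` yields a nonzero polynomial
in `u` killing `x`. -/
theorem exists_aeval_apply_eq_zero_of_not_linearIndependent
    {F V : Type*} [Field F] [AddCommGroup V] [Module F V] (u : V ≃ₗ[F] V) (x : V)
    (h : ¬ LinearIndependent F (fun k : ℤ => (u ^ k) x)) :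
    ∃ p : Polynomial F, p ≠ 0 ∧ Polynomial.aeval (u : Module.End F V) p x = 0 := by
  obtain ⟨s, g, hg, i, his, hi⟩ := not_linearIndependent_iff.mp h
  obtain ⟨b, hb⟩ := s.bddBelow
  have hb' : ∀ j ∈ s, b ≤ j := fun j hj => hb hj
  refine ⟨∑ j ∈ s, Polynomial.monomial (j - b).toNat (g j), fun h0 => hi ?_, ?_⟩
  · have hc := congrArg (fun p => Polynomial.coeff p (i - b).toNat) h0
    simp only [Polynomial.finsetSum_coeff, Polynomial.coeff_monomial,
      Polynomial.coeff_zero] at hc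
    rw [Finset.sum_eq_single_of_mem i his] at hc
    · simpa using hc
    · intro j hj hji
      have := hb' j hj
      have := hb' i his
      exact if_neg (by omega)
  · have hpow : ∀ (n : ℕ) (y : V), ((u : Module.End F V) ^ n) y = (u ^ n) y := by
      intro n y
      induction n with
      | zero => simp
      | succ n ih => rw [pow_succ', pow_succ', Module.End.mul_apply, ih]; rfl
    have hs := congrArg (u ^ (-b)) hg
    rw [map_sum, map_zero] at hs
    rw [map_sum, LinearMap.sum_apply, ← hs]
    refine Finset.sum_congr rfl fun j hj => ?_
    have := hb' j hj
    rw [Polynomial.aeval_monomial, Module.End.mul_apply, hpow, Module.algebraMap_end_apply,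
      map_smul, ← LinearEquiv.mul_apply, ← zpow_add, ← zpow_natCast,
      Int.toNat_of_nonneg (by omega), sub_eq_neg_add]

theorem linearIndependent_of_span_orbit
    {F V : Type*} [Field F] [AddCommGroup V] [Module F V]
    (hV : ℵ₀ ≤ Module.rank F V) (u : V ≃ₗ[F] V) (x : V)
    (hspan : Submodule.span F (Set.range fun k : ℤ => (u ^ k) x) = ⊤) :
    LinearIndependent F (fun k : ℤ => (u ^ k) x) := by
  by_contra h
  obtain ⟨p, hp, hpx⟩ := exists_aeval_apply_eq_zero_of_not_linearIndependent u x h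
  have hfin := finite_range_aeval_apply _ x hp hpx
  set W := LinearMap.range
    ((LinearMap.applyₗ x).comp (Polynomial.aeval (R := F) (u : Module.End F V)).toLinearMap)
  have hxW : x ∈ W := ⟨1, by simp⟩
  have hle : W.map (u : V →ₗ[F] V) ≤ W := by
    rintro _ ⟨_, ⟨q, rfl⟩, rfl⟩
    exact ⟨Polynomial.X * q, by simp⟩
  have hmap : W.map (u : V →ₗ[F] V) = W :=
    Submodule.eq_of_le_of_finrank_eq hle (LinearEquiv.finrank_map_eq u W)
  have hmem : ∀ y, u y ∈ W ↔ y ∈ W := by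
    intro y
    conv_lhs => rw [← hmap]
    simp
  have horbit : ∀ k : ℤ, (u ^ k) x ∈ W := by
    intro k
    induction k using Int.induction_on with
    | zero => simpa using hxW
    | succ n ih => rwa [add_comm, zpow_one_add, LinearEquiv.mul_apply, hmem]
    | pred n ih => rwa [← hmem, ← LinearEquiv.mul_apply, ← zpow_one_add, add_sub_cancel]
  have htop : W = ⊤ := by
    rw [eq_top_iff, ← hspan, Submodule.span_le]
    rintro _ ⟨k, rfl⟩
    exact horbit k
  have : Module.Finite F V := Module.finite_def.mpr (htop ▸ Module.Finite.iff_fg.mp hfin)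
  exact hV.not_gt (Module.rank_lt_aleph0 F V)
end

section
/- Let F be a field, V an infinite-dimensional F-vector space, and u a linear automorphism of V having a dominant eigenvalue. Let p ∈ F[t] be a non-derogatory polynomial of degree 2. Then there exists a linear automorphism a of V with p(a) = 0 such that the automorphism a ∘ u has no dominant eigenvalue, i.e. rank(a ∘ u − λ·id_V) = dim V for every λ ∈ F. -/
open Cardinal Polynomial

/-- A vector space of infinite dimension carries an endomorphism, made of companion blocks of
`t ^ 2 + b t + d`, such that some linear map `j` makes every combination `l • f - m • 1` with
`l ≠ 0` injective on its image. -/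
theorem exists_quadratic_end_forall_injective_comp
    {F V : Type*} [Field F] [AddCommGroup V] [Module F V]
    (hV : ℵ₀ ≤ Module.rank F V) (b d : F) :
    ∃ f j : Module.End F V, f * f + b • f + d • 1 = 0 ∧
      ∀ l m : F, l ≠ 0 → Function.Injective ((l • f - m • 1) * j : Module.End F V) := by
  have hrank : Module.rank F V = Module.rank F (V × V) := by
    rw [rank_prod', Cardinal.add_eq_self hV]
  let e : V ≃ₗ[F] V × V := LinearEquiv.ofRankEq V (V × V) hrank
  let g : V × V →ₗ[F] V × V :=
    ((-d) • LinearMap.snd F V V).prod (LinearMap.fst F V V - b • LinearMap.snd F V V)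
  refine ⟨e.symm.toLinearMap ∘ₗ g ∘ₗ e.toLinearMap, e.symm.toLinearMap ∘ₗ LinearMap.inl F V V,
    ?_, ?_⟩
  · ext x
    apply e.injective
    ext
    · simp [g]
      module
    · simp [g]
  · intro l m hl
    rw [injective_iff_map_eq_zero]
    intro x hx
    have h := congrArg (fun v => (e v).2) hx
    simpa [g, hl] using h

/-- An endomorphism satisfying a monic quadratic equation with nonzero constant term is an
automorphism. -/
theorem exists_linearEquiv_coe_eq_of_quadratic
    {F V : Type*} [Field F] [AddCommGroup V] [Module F V] {b d : F} (hd : d ≠ 0)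
    {f : Module.End F V} (hf : f * f + b • f + d • 1 = 0) :
    ∃ a : V ≃ₗ[F] V, (a : Module.End F V) = f := by
  have key (x : V) : f (f x) + b • f x + d • x = 0 := by
    simpa using LinearMap.congr_fun hf x
  have hinv (x : V) : (-d⁻¹) • (f (f x) + b • f x) = x := by
    rw [eq_neg_of_add_eq_zero_left (key x), smul_neg, neg_smul, neg_neg, inv_smul_smul₀ hd]
  refine ⟨LinearEquiv.ofLinearMap f ((-d⁻¹) • (f + b • 1)) ?_ ?_, rfl⟩
  · ext x
    simpa using hinv x
  · ext x
    simpa using hinv x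

theorem adjacent_to_automorphism_without_dominant_eigenvalue
    {F V : Type*} [Field F] [AddCommGroup V] [Module F V]
    (hV : ℵ₀ ≤ Module.rank F V) (u : V ≃ₗ[F] V)
    (hdom : ∃ lam : F,
      LinearMap.rank ((u : Module.End F V) - lam • 1) < Module.rank F V)
    (p : F[X]) (hp : p.degree = 2 ∧ p.eval 0 ≠ 0) :
    ∃ a : V ≃ₗ[F] V, aeval (a : Module.End F V) p = 0 ∧
      ∀ lam : F,
        LinearMap.rank ((a : Module.End F V) * (u : Module.End F V) - lam • 1) =
          Module.rank F V := by
  obtain ⟨l, hl⟩ := hdom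
  obtain ⟨hdeg, hp0⟩ := hp
  have hl0 : l ≠ 0 := by
    rintro rfl
    rw [zero_smul, sub_zero, LinearMap.rank, LinearEquiv.range, rank_top] at hl
    exact lt_irrefl _ hl
  have hc2 : p.coeff 2 ≠ 0 := coeff_ne_zero_of_eq_degree hdeg
  rw [← coeff_zero_eq_eval_zero] at hp0
  obtain ⟨f, j, hf, hinj⟩ := exists_quadratic_end_forall_injective_comp hV
    (p.coeff 1 / p.coeff 2) (p.coeff 0 / p.coeff 2)
  obtain ⟨a, rfl⟩ := exists_linearEquiv_coe_eq_of_quadratic (div_ne_zero hp0 hc2) hf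
  refine ⟨a, ?_, fun m => le_antisymm (LinearMap.rank_le_range _) ?_⟩
  · set f : Module.End F V := (a : Module.End F V)
    have hpf : aeval f p = p.coeff 2 • (f * f + (p.coeff 1 / p.coeff 2) • f +
        (p.coeff 0 / p.coeff 2) • 1) := by
      conv_lhs => rw [eq_quadratic_of_degree_le_two hdeg.le]
      simp [Algebra.algebraMap_eq_smul_one, smul_smul, mul_div_cancel₀, hc2, pow_two]
    rw [hpf, hf, smul_zero]
  · set f : Module.End F V := (a : Module.End F V)
    set w : Module.End F V := (u : Module.End F V) - l • 1 with hw
    by_contra! hlt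
    have hdecomp : l • f - m • 1 = (f * (u : Module.End F V) - m • 1) + (-f) * w := by
      rw [hw, mul_sub, neg_mul, mul_smul_comm, mul_one]
      simp only [smul_neg]
      abel
    have h1 : Module.rank F V ≤ LinearMap.rank (l • f - m • 1) := by
      rw [← rank_range_of_injective _ (hinj l m hl0)]
      exact LinearMap.rank_comp_le_left j (l • f - m • 1)
    have h2 : LinearMap.rank ((-f) * w) < Module.rank F V :=
      (LinearMap.rank_comp_le_right w (-f)).trans_lt hl
    rw [hdecomp] at h1
    exact absurd (h1.trans (LinearMap.rank_add_le _ _)) (Cardinal.add_lt_of_lt hV hlt h2).not_ge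
end
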